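/- There exist constants c > 0 and C > 0 such that for all integers m ≥ 1, all real y ≥ 3, and all integers j with 1 ≤ j ≤ y^{1/4}, one has |a_m(j, y)| ≤ C·√ψ(m)/(j·𝓛(2j)^{2c}), where a_m(j, y) := ∑_{y/(j+1) < δ ≤ y/j, gcd(δ, m) = 1} (δ·μ(δ)²/ψ(δ)²) (∑_{d ≤ j} μ(dδ)/ψ_m(d))² and 𝓛 is evaluated at max(3, 2j). -/

import Mathlib

open Finset MeasureTheory Filter

/-- `M(n, z) := ∑_{d ∣ n, d ≤ z} μ(d)`. -/
noncomputable def mobM (n : ℕ) (z : ℝ) : ℤ :=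
  ∑ d ∈ n.divisors.filter (fun d : ℕ => (d : ℝ) ≤ z), ArithmeticFunction.moebius d

/-- `S(x, z) := ∑_{n ≤ x} M(n, z)²`. -/
noncomputable def Ssum (x z : ℝ) : ℝ :=
  ∑ n ∈ Finset.Icc 1 ⌊x⌋₊, ((mobM n z : ℝ)) ^ 2

/-- `S(z) := ∑_{m, n ≤ z} μ(m) μ(n) / [m, n]`. -/
noncomputable def Sz (z : ℝ) : ℝ :=
  ∑ m ∈ Finset.Icc 1 ⌊z⌋₊, ∑ n ∈ Finset.Icc 1 ⌊z⌋₊,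
    ((ArithmeticFunction.moebius m : ℝ) * (ArithmeticFunction.moebius n : ℝ)) / (Nat.lcm m n : ℝ)

/-- `f(n; iτ) := ∏_{p ∣ n} |1 - p^{-iτ}|²`. -/
noncomputable def fI (n : ℕ) (τ : ℝ) : ℝ :=
  ∏ p ∈ n.primeFactors, ‖(1 : ℂ) - (p : ℂ) ^ (-(τ * Complex.I))‖ ^ 2

/-- `f(n; s) := ∏_{p ∣ n} |1 - p^{-s}|²` for complex `s`. -/
noncomputable def fC (n : ℕ) (s : ℂ) : ℝ :=
  ∏ p ∈ n.primeFactors, ‖(1 : ℂ) - (p : ℂ) ^ (-s)‖ ^ 2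

/-- The constant `L`. -/
noncomputable def Lconst : ℝ :=
  (1 / (2 * Real.pi)) *
    ∫ τ : ℝ,
      (∏' p : Nat.Primes,
        (1 - 1 / ((p : ℕ) : ℝ)) * (1 + (fI (p : ℕ) τ - 1) / ((p : ℕ) : ℝ))) / τ ^ 2

/-- `𝓛(y) := exp{(log y)^{3/5} / (log log y)^{1/5}}`. -/
noncomputable def curlyL (y : ℝ) : ℝ :=
  Real.exp ((Real.log y) ^ ((3 : ℝ) / 5) / (Real.log (Real.log y)) ^ ((1 : ℝ) / 5))

/-- `ψ(n) := ∏_{p ∣ n} (p + 1)`. -/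
def psi (n : ℕ) : ℕ := ∏ p ∈ n.primeFactors, (p + 1)

/-- `ψ_m(n) := ∏_{p ∣ n, p ∤ m} (p + 1)`. -/
def psiM (m n : ℕ) : ℕ := ∏ p ∈ n.primeFactors.filter (fun p : ℕ => ¬ p ∣ m), (p + 1)

/-- `r(n) := ∏_{p ∣ n} (1 + 2/√p)`. -/
noncomputable def rfun (n : ℕ) : ℝ := ∏ p ∈ n.primeFactors, (1 + 2 / Real.sqrt p)

/-- `k(n)`, the squarefree kernel of `n`. -/
def ker (n : ℕ) : ℕ := ∏ p ∈ n.primeFactors, p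

/-- `T(y; m) := (6/π²) ∑_{d, t ≤ y} μ(d) μ(t) / ψ([d, t, m])`. -/
noncomputable def T (y : ℝ) (m : ℕ) : ℝ :=
  (6 / Real.pi ^ 2) *
    ∑ d ∈ Finset.Icc 1 ⌊y⌋₊, ∑ t ∈ Finset.Icc 1 ⌊y⌋₊,
      ((ArithmeticFunction.moebius d : ℝ) * (ArithmeticFunction.moebius t : ℝ)) /
        (psi (Nat.lcm (Nat.lcm d t) m) : ℝ)

/-- The constant `L(m)`. -/
noncomputable def Lm (m : ℕ) : ℝ :=
  ((Nat.totient m : ℝ) ^ 2 / (2 * Real.pi * (m : ℝ) ^ 2 * (ker m : ℝ))) *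
    ∫ τ : ℝ,
      (fI m τ *
        ∏' p : {p : Nat.Primes // ¬ ((p : ℕ) ∣ m)},
          (1 - 1 / ((p.1 : ℕ) : ℝ)) ^ 2 * (1 + fI (p.1 : ℕ) τ / ((p.1 : ℕ) : ℝ))) / τ ^ 2

/-- `B := ∏_p (1 - (3p + 1)/(p (p + 1)²))`. -/
noncomputable def Bconst : ℝ :=
  ∏' p : Nat.Primes,
    (1 - (3 * ((p : ℕ) : ℝ) + 1) / (((p : ℕ) : ℝ) * (((p : ℕ) : ℝ) + 1) ^ 2))

/-- `α(n) := ∏_{p ∣ n} (1 - p/(p² + 3p + 1))`. -/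
noncomputable def alpha (n : ℕ) : ℝ :=
  ∏ p ∈ n.primeFactors, (1 - (p : ℝ) / ((p : ℝ) ^ 2 + 3 * (p : ℝ) + 1))

/-- The number of pairs in `I × I` with equal image under `Φ`. -/
def energy {ι G : Type*} [DecidableEq G] (I : Finset ι) (Φ : ι → G) : ℕ :=
  #{q ∈ I ×ˢ I | Φ q.1 = Φ q.2}

section Energy

variable {ι κ τ G : Type*} [DecidableEq G]

lemma energy_eq_sum (I : Finset ι) (Φ : ι → G) :
    energy I Φ = ∑ a ∈ I, #{b ∈ I | Φ b = Φ a} := by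
  classical
  unfold energy
  rw [card_filter, sum_product]
  refine sum_congr rfl fun a _ => ?_
  rw [card_filter]
  refine sum_congr rfl fun b _ => ?_
  simp only [eq_comm]

lemma energy_eq_sum_sq (I : Finset ι) (Φ : ι → G) (V : Finset G) (hV : ∀ a ∈ I, Φ a ∈ V) :
    energy I Φ = ∑ v ∈ V, #{b ∈ I | Φ b = v} ^ 2 := by
  classical
  rw [energy_eq_sum, ← sum_fiberwise_of_maps_to hV]
  refine sum_congr rfl fun v _ => ?_
  rw [sum_congr rfl (g := fun _ => #{b ∈ I | Φ b = v})]
  · rw [sum_const, smul_eq_mul, sq]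
  · intro a ha
    rw [(mem_filter.1 ha).2]

lemma energy_le_of_injOn {G' : Type*} [DecidableEq G'] {I : Finset ι} {Φ : ι → G} {I' : Finset κ}
    {Φ' : κ → G'} (f : ι → κ) (hf : Set.InjOn f I) (hmaps : ∀ a ∈ I, f a ∈ I')
    (h : ∀ a ∈ I, ∀ b ∈ I, Φ a = Φ b → Φ' (f a) = Φ' (f b)) : energy I Φ ≤ energy I' Φ' := by
  classical
  unfold energy
  refine card_le_card_of_injOn (fun q => (f q.1, f q.2)) ?_ ?_
  · intro q hq
    simp only [coe_filter, mem_product, Set.mem_ofPred_eq] at hq ⊢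
    exact ⟨⟨hmaps _ hq.1.1, hmaps _ hq.1.2⟩, h _ hq.1.1 _ hq.1.2 hq.2⟩
  · intro q hq r hr hqr
    simp only [coe_filter, mem_product, Set.mem_ofPred_eq] at hq hr
    simp only [Prod.mk.injEq] at hqr
    exact Prod.ext (hf hq.1.1 hr.1.1 hqr.1) (hf hq.1.2 hr.1.2 hqr.2)

lemma energy_le_sq (I : Finset ι) (Φ : ι → G) : energy I Φ ≤ #I ^ 2 := by
  unfold energy
  refine (card_filter_le _ _).trans ?_
  rw [card_product, sq]

lemma energy_le_of_cover {I : Finset ι} {Φ : ι → G} (T : Finset τ) (J : τ → Finset ι)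
    (h : ∀ a ∈ I, ∃ t ∈ T, a ∈ J t) : energy I Φ ≤ #T * ∑ t ∈ T, energy (J t) Φ := by
  classical
  set V : Finset G := (I ∪ T.biUnion J).image Φ
  have hI : ∀ a ∈ I, Φ a ∈ V := fun a ha => mem_image_of_mem _ (mem_union_left _ ha)
  have hJ : ∀ t ∈ T, ∀ a ∈ J t, Φ a ∈ V := fun t ht a ha =>
    mem_image_of_mem _ (mem_union_right _ (mem_biUnion.2 ⟨t, ht, ha⟩))
  rw [energy_eq_sum_sq I Φ V hI, sum_congr rfl fun t ht => energy_eq_sum_sq (J t) Φ V (hJ t ht),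
    sum_comm, mul_sum]
  refine sum_le_sum fun v _ => ?_
  refine le_trans ?_ (sq_sum_le_card_mul_sum_sq (s := T) (f := fun t => #{b ∈ J t | Φ b = v}))
  gcongr
  refine le_trans (card_le_card ?_) card_biUnion_le
  intro b hb
  obtain ⟨hb, hv⟩ := mem_filter.1 hb
  obtain ⟨t, ht, hbt⟩ := h b hb
  exact mem_biUnion.2 ⟨t, ht, mem_filter.2 ⟨hbt, hv⟩⟩

lemma energy_union_le {I J K : Finset ι} (Φ : ι → G) (h : ∀ a ∈ I, a ∈ J ∨ a ∈ K) :
    energy I Φ ≤ 2 * (energy J Φ + energy K Φ) := by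
  have := energy_le_of_cover (I := I) (Φ := Φ) (univ : Finset Bool) (fun b => if b then J else K)
    (fun a ha => by
      rcases h a ha with h | h
      · exact ⟨true, mem_univ _, by simpa using h⟩
      · exact ⟨false, mem_univ _, by simpa using h⟩)
  simpa using this

/-- The number of solutions of `Φ a = Φ b + v` is largest for `v = 0`. -/
lemma card_shift_le_energy [AddCommGroup G] (I : Finset ι) (Φ : ι → G) (v : G) :
    #{q ∈ I ×ˢ I | Φ q.1 = Φ q.2 + v} ≤ energy I Φ := by
  classical
  set V : Finset G := I.image Φ ∪ I.image (fun a => Φ a - v) with hV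
  have h1 : ∀ a ∈ I, Φ a ∈ V := fun a ha => mem_union_left _ (mem_image_of_mem _ ha)
  have h2 : ∀ a ∈ I, Φ a - v ∈ V := fun a ha =>
    mem_union_right _ (mem_image_of_mem (fun a => Φ a - v) ha)
  have e1 := energy_eq_sum_sq I Φ V h1
  have e2 : energy I Φ = energy I (fun a => Φ a - v) := by
    unfold energy
    congr 1
    refine filter_congr fun q _ => ?_
    simp
  rw [energy_eq_sum_sq I (fun a => Φ a - v) V h2] at e2
  have e3 : #{q ∈ I ×ˢ I | Φ q.1 = Φ q.2 + v} =
      ∑ w ∈ V, #{b ∈ I | Φ b - v = w} * #{b ∈ I | Φ b = w} := by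
    rw [card_eq_sum_card_fiberwise (f := fun q : ι × ι => Φ q.2) (t := V)]
    · refine sum_congr rfl fun w _ => ?_
      rw [← card_product]
      congr 1
      ext q
      simp only [mem_filter, mem_product]
      constructor
      · rintro ⟨⟨⟨a, b⟩, c⟩, d⟩
        exact ⟨⟨a, by rw [c, d]; simp⟩, b, d⟩
      · rintro ⟨⟨a, c⟩, b, d⟩
        exact ⟨⟨⟨a, b⟩, by rw [d, ← c]; simp⟩, d⟩
    · intro q hq
      simp only [coe_filter, mem_product, Set.mem_ofPred_eq] at hq
      exact h1 _ hq.1.2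
  have h4 : 2 * #{q ∈ I ×ˢ I | Φ q.1 = Φ q.2 + v} ≤ 2 * energy I Φ := by
    rw [e3, two_mul (energy I Φ)]
    nth_rw 1 [e2]
    rw [e1, ← sum_add_distrib, mul_sum]
    refine sum_le_sum fun w _ => ?_
    rw [← mul_assoc]
    exact two_mul_le_add_sq _ _
  omega

end Energy

section TorusFourier

open UnitAddTorus

variable {ι κ : Type*} {k : ℕ}

/-- Normalised Haar measure on the `k`-dimensional unit torus. -/
noncomputable def torusMeasure (k : ℕ) : Measure (UnitAddTorus (Fin k)) :=
  Measure.pi fun _ => AddCircle.haarAddCircle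

instance (k : ℕ) : IsProbabilityMeasure (torusMeasure k) := by
  unfold torusMeasure
  infer_instance

lemma integral_mFourier (v : Fin k → ℤ) :
    ∫ x, mFourier v x ∂torusMeasure k = if v = 0 then 1 else 0 := by
  have h := (orthonormal_iff_ite.1 (orthonormal_mFourier (d := Fin k))) 0 v
  rw [ContinuousMap.inner_toLp] at h
  simp only [mFourier_zero, ContinuousMap.coe_one, Pi.one_apply, map_one, mul_one,
    eq_comm (a := (0 : Fin k → ℤ))] at h
  exact h

lemma integrable_torus {E : Type*} [NormedAddCommGroup E] {f : UnitAddTorus (Fin k) → E}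
    (hf : Continuous f) : Integrable f (torusMeasure k) :=
  hf.integrable_of_hasCompactSupport (HasCompactSupport.of_compactSpace f)

/-- The exponential sum attached to `Φ` over `I`. -/
noncomputable def expSum (I : Finset ι) (Φ : ι → Fin k → ℤ) (x : UnitAddTorus (Fin k)) : ℂ :=
  ∑ a ∈ I, mFourier (Φ a) x

lemma continuous_expSum (I : Finset ι) (Φ : ι → Fin k → ℤ) : Continuous (expSum I Φ) := by
  unfold expSum
  fun_prop

lemma energy_eq_integral (I : Finset ι) (Φ : ι → Fin k → ℤ) :
    (energy I Φ : ℝ) = ∫ x, ‖expSum I Φ x‖ ^ 2 ∂torusMeasure k := by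
  have h1 : ∀ x, ((‖expSum I Φ x‖ ^ 2 : ℝ) : ℂ) =
      ∑ a ∈ I, ∑ b ∈ I, mFourier (Φ a - Φ b) x := by
    intro x
    rw [Complex.ofReal_pow, ← Complex.mul_conj']
    unfold expSum
    rw [map_sum, sum_mul_sum]
    refine sum_congr rfl fun a _ => sum_congr rfl fun b _ => ?_
    rw [← mFourier_neg, ← mFourier_add, sub_eq_add_neg]
  have h2 : ((energy I Φ : ℝ) : ℂ) =
      ((∫ x, ‖expSum I Φ x‖ ^ 2 ∂torusMeasure k : ℝ) : ℂ) := by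
    rw [← integral_complex_ofReal]
    simp_rw [h1]
    rw [integral_finsetSum]
    · rw [energy, card_filter, sum_product]
      push_cast
      refine sum_congr rfl fun a _ => ?_
      rw [integral_finsetSum]
      · refine sum_congr rfl fun b _ => ?_
        rw [integral_mFourier]
        simp only [sub_eq_zero]
        split_ifs <;> simp
      · intro b _
        exact integrable_torus (by fun_prop)
    · intro a _
      exact integrable_torus (by fun_prop)
  exact_mod_cast h2

lemma mFourier_sum (s : Finset κ) (f : κ → Fin k → ℤ) (x : UnitAddTorus (Fin k)) :
    mFourier (∑ i ∈ s, f i) x = ∏ i ∈ s, mFourier (f i) x := by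
  classical
  induction s using Finset.induction_on with
  | empty => simp [mFourier_zero]
  | insert i s hi ih => rw [sum_insert hi, prod_insert hi, mFourier_add, ih]

lemma expSum_piFinset [Fintype κ] [DecidableEq κ] (W : κ → Finset ι) (φ : ι → Fin k → ℤ)
    (x : UnitAddTorus (Fin k)) :
    expSum (Fintype.piFinset W) (fun w => ∑ i, φ (w i)) x = ∏ i, expSum (W i) φ x := by
  unfold expSum
  rw [prod_univ_sum]
  exact sum_congr rfl fun w _ => mFourier_sum _ _ _

lemma expSum_product {τ : Type*} (U : Finset τ) (W : Finset κ) (ψ : τ → Fin k → ℤ)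
    (φ : κ → Fin k → ℤ) (x : UnitAddTorus (Fin k)) :
    expSum (U ×ˢ W) (fun q => ψ q.1 + φ q.2) x = expSum U ψ x * expSum W φ x := by
  unfold expSum
  rw [sum_product, sum_mul_sum]
  exact sum_congr rfl fun a _ => sum_congr rfl fun b _ => mFourier_add

lemma prod_le_sum_pow [Fintype κ] [Nonempty κ] (a : κ → ℝ) (ha : ∀ i, 0 ≤ a i) :
    ∏ i, a i ≤ ∑ i, a i ^ Fintype.card κ := by
  obtain ⟨j, -, hj⟩ := exists_max_image univ a univ_nonempty
  calc ∏ i, a i ≤ ∏ _i : κ, a j := prod_le_prod (fun i _ => ha i) fun i hi => hj i hi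
    _ = a j ^ Fintype.card κ := by simp
    _ ≤ _ := single_le_sum (f := fun i => a i ^ Fintype.card κ)
        (fun i _ => pow_nonneg (ha i) _) (mem_univ j)

/-- Hölder's inequality for the number of solutions with variables in different sets. -/
lemma energy_product_le [Fintype κ] [DecidableEq κ] [Nonempty κ] {τ : Type*} (U : Finset τ)
    (ψ : τ → Fin k → ℤ) (W : κ → Finset ι) (φ : ι → Fin k → ℤ) :
    energy (U ×ˢ Fintype.piFinset W) (fun q => ψ q.1 + ∑ i, φ (q.2 i)) ≤
      ∑ j, energy (U ×ˢ Fintype.piFinset fun _ : κ => W j) (fun q => ψ q.1 + ∑ i, φ (q.2 i)) := by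
  have key : ∀ W : κ → Finset ι,
      ((energy (U ×ˢ Fintype.piFinset W) (fun q => ψ q.1 + ∑ i, φ (q.2 i)) : ℕ) : ℝ) =
      ∫ x, ‖expSum U ψ x‖ ^ 2 * ∏ i, ‖expSum (W i) φ x‖ ^ 2 ∂torusMeasure k := by
    intro W
    rw [energy_eq_integral]
    congr 1
    ext x
    rw [expSum_product U _ ψ (fun w : κ → ι => ∑ i, φ (w i)), expSum_piFinset, norm_mul, norm_prod,
      mul_pow, prod_pow]
  have hc : ∀ W : κ → Finset ι, Continuous fun x =>
      ‖expSum U ψ x‖ ^ 2 * ∏ i, ‖expSum (W i) φ x‖ ^ 2 := fun W => by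
    have := continuous_expSum (k := k) U ψ
    have h2 := fun i => continuous_expSum (k := k) (W i) φ
    fun_prop
  rw [← Nat.cast_le (α := ℝ)]
  push_cast
  rw [key, sum_congr rfl fun j _ => key fun _ => W j,
    ← integral_finsetSum _ fun j _ => integrable_torus (hc _)]
  refine integral_mono (integrable_torus (hc _))
    (integrable_finsetSum _ fun j _ => integrable_torus (hc _)) fun x => ?_
  simp only
  rw [← mul_sum]
  gcongr
  simpa using prod_le_sum_pow (fun i => ‖expSum (W i) φ x‖ ^ 2) fun i => by positivity

/-- Hölder's inequality for the number of solutions with variables in different sets. -/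
lemma energy_piFinset_le [Fintype κ] [DecidableEq κ] [Nonempty κ] (W : κ → Finset ι)
    (φ : ι → Fin k → ℤ) :
    energy (Fintype.piFinset W) (fun w => ∑ i, φ (w i)) ≤
      ∑ j, energy (Fintype.piFinset fun _ : κ => W j) (fun w => ∑ i, φ (w i)) := by
  have e : ∀ W : κ → Finset ι, energy (Fintype.piFinset W) (fun w => ∑ i, φ (w i)) =
      energy ((univ : Finset Unit) ×ˢ Fintype.piFinset W)
        (fun q => (0 : Unit → Fin k → ℤ) q.1 + ∑ i, φ (q.2 i)) := by
    intro W
    apply le_antisymm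
    · exact energy_le_of_injOn (fun w => ((), w)) (fun a _ b _ h => (Prod.ext_iff.1 h).2)
        (by simp) (by simp)
    · exact energy_le_of_injOn (fun q => q.2) (fun a _ b _ h => Prod.ext (Subsingleton.elim _ _) h)
        (by simp) (by simp)
  rw [e, sum_congr rfl fun j _ => e fun _ => W j]
  exact energy_product_le _ _ _ _

end TorusFourier

section Newton

open MvPolynomial in
lemma aeval_esymm_eq_of_psum {R σ : Type*} [CommRing R] [Fintype σ] (k : ℕ)
    (hu : ∀ j, 1 ≤ j → j ≤ k → IsUnit (j : R)) (x y : σ → R)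
    (h : ∀ j, 1 ≤ j → j ≤ k → ∑ i, x i ^ j = ∑ i, y i ^ j) :
    ∀ j ≤ k, aeval x (esymm σ R j) = aeval y (esymm σ R j) := by
  have hp : ∀ j, 1 ≤ j → j ≤ k → aeval x (psum σ R j) = aeval y (psum σ R j) := by
    intro j h1 h2
    simp only [psum, map_sum, map_pow, aeval_X]
    exact h j h1 h2
  intro j
  induction j using Nat.strong_induction_on with
  | _ j ih =>
    intro hjk
    rcases Nat.eq_zero_or_pos j with rfl | hj
    · simp
    refine (hu j hj hjk).mul_left_cancel ?_
    have hx := congrArg (aeval x) (mul_esymm_eq_sum σ R j)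
    have hy := congrArg (aeval y) (mul_esymm_eq_sum σ R j)
    simp only [map_mul, map_natCast, map_sum, map_pow, map_neg, map_one] at hx hy
    rw [hx, hy]
    congr 1
    refine sum_congr rfl fun a ha => ?_
    obtain ⟨ha1, ha2⟩ := mem_filter.1 ha
    rw [HasAntidiagonal.mem_antidiagonal] at ha1
    rw [ih a.1 ha2 (by omega), hp a.2 (by omega) (by omega)]

open Polynomial in
lemma prod_sub_eq_of_power_sums {R : Type*} [CommRing R] {k : ℕ}
    (hu : ∀ j, 1 ≤ j → j ≤ k → IsUnit (j : R)) (x y : Fin k → R)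
    (h : ∀ j, 1 ≤ j → j ≤ k → ∑ i, x i ^ j = ∑ i, y i ^ j) (T : R) :
    ∏ i, (T - x i) = ∏ i, (T - y i) := by
  have key : ∀ z : Fin k → R, ∏ i, (T - z i) =
      ∑ j ∈ range (k + 1), (-1) ^ j *
        (MvPolynomial.aeval z (MvPolynomial.esymm (Fin k) R j) * T ^ (k - j)) := by
    intro z
    have := congrArg (eval T) (Multiset.prod_X_sub_X_eq_sum_esymm (univ.val.map z))
    simp only [Multiset.map_map, Multiset.card_map, card_val, card_univ, Fintype.card_fin,
      eval_finsetSum, eval_mul, eval_pow, eval_neg, eval_one, eval_C, eval_X] at this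
    rw [eval_multiset_prod, Multiset.map_map] at this
    simp only [Function.comp_def, eval_sub, eval_X, eval_C] at this
    rw [← Finset.prod_map_val] 
    rw [this]
    refine sum_congr rfl fun j _ => ?_
    rw [MvPolynomial.aeval_esymm_eq_multiset_esymm]
  rw [key x, key y]
  refine sum_congr rfl fun j hj => ?_
  rw [aeval_esymm_eq_of_psum k hu x y h j (by simpa [Nat.lt_succ_iff] using hj)]

end Newton

section PadicCount

lemma eq_of_power_sums_modEq {k p : ℕ} (hp : p.Prime) (hk : k < p) {u v : Fin k → ℤ}
    (hinj : Function.Injective fun i => (v i : ZMod p))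
    (h : ∀ j, 1 ≤ j → j ≤ k → (p ^ k : ℤ) ∣ ∑ i, u i ^ j - ∑ i, v i ^ j) (i : Fin k) :
    ∃ l, (p ^ k : ℤ) ∣ u i - v l := by
  classical
  have h0 : ∏ l, ((u i : ZMod (p ^ k)) - v l) = 0 := by
    rw [← prod_sub_eq_of_power_sums (x := fun l => (u l : ZMod (p ^ k)))]
    · exact prod_eq_zero (mem_univ i) (sub_self _)
    · intro j h1 h2
      rw [ZMod.isUnit_iff_coprime]
      exact Nat.Coprime.pow_right k (Nat.coprime_of_lt_prime (by omega) (h2.trans_lt hk) hp).symm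
    · intro j h1 h2
      have := h j h1 h2
      rw [← sub_eq_zero]
      have h3 := (ZMod.intCast_zmod_eq_zero_iff_dvd (∑ i, u i ^ j - ∑ i, v i ^ j) (p ^ k)).2
        (by exact_mod_cast this)
      push_cast at h3
      exact h3
  have h1 : (p ^ k : ℤ) ∣ ∏ l, (u i - v l) := by
    have := (ZMod.intCast_zmod_eq_zero_iff_dvd (∏ l, (u i - v l)) (p ^ k)).1 (by push_cast; exact h0)
    exact_mod_cast this
  have hk0 : 0 < k := i.pos
  have hpI : Prime (p : ℤ) := Nat.prime_iff_prime_int.1 hp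
  obtain ⟨l, -, hl⟩ := hpI.exists_mem_finset_dvd ((dvd_pow_self (p : ℤ) hk0.ne').trans h1)
  refine ⟨l, ?_⟩
  rw [← mul_prod_erase univ _ (mem_univ l)] at h1
  refine IsCoprime.dvd_of_dvd_mul_right ?_ h1
  refine IsCoprime.pow_left (IsCoprime.prod_right fun m hm => ?_)
  rw [Int.isCoprime_iff_gcd_eq_one]
  by_contra hne
  have hd : (p : ℤ) ∣ u i - v m := by
    by_contra hnd
    exact hne (Int.isCoprime_iff_gcd_eq_one.1 ((hpI.coprime_iff_not_dvd).2 hnd))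
  have : (p : ℤ) ∣ v l - v m := by
    have := dvd_sub hd hl
    simpa using this
  have h2 := (ZMod.intCast_zmod_eq_zero_iff_dvd (v l - v m) p).2 this
  push_cast at h2
  exact (mem_erase.1 hm).1 (hinj (sub_eq_zero.1 h2)).symm

lemma card_Ico_filter_dvd_sub {p k j : ℕ} (hp : 0 < p) (hj : j ≤ k) (v : ℤ) :
    #{x ∈ Ico (0 : ℤ) (p ^ k) | (p ^ j : ℤ) ∣ x - v} = p ^ (k - j) := by
  have h0 : (0 : ℤ) < (p : ℤ) ^ j := by positivity
  have h1 : {x ∈ Ico (0 : ℤ) (p ^ k) | (p ^ j : ℤ) ∣ x - v} =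
      {x ∈ Ico (0 : ℤ) (p ^ k) | x ≡ v [ZMOD (p ^ j : ℤ)]} := by
    refine filter_congr fun x _ => ?_
    rw [Int.modEq_comm, Int.modEq_iff_dvd]
  have h2 := Int.Ico_filter_modEq_card (0 : ℤ) (p ^ k) h0 v
  rw [← h1] at h2
  have h3 : (((p ^ k : ℤ) : ℚ) - v) / ((p ^ j : ℤ) : ℚ) =
      (((0 : ℤ) : ℚ) - v) / ((p ^ j : ℤ) : ℚ) + ((p ^ (k - j) : ℕ) : ℤ) := by
    have : (p : ℚ) ^ j ≠ 0 := by positivity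
    push_cast
    field_simp
    rw [← pow_add, Nat.add_sub_cancel' hj]
    ring
  rw [h3, Int.ceil_add_intCast] at h2
  have h4 : (0 : ℤ) ≤ ((p ^ (k - j) : ℕ) : ℤ) := by positivity
  rw [add_sub_cancel_left, max_eq_left h4] at h2
  exact_mod_cast h2

lemma card_congruence_system_le {k p : ℕ} (hp : p.Prime) (hk : k < p) (U : Finset (Fin k → ℤ))
    (hinj : ∀ u ∈ U, Function.Injective fun i => (u i : ZMod p))
    (hU : ∀ u ∈ U, ∀ i, 0 ≤ u i ∧ u i < (p : ℤ) ^ k) (b : ℤ) (lam : Fin k → ℤ) :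
    #{u ∈ U | ∀ j : Fin k, (p ^ (j.1 + 1) : ℤ) ∣ ∑ i, (u i - b) ^ (j.1 + 1) - lam j} ≤
      k ^ k * p ^ (k * (k - 1) / 2) := by
  classical
  set t : Finset (Fin k → ℤ) := Fintype.piFinset fun j : Fin k =>
    {x ∈ Ico (0 : ℤ) (p ^ k) | (p ^ (j.1 + 1) : ℤ) ∣ x - lam j} with ht
  have hpk : (0 : ℤ) < (p : ℤ) ^ k := by have := hp.pos; positivity
  have htc : #t = p ^ (k * (k - 1) / 2) := by
    rw [ht, Fintype.card_piFinset, prod_congr rfl fun j _ =>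
      card_Ico_filter_dvd_sub hp.pos (k := k) (j := j.1 + 1) j.2 (lam j), prod_pow_eq_pow_sum]
    congr 1
    rw [← Finset.sum_range_id, ← Finset.sum_range_reflect, Finset.sum_range]
    refine sum_congr rfl fun i _ => ?_
    omega
  rw [← htc]
  refine card_le_mul_card_image_of_maps_to
    (f := fun u j => (∑ i, (u i - b) ^ (j.1 + 1)) % (p : ℤ) ^ k) ?_ _ ?_
  · intro u hu
    rw [mem_filter] at hu
    rw [ht, Fintype.mem_piFinset]
    intro j
    rw [mem_filter, mem_Ico]
    refine ⟨⟨Int.emod_nonneg _ hpk.ne', Int.emod_lt_of_pos _ hpk⟩, ?_⟩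
    have h1 : (p ^ (j.1 + 1) : ℤ) ∣ (∑ i, (u i - b) ^ (j.1 + 1)) % (p : ℤ) ^ k -
        ∑ i, (u i - b) ^ (j.1 + 1) := by
      refine (pow_dvd_pow _ j.2).trans ?_
      rw [← Int.modEq_iff_dvd]
      exact (Int.mod_modEq _ _).symm
    have := dvd_add h1 (hu.2 j)
    simpa using this
  · intro v _
    rcases ({u ∈ {u ∈ U | ∀ j : Fin k, (p ^ (j.1 + 1) : ℤ) ∣ ∑ i, (u i - b) ^ (j.1 + 1) - lam j} |
      (fun j : Fin k => (∑ i, (u i - b) ^ (j.1 + 1)) % (p : ℤ) ^ k) = v}).eq_empty_or_nonempty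
      with he | ⟨w, hw⟩
    · rw [he]; simp
    · rw [mem_filter, mem_filter] at hw
      have hsub : {u ∈ {u ∈ U | ∀ j : Fin k,
            (p ^ (j.1 + 1) : ℤ) ∣ ∑ i, (u i - b) ^ (j.1 + 1) - lam j} |
          (fun j : Fin k => (∑ i, (u i - b) ^ (j.1 + 1)) % (p : ℤ) ^ k) = v} ⊆
          Fintype.piFinset fun _ : Fin k => univ.image w := by
        intro u hu
        rw [mem_filter, mem_filter] at hu
        rw [Fintype.mem_piFinset]
        intro i
        have hpow : ∀ j, 1 ≤ j → j ≤ k →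
            (p ^ k : ℤ) ∣ ∑ i, (u i - b) ^ j - ∑ i, (w i - b) ^ j := by
          intro j h1 h2
          have := congrFun (hu.2.trans hw.2.symm) ⟨j - 1, by omega⟩
          simp only [Nat.sub_add_cancel h1] at this
          exact Int.ModEq.dvd (n := (p ^ k : ℤ)) this.symm
        obtain ⟨l, hl⟩ := eq_of_power_sums_modEq hp hk (u := fun i => u i - b)
          (v := fun i => w i - b) (by
            intro i j hij
            refine hinj w hw.1.1 ?_
            simpa using hij) hpow i
        simp only [sub_sub_sub_cancel_right] at hl
        have hui := hU u hu.1.1 i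
        have hwl := hU w hw.1.1 l
        have : u i - w l = 0 := Int.eq_zero_of_abs_lt_dvd hl (by rw [abs_lt]; constructor <;> linarith)
        exact mem_image.2 ⟨l, mem_univ _, by linarith⟩
      refine (card_le_card hsub).trans ?_
      rw [Fintype.card_piFinset_const]
      exact Nat.pow_le_pow_left (card_image_le.trans (by simp)) k

end PadicCount

section MeanValue

/-- The vector of powers `(x, x ^ 2, …, x ^ k)`. -/
def powVec (k : ℕ) (x : ℤ) : Fin k → ℤ := fun j => x ^ (j.1 + 1)

/-- Vinogradov's mean value: the number of solutions of the system of equal power sums of degree at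
most `k`, for pairs of tuples indexed by `κ` with entries in `A`. -/
def vinMean (κ : Type*) [Fintype κ] [DecidableEq κ] (k : ℕ) (A : Finset ℤ) : ℕ :=
  energy (Fintype.piFinset fun _ : κ => A) (fun x => ∑ i, powVec k (x i))

variable {κ : Type*} [Fintype κ]

lemma sum_powVec_eq_iff {k : ℕ} {x y : κ → ℤ} :
    ∑ i, powVec k (x i) = ∑ i, powVec k (y i) ↔
      ∀ j, 1 ≤ j → j ≤ k → ∑ i, x i ^ j = ∑ i, y i ^ j := by
  rw [funext_iff]
  simp only [Finset.sum_apply, powVec]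
  constructor
  · intro h j h1 h2
    simpa [Nat.sub_add_cancel h1] using h ⟨j - 1, by omega⟩
  · intro h j
    exact h _ (by omega) j.2

lemma sum_powVec_sub {k : ℕ} {x y : κ → ℤ} (h : ∑ i, powVec k (x i) = ∑ i, powVec k (y i)) (b : ℤ) :
    ∑ i, powVec k (x i - b) = ∑ i, powVec k (y i - b) := by
  rw [sum_powVec_eq_iff] at h ⊢
  intro j h1 h2
  have key : ∀ z : κ → ℤ, ∑ i, (z i - b) ^ j =
      ∑ l ∈ range (j + 1), (∑ i, z i ^ l) * ((-b) ^ (j - l) * (j.choose l : ℤ)) := by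
    intro z
    simp only [sub_eq_add_neg, add_pow, sum_mul]
    rw [sum_comm]
    exact sum_congr rfl fun _ _ => sum_congr rfl fun _ _ => by ring
  rw [key, key]
  refine sum_congr rfl fun l hl => ?_
  rcases Nat.eq_zero_or_pos l with rfl | hl0
  · simp
  · rw [h l hl0 (by rw [mem_range] at hl; omega)]

lemma vinMean_le_of_affine [DecidableEq κ] {A B : Finset ℤ} {p b : ℤ} (k : ℕ) (hp : p ≠ 0)
    (h : ∀ a ∈ A, ∃ y ∈ B, a = b + p * y) : vinMean κ k A ≤ vinMean κ k B := by
  have hf : ∀ a ∈ A, (a - b) / p ∈ B ∧ a = b + p * ((a - b) / p) := by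
    intro a ha
    obtain ⟨y, hy, rfl⟩ := h a ha
    have : (b + p * y - b) / p = y := by rw [add_sub_cancel_left, Int.mul_ediv_cancel_left _ hp]
    rw [this]
    exact ⟨hy, rfl⟩
  refine energy_le_of_injOn (fun x i => (x i - b) / p) ?_ ?_ ?_
  · intro x hx y hy hxy
    rw [mem_coe, Fintype.mem_piFinset] at hx hy
    funext i
    rw [(hf _ (hx i)).2, (hf _ (hy i)).2]
    have := congrFun hxy i
    simp only at this
    rw [this]
  · intro x hx
    rw [Fintype.mem_piFinset] at hx ⊢
    exact fun i => (hf _ (hx i)).1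
  · intro x hx y hy hxy
    rw [Fintype.mem_piFinset] at hx hy
    have h1 := sum_powVec_sub hxy b
    rw [sum_powVec_eq_iff] at h1 ⊢
    intro j hj1 hj2
    have h2 := h1 j hj1 hj2
    have key : ∀ z : κ → ℤ, (∀ i, z i ∈ A) →
        ∑ i, (z i - b) ^ j = p ^ j * ∑ i, ((z i - b) / p) ^ j := by
      intro z hz
      rw [mul_sum]
      refine sum_congr rfl fun i _ => ?_
      rw [← mul_pow]
      congr 1
      have := (hf _ (hz i)).2
      linarith
    rw [key x hx, key y hy] at h2
    exact mul_left_cancel₀ (pow_ne_zero _ hp) h2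

lemma energy_product_le_card_mul {τ ι G : Type*} [DecidableEq G] [AddCommGroup G] [DecidableEq τ]
    (U : Finset τ) (W : Finset ι) (ψ : τ → G) (φ : ι → G) (P : Finset (τ × τ))
    (hP : ∀ u ∈ U, ∀ u' ∈ U, ∀ w ∈ W, ∀ w' ∈ W, ψ u + φ w = ψ u' + φ w' → (u, u') ∈ P) :
    energy (U ×ˢ W) (fun q => ψ q.1 + φ q.2) ≤ energy W φ * #P := by
  classical
  unfold energy
  refine card_le_mul_card_image_of_maps_to (f := fun q => (q.1.1, q.2.1)) ?_ _ ?_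
  · intro q hq
    simp only [mem_filter, mem_product] at hq
    exact hP _ hq.1.1.1 _ hq.1.2.1 _ hq.1.1.2 _ hq.1.2.2 hq.2
  · rintro ⟨u, u'⟩ -
    refine le_trans ?_ (card_shift_le_energy W φ (ψ u' - ψ u))
    refine card_le_card_of_injOn (fun q => (q.1.2, q.2.2)) ?_ ?_
    · rintro ⟨⟨a, b⟩, ⟨c, d⟩⟩ hq
      simp only [coe_filter, mem_product, Set.mem_ofPred_eq, mem_filter, Prod.mk.injEq] at hq ⊢
      obtain ⟨⟨⟨⟨h1, h2⟩, h3, h4⟩, h5⟩, rfl, rfl⟩ := hq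
      refine ⟨⟨h2, h4⟩, ?_⟩
      rw [eq_comm, ← sub_eq_zero] at h5 ⊢
      rw [← h5]
      abel
    · rintro ⟨⟨a, b⟩, ⟨c, d⟩⟩ hq ⟨⟨a', b'⟩, ⟨c', d'⟩⟩ hq' he
      simp only [coe_filter, mem_product, Set.mem_ofPred_eq, mem_filter, Prod.mk.injEq] at hq hq' he ⊢
      obtain ⟨-, h1, h2⟩ := hq
      obtain ⟨-, h3, h4⟩ := hq'
      exact ⟨⟨h1.trans h3.symm, he.1⟩, h2.trans h4.symm, he.2⟩

lemma vinMean_equiv_le {κ' : Type*} [Fintype κ'] [DecidableEq κ] [DecidableEq κ'] (e : κ ≃ κ')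
    (k : ℕ) (A : Finset ℤ) : vinMean κ k A ≤ vinMean κ' k A := by
  refine energy_le_of_injOn (fun x => x ∘ e.symm) ?_ ?_ ?_
  · intro x _ y _ hxy
    exact (e.symm.surjective.injective_comp_right) hxy
  · intro x hx
    rw [Fintype.mem_piFinset] at hx ⊢
    exact fun i => hx _
  · intro x _ y _ hxy
    have key : ∀ z : κ → ℤ, ∑ i, powVec k ((z ∘ e.symm) i) = ∑ i, powVec k (z i) := fun z =>
      e.symm.sum_comp (fun i => powVec k (z i))
    rw [key, key, hxy]

lemma energy_sum_eq_product {κ₁ κ₂ : Type*} [Fintype κ₁] [Fintype κ₂]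
    (k : ℕ) (I : Finset (κ₁ ⊕ κ₂ → ℤ)) (U : Finset (κ₁ → ℤ)) (W : Finset (κ₂ → ℤ))
    (h : ∀ x ∈ I, x ∘ Sum.inl ∈ U ∧ x ∘ Sum.inr ∈ W) :
    energy I (fun x => ∑ i, powVec k (x i)) ≤
      energy (U ×ˢ W) (fun q => ∑ i, powVec k (q.1 i) + ∑ i, powVec k (q.2 i)) := by
  refine energy_le_of_injOn (fun x => (x ∘ Sum.inl, x ∘ Sum.inr)) ?_ ?_ ?_
  · intro x _ y _ hxy
    simp only [Prod.mk.injEq] at hxy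
    funext i
    rcases i with i | i
    · exact congrFun hxy.1 i
    · exact congrFun hxy.2 i
  · intro x hx
    exact mem_product.2 (h x hx)
  · intro x _ y _ hxy
    simp only [Fintype.sum_sum_type] at hxy
    exact hxy

lemma vinMean_sum_le (k s : ℕ) (A : Finset ℤ) :
    vinMean (Fin k ⊕ Fin s) k A ≤ vinMean (Fin s) k A * #A ^ (2 * k) := by
  refine (energy_sum_eq_product k _ (Fintype.piFinset fun _ => A) (Fintype.piFinset fun _ => A)
    ?_).trans ?_
  · intro x hx
    rw [Fintype.mem_piFinset] at hx
    exact ⟨Fintype.mem_piFinset.2 fun i => hx _, Fintype.mem_piFinset.2 fun i => hx _⟩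
  · refine (energy_product_le_card_mul _ _ (fun u : Fin k → ℤ => ∑ i, powVec k (u i))
      (fun w : Fin s → ℤ => ∑ i, powVec k (w i))
      ((Fintype.piFinset fun _ => A) ×ˢ (Fintype.piFinset fun _ => A)) ?_).trans ?_
    · intro u hu u' hu' _ _ _ _ _
      exact mem_product.2 ⟨hu, hu'⟩
    · rw [card_product, Fintype.card_piFinset_const, ← pow_add, ← two_mul]
      rfl

end MeanValue

section Recursion

/-- The elements of `[0, X)` in a given residue class. -/
noncomputable def residueClass (p X : ℕ) (b : ZMod p) : Finset ℤ := {x ∈ Ico (0 : ℤ) X | (x : ZMod p) = b}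

lemma vinMean_residueClass_le (κ : Type*) [Fintype κ] [DecidableEq κ] (k : ℕ) {p X : ℕ} [NeZero p]
    (b : ZMod p) : vinMean κ k (residueClass p X b) ≤ vinMean κ k (Ico (0 : ℤ) ((X / p + 1 : ℕ) : ℤ)) := by
  have hp : (0 : ℤ) < p := by exact_mod_cast Nat.pos_of_ne_zero (NeZero.ne p)
  refine vinMean_le_of_affine (p := p) (b := (b.val : ℤ)) k hp.ne' fun a ha => ?_
  rw [residueClass, mem_filter, mem_Ico] at ha
  obtain ⟨⟨h0, hX⟩, hab⟩ := ha
  refine ⟨a / p, ?_, ?_⟩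
  · rw [mem_Ico]
    refine ⟨Int.ediv_nonneg h0 hp.le, ?_⟩
    push_cast
    have := Int.ediv_le_ediv hp hX.le
    omega
  · have : (b.val : ℤ) = a % p := by rw [← hab, ZMod.val_intCast]
    rw [this, Int.emod_add_mul_ediv]

lemma energy_good_le {k s p X : ℕ} (hp : p.Prime) (hk : k < p) (hX : X ≤ p ^ k)
    (U : Finset (Fin k → ℤ)) (hinj : ∀ u ∈ U, Function.Injective fun i => (u i : ZMod p))
    (hU : U ⊆ Fintype.piFinset fun _ => Ico (0 : ℤ) X) (b : ZMod p) :
    energy (U ×ˢ Fintype.piFinset fun _ : Fin s => residueClass p X b)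
      (fun q => ∑ i, powVec k (q.1 i) + ∑ i, powVec k (q.2 i)) ≤
    vinMean (Fin s) k (Ico (0 : ℤ) ((X / p + 1 : ℕ) : ℤ)) *
      (X ^ k * (k ^ k * p ^ (k * (k - 1) / 2))) := by
  classical
  have : NeZero p := ⟨hp.ne_zero⟩
  set β : ℤ := (b.val : ℤ) with hβ
  set P : Finset ((Fin k → ℤ) × (Fin k → ℤ)) := {q ∈ U ×ˢ U | ∀ j : Fin k,
    (p ^ (j.1 + 1) : ℤ) ∣ ∑ i, (q.2 i - β) ^ (j.1 + 1) - ∑ i, (q.1 i - β) ^ (j.1 + 1)} with hPdef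
  have hbox : ∀ u ∈ U, ∀ i, 0 ≤ u i ∧ u i < (p : ℤ) ^ k := by
    intro u hu i
    have := Fintype.mem_piFinset.1 (hU hu) i
    rw [mem_Ico] at this
    exact ⟨this.1, this.2.trans_le (by exact_mod_cast hX)⟩
  have hPc : #P ≤ X ^ k * (k ^ k * p ^ (k * (k - 1) / 2)) := by
    have h1 : #P = ∑ u ∈ U, #{u' ∈ U | ∀ j : Fin k,
        (p ^ (j.1 + 1) : ℤ) ∣ ∑ i, (u' i - β) ^ (j.1 + 1) - ∑ i, (u i - β) ^ (j.1 + 1)} := by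
      rw [hPdef, card_filter, sum_product]
      refine sum_congr rfl fun u _ => ?_
      rw [card_filter]
    rw [h1]
    refine (sum_le_card_nsmul U _ _ fun u _ =>
      card_congruence_system_le hp hk U hinj hbox β _).trans ?_
    rw [smul_eq_mul]
    refine Nat.mul_le_mul_right _ ((card_le_card hU).trans ?_)
    rw [Fintype.card_piFinset_const, Int.card_Ico]
    simp
  refine (energy_product_le_card_mul U _ (fun u : Fin k → ℤ => ∑ i, powVec k (u i))
      (fun w : Fin s → ℤ => ∑ i, powVec k (w i)) P ?_).trans
      (Nat.mul_le_mul (vinMean_residueClass_le (Fin s) k b) hPc)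
  intro u hu u' hu' w hw w' hw' h
  rw [hPdef, mem_filter, mem_product]
  refine ⟨⟨hu, hu'⟩, fun j => ?_⟩
  have h1 : ∑ i, powVec k (Sum.elim u w i) = ∑ i, powVec k (Sum.elim u' w' i) := by
    simpa [Fintype.sum_sum_type] using h
  have h2 := sum_powVec_eq_iff.1 (sum_powVec_sub h1 β) (j.1 + 1) (by omega) j.2
  simp only [Fintype.sum_sum_type, Sum.elim_inl, Sum.elim_inr] at h2
  have hd : ∀ v ∈ Fintype.piFinset fun _ : Fin s => residueClass p X b,
      (p ^ (j.1 + 1) : ℤ) ∣ ∑ i, (v i - β) ^ (j.1 + 1) := by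
    intro v hv
    refine dvd_sum fun i _ => pow_dvd_pow_of_dvd ?_ _
    have hvi := Fintype.mem_piFinset.1 hv i
    rw [residueClass, mem_filter] at hvi
    rw [← ZMod.intCast_zmod_eq_zero_iff_dvd]
    push_cast
    rw [hvi.2, hβ]
    simp
  have h3 : ∑ i, (u' i - β) ^ (j.1 + 1) - ∑ i, (u i - β) ^ (j.1 + 1) =
      ∑ i, (w i - β) ^ (j.1 + 1) - ∑ i, (w' i - β) ^ (j.1 + 1) := by linarith
  rw [h3]
  exact dvd_sub (hd w hw) (hd w' hw')

lemma exists_injective_or_covered {ι R : Type*} [Fintype ι] [DecidableEq R] [Inhabited R] (k : ℕ)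
    (f : ι → R) : (∃ g : Fin k → ι, Function.Injective (f ∘ g)) ∨
      ∃ (c : Fin k → R) (g : ι → Fin k), ∀ i, f i = c (g i) := by
  classical
  rcases le_or_gt k (#(univ.image f)) with h | h
  · left
    obtain ⟨t, ht, htc⟩ := exists_subset_card_eq h
    have e := (t.equivFinOfCardEq htc).symm
    have hmem : ∀ i : Fin k, ∃ a, f a = (e i : R) := fun i => by
      simpa using ht (e i).2
    choose g hg using hmem
    refine ⟨g, fun i j hij => e.injective (Subtype.ext ?_)⟩
    simpa [hg] using hij
  · right
    have e := (univ.image f).equivFin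
    refine ⟨fun i => if h : i.1 < #(univ.image f) then (e.symm ⟨i.1, h⟩ : R) else default,
      fun i => ⟨(e ⟨f i, mem_image_of_mem f (mem_univ i)⟩).1, (Fin.is_lt _).trans h⟩, fun i => ?_⟩
    simp

lemma exists_perm_comp_inl {k s : ℕ} (g : Fin k → Fin k ⊕ Fin s) (hg : Function.Injective g) :
    ∃ e : Equiv.Perm (Fin k ⊕ Fin s), ∀ i, e (Sum.inl i) = g i := by
  classical
  obtain ⟨e, he⟩ := Equiv.Perm.exists_extending_pair (Sum.inl : Fin k → Fin k ⊕ Fin s) g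
    Sum.inl_injective hg
  exact ⟨e, he⟩

lemma vinMean_recursion {k s p X : ℕ} (hp : p.Prime) (hk : k < p) (hX : X ≤ p ^ k) (hk0 : 0 < k)
    (hs : 0 < s) :
    vinMean (Fin k ⊕ Fin s) k (Ico (0 : ℤ) X) ≤
      2 * (p ^ (2 * k) * k ^ (2 * (k + s)) * (k + s) * (X / p + 1) ^ (2 * k) +
        (k + s).factorial ^ 2 * p ^ (2 * s) * s * X ^ k * k ^ k * p ^ (k * (k - 1) / 2)) *
      vinMean (Fin s) k (Ico (0 : ℤ) ((X / p + 1 : ℕ) : ℤ)) := by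
  classical
  have : NeZero p := ⟨hp.ne_zero⟩
  have : Nonempty (Fin s) := ⟨⟨0, hs⟩⟩
  have : Nonempty (Fin k) := ⟨⟨0, hk0⟩⟩
  set Y := X / p + 1 with hY
  set JY := vinMean (Fin s) k (Ico (0 : ℤ) (Y : ℤ)) with hJY
  set I : Finset (Fin k ⊕ Fin s → ℤ) := Fintype.piFinset fun _ => Ico (0 : ℤ) X with hI
  set Φ : (Fin k ⊕ Fin s → ℤ) → Fin k → ℤ := fun x => ∑ i, powVec k (x i) with hΦ
  set G := {x ∈ I | ∃ g : Fin k → Fin k ⊕ Fin s,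
    Function.Injective ((fun i => (x i : ZMod p)) ∘ g)} with hG
  set B := {x ∈ I | ∃ (c : Fin k → ZMod p) (g : Fin k ⊕ Fin s → Fin k),
    ∀ i, (x i : ZMod p) = c (g i)} with hB
  have hGB : energy I Φ ≤ 2 * (energy B Φ + energy G Φ) := by
    refine energy_union_le Φ fun x hx => ?_
    rcases exists_injective_or_covered k (fun i => (x i : ZMod p)) with h | h
    · exact Or.inr (mem_filter.2 ⟨hx, h⟩)
    · exact Or.inl (mem_filter.2 ⟨hx, h⟩)
  have hBad : energy B Φ ≤
      p ^ (2 * k) * k ^ (2 * (k + s)) * (k + s) * Y ^ (2 * k) * JY := by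
    have hcls : ∀ b : ZMod p, vinMean (Fin k ⊕ Fin s) k (residueClass p X b) ≤ JY * Y ^ (2 * k) := by
      intro b
      refine (vinMean_residueClass_le _ k b).trans ((vinMean_sum_le k s _).trans ?_)
      rw [Int.card_Ico, sub_zero, Int.toNat_natCast]
    refine (energy_le_of_cover (univ : Finset ((Fin k → ZMod p) × (Fin k ⊕ Fin s → Fin k)))
      (fun t => Fintype.piFinset fun i => residueClass p X (t.1 (t.2 i))) ?_).trans ?_
    · intro x hx
      obtain ⟨hx, c, g, h⟩ := mem_filter.1 hx
      refine ⟨(c, g), mem_univ _, Fintype.mem_piFinset.2 fun i => ?_⟩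
      exact mem_filter.2 ⟨Fintype.mem_piFinset.1 hx i, h i⟩
    · refine (Nat.mul_le_mul_left _ (sum_le_card_nsmul _ _ ((k + s) * (JY * Y ^ (2 * k)))
        fun t _ => ?_)).trans ?_
      · refine (energy_piFinset_le _ _).trans ?_
        refine (sum_le_card_nsmul _ _ _ fun i _ => hcls (t.1 (t.2 i))).trans ?_
        simp
      · rw [smul_eq_mul, card_univ, Fintype.card_prod, Fintype.card_fun, Fintype.card_fun, ZMod.card,
          Fintype.card_sum, Fintype.card_fin, Fintype.card_fin]
        apply le_of_eq
        ring
  have hGood : energy G Φ ≤ (k + s).factorial ^ 2 * p ^ (2 * s) * s * X ^ k * k ^ k *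
      p ^ (k * (k - 1) / 2) * JY := by
    set N := JY * (X ^ k * (k ^ k * p ^ (k * (k - 1) / 2))) with hN
    set G0 := {x ∈ I | Function.Injective fun i : Fin k => (x (Sum.inl i) : ZMod p)} with hG0
    set U := {u ∈ Fintype.piFinset fun _ : Fin k => Ico (0 : ℤ) X |
      Function.Injective fun i => (u i : ZMod p)} with hU
    have h1 : energy G0 Φ ≤ p ^ (2 * s) * s * N := by
      refine (energy_sum_eq_product k G0 U (Fintype.piFinset fun _ => Ico (0 : ℤ) X) ?_).trans ?_
      · intro x hx
        obtain ⟨hx, h⟩ := mem_filter.1 hx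
        rw [hI, Fintype.mem_piFinset] at hx
        exact ⟨mem_filter.2 ⟨Fintype.mem_piFinset.2 fun i => hx _, h⟩,
          Fintype.mem_piFinset.2 fun i => hx _⟩
      refine (energy_le_of_cover (univ : Finset (Fin s → ZMod p))
        (fun c => U ×ˢ Fintype.piFinset fun i => residueClass p X (c i)) ?_).trans ?_
      · rintro ⟨u, w⟩ hx
        obtain ⟨hu, hw⟩ := mem_product.1 hx
        refine ⟨fun i => (w i : ZMod p), mem_univ _, mem_product.2 ⟨hu, ?_⟩⟩
        refine Fintype.mem_piFinset.2 fun i => ?_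
        exact mem_filter.2 ⟨Fintype.mem_piFinset.1 hw i, rfl⟩
      · refine (Nat.mul_le_mul_left _ (sum_le_card_nsmul _ _ (s * N) fun c _ => ?_)).trans ?_
        · refine (energy_product_le U (fun u : Fin k → ℤ => ∑ i, powVec k (u i)) _ _).trans ?_
          refine (sum_le_card_nsmul _ _ N fun i _ => ?_).trans ?_
          · exact energy_good_le hp hk hX U (fun u hu => (mem_filter.1 hu).2) (filter_subset _ _) _
          · simp
        · rw [smul_eq_mul, card_univ, Fintype.card_fun, ZMod.card, Fintype.card_fin]
          apply le_of_eq
          ring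
    refine (energy_le_of_cover (univ : Finset (Equiv.Perm (Fin k ⊕ Fin s)))
      (fun e => {x ∈ I | x ∘ e ∈ G0}) ?_).trans ?_
    · intro x hx
      obtain ⟨hx, g, hg⟩ := mem_filter.1 hx
      obtain ⟨e, he⟩ := exists_perm_comp_inl g hg.of_comp
      refine ⟨e, mem_univ _, mem_filter.2 ⟨hx, mem_filter.2 ⟨?_, ?_⟩⟩⟩
      · exact Fintype.mem_piFinset.2 fun i => Fintype.mem_piFinset.1 hx _
      · intro i j hij
        apply hg
        simpa [he] using hij
    · refine (Nat.mul_le_mul_left _ (sum_le_card_nsmul _ _ (p ^ (2 * s) * s * N) fun e _ => ?_)).trans ?_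
      · refine le_trans (energy_le_of_injOn (fun x => x ∘ e) ?_ ?_ ?_) h1
        · intro x _ y _ hxy
          exact e.surjective.injective_comp_right hxy
        · intro x hx
          exact (mem_filter.1 hx).2
        · intro x _ y _ hxy
          have key : ∀ z : Fin k ⊕ Fin s → ℤ, Φ (z ∘ e) = Φ z := fun z =>
            Equiv.sum_comp e (fun i => powVec k (z i))
          rw [key, key, hxy]
      · rw [smul_eq_mul, card_univ, Fintype.card_perm, Fintype.card_sum, Fintype.card_fin,
          Fintype.card_fin]
        apply le_of_eq
        rw [hN]
        ring
  calc vinMean (Fin k ⊕ Fin s) k (Ico (0 : ℤ) X) = energy I Φ := rfl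
    _ ≤ _ := hGB
    _ ≤ _ := Nat.mul_le_mul_left 2 (Nat.add_le_add hBad hGood)
    _ = _ := by ring

end Recursion

section MeanValueTheorem

lemma vinMean_trivial (s k X : ℕ) : vinMean (Fin s) k (Ico (0 : ℤ) X) ≤ X ^ (2 * s) := by
  refine (energy_le_sq _ _).trans (le_of_eq ?_)
  rw [Fintype.card_piFinset_const, Int.card_Ico, sub_zero, Int.toNat_natCast]
  ring

lemma exists_prime_near_root {k X : ℕ} (hk : 3 ≤ k) (hX : k ^ k < X) :
    ∃ p : ℕ, p.Prime ∧ k < p ∧ X ≤ p ^ k ∧ p ≤ X ∧ p ^ k ≤ 4 ^ k * X := by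
  have hex : ∃ n : ℕ, X ≤ n ^ k := ⟨X, Nat.le_self_pow (by omega) X⟩
  classical
  set n := Nat.find hex with hn
  have h1 : X ≤ n ^ k := Nat.find_spec hex
  have h2 : k < n := by
    by_contra h
    exact absurd (h1.trans (Nat.pow_le_pow_left (not_lt.1 h) k)) (not_le.2 hX)
  have h3 : (n - 1) ^ k < X := not_le.1 (Nat.find_min hex (by omega : n - 1 < n))
  obtain ⟨p, hp, hp1, hp2⟩ := Nat.exists_prime_lt_and_le_two_mul n (by omega)
  have h4 : p ≤ 4 * (n - 1) := by omega
  refine ⟨p, hp, h2.trans hp1, h1.trans (Nat.pow_le_pow_left hp1.le k), ?_, ?_⟩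
  · have h5 : (n - 1) ^ 3 ≤ (n - 1) ^ k := Nat.pow_le_pow_right (by omega) hk
    have h6 : 3 ≤ n - 1 := by omega
    have h7 : 9 * (n - 1) ≤ (n - 1) ^ 3 := by
      have := Nat.mul_le_mul_right (n - 1) (Nat.mul_le_mul h6 h6)
      calc _ = 3 * 3 * (n - 1) := by ring
        _ ≤ _ := this
        _ = _ := by ring
    omega
  · calc p ^ k ≤ (4 * (n - 1)) ^ k := Nat.pow_le_pow_left h4 k
      _ = 4 ^ k * (n - 1) ^ k := mul_pow _ _ _
      _ ≤ 4 ^ k * X := Nat.mul_le_mul_left _ h3.le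

lemma recursion_constant_le {k s B : ℕ} (hk : 3 ≤ k) (hs : k ≤ s) (hS : k + s ≤ B * k ^ 2) :
    2 * (k ^ (2 * (k + s)) * (k + s) * 4 ^ k + (k + s).factorial ^ 2 * s * k ^ k) ≤
      k ^ ((2 * B + 8) * (B * k ^ 2)) := by
  set S := k + s with hSdef
  have hk1 : 1 ≤ k := by omega
  have hSk : S ≤ k ^ S := (Nat.lt_pow_self (by omega)).le
  have hsk : s ≤ k ^ S := le_trans (by omega) hSk
  have h4 : 4 ^ k ≤ k ^ (2 * S) := by
    calc 4 ^ k ≤ (k ^ 2) ^ k := Nat.pow_le_pow_left (by nlinarith) k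
      _ = k ^ (2 * k) := by rw [pow_mul]
      _ ≤ _ := Nat.pow_le_pow_right hk1 (by omega)
  have hSB : S ≤ k ^ (B + 2) := by
    calc S ≤ B * k ^ 2 := hS
      _ ≤ k ^ B * k ^ 2 := Nat.mul_le_mul_right _ (Nat.lt_pow_self (by omega)).le
      _ = _ := (pow_add _ _ _).symm
  have hfac : S.factorial ≤ k ^ ((B + 2) * S) := by
    rw [pow_mul]
    exact (Nat.factorial_le_pow S).trans (Nat.pow_le_pow_left hSB S)
  have hkk : k ^ k ≤ k ^ S := Nat.pow_le_pow_right hk1 (by omega)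
  have e1 : k ^ (2 * S) * S * 4 ^ k ≤ k ^ ((2 * B + 6) * S) := by
    calc k ^ (2 * S) * S * 4 ^ k ≤ k ^ (2 * S) * k ^ S * k ^ (2 * S) := by gcongr
      _ = k ^ (5 * S) := by rw [← pow_add, ← pow_add]; ring_nf
      _ ≤ _ := Nat.pow_le_pow_right hk1 (Nat.mul_le_mul_right _ (by omega))
  have e2 : S.factorial ^ 2 * s * k ^ k ≤ k ^ ((2 * B + 6) * S) := by
    calc S.factorial ^ 2 * s * k ^ k ≤ (k ^ ((B + 2) * S)) ^ 2 * k ^ S * k ^ S := by gcongr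
      _ = _ := by rw [← pow_mul, ← pow_add, ← pow_add]; ring_nf
  calc _ ≤ 2 * (k ^ ((2 * B + 6) * S) + k ^ ((2 * B + 6) * S)) := by gcongr
    _ = 4 * k ^ ((2 * B + 6) * S) := by ring
    _ ≤ k ^ (2 * S) * k ^ ((2 * B + 6) * S) := by
        gcongr
        calc 4 ≤ k ^ 2 := by nlinarith
          _ ≤ _ := Nat.pow_le_pow_right hk1 (by omega)
    _ = k ^ ((2 * B + 8) * S) := by rw [← pow_add]; ring_nf
    _ ≤ _ := Nat.pow_le_pow_right hk1 (Nat.mul_le_mul_left _ hS)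

set_option maxHeartbeats 1000000 in
lemma vinMean_step {k s X B : ℕ} {C δ : ℝ} (hk : 3 ≤ k) (hks : k ^ 2 ≤ s)
    (hS : k + s ≤ B * k ^ 2) (hX : k ^ k < X) (hC : 0 ≤ C) (hδ0 : 0 ≤ δ) (hδ : δ ≤ k * (k + 1) / 2)
    (ih : ∀ Y : ℕ, 1 ≤ Y → (vinMean (Fin s) k (Ico (0 : ℤ) Y) : ℝ) ≤
      C * (Y : ℝ) ^ ((2 * s : ℝ) - k * (k + 1) / 2 + δ)) :
    (vinMean (Fin (k + s)) k (Ico (0 : ℤ) X) : ℝ) ≤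
      (k : ℝ) ^ ((2 * B + 8) * (B * k ^ 2) + (2 * B + 2) * k ^ 2) * C *
        (X : ℝ) ^ (2 * (k + s : ℝ) - k * (k + 1) / 2 + δ * (1 - 1 / k)) := by
  obtain ⟨p, hp, hkp, hXp, hpX, hpk⟩ := exists_prime_near_root hk hX
  have hks' : k ≤ s := le_trans (by nlinarith) hks
  have hkR : (3 : ℝ) ≤ k := by exact_mod_cast hk
  have hksR : (k : ℝ) ^ 2 ≤ s := by exact_mod_cast hks
  have hp0 : (0 : ℝ) < p := by exact_mod_cast hp.pos
  have hX1 : 1 ≤ X := by omega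
  have hX0 : (0 : ℝ) < X := by exact_mod_cast hX1
  have hX1' : (1 : ℝ) ≤ X := by exact_mod_cast hX1
  set Y := X / p + 1 with hY
  have hYX : (Y : ℝ) ≤ 2 * X / p := by
    have h1 : ((X / p : ℕ) : ℝ) ≤ X / p := Nat.cast_div_le
    have h2 : (1 : ℝ) ≤ X / p := by rw [le_div_iff₀ hp0, one_mul]; exact_mod_cast hpX
    rw [hY]; push_cast
    calc ((X / p : ℕ) : ℝ) + 1 ≤ X / p + X / p := by linarith
      _ = _ := by ring
  set h := k * (k - 1) / 2 with hh
  have hhR : (h : ℝ) = k * (k - 1) / 2 := by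
    rw [hh, ← Nat.choose_two_right, Nat.cast_choose_two]
  set E : ℝ := (2 * s : ℝ) - k * (k + 1) / 2 + δ with hE
  have hE0 : 0 ≤ E := by rw [hE]; nlinarith
  have hE2 : E ≤ ((2 * s : ℕ) : ℝ) := by rw [hE]; push_cast; linarith
  have hrec := vinMean_recursion (s := s) hp hkp hXp (by omega) (by nlinarith)
  have hrecR : (vinMean (Fin (k + s)) k (Ico (0 : ℤ) X) : ℝ) ≤
      2 * ((p : ℝ) ^ (2 * k) * k ^ (2 * (k + s)) * (k + s) * (Y : ℝ) ^ (2 * k) +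
        ((k + s).factorial : ℝ) ^ 2 * p ^ (2 * s) * s * X ^ k * k ^ k * p ^ h) *
      vinMean (Fin s) k (Ico (0 : ℤ) (Y : ℤ)) := by
    exact_mod_cast (vinMean_equiv_le finSumFinEquiv.symm k _).trans hrec
  have hJ : (vinMean (Fin s) k (Ico (0 : ℤ) (Y : ℤ)) : ℝ) ≤
      C * (2 ^ (2 * s) * ((X : ℝ) ^ E * (p : ℝ) ^ (-E))) := by
    refine (ih Y (Nat.le_add_left 1 _)).trans (mul_le_mul_of_nonneg_left ?_ hC)
    calc (Y : ℝ) ^ E ≤ (2 * X / p) ^ E := Real.rpow_le_rpow (by positivity) hYX hE0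
      _ = 2 ^ E * ((X : ℝ) ^ E * (p : ℝ) ^ (-E)) := by
        rw [Real.div_rpow (by positivity) hp0.le, Real.mul_rpow (by norm_num) hX0.le,
          Real.rpow_neg hp0.le]
        ring
      _ ≤ _ := by
        gcongr
        rw [← Real.rpow_natCast 2]
        exact Real.rpow_le_rpow_of_exponent_le (by norm_num) hE2
  have hA := recursion_constant_le hk hks' hS
  have hAR : 2 * ((k : ℝ) ^ (2 * (k + s)) * (k + s) * 4 ^ k + ((k + s).factorial : ℝ) ^ 2 * s * k ^ k) ≤
      (k : ℝ) ^ ((2 * B + 8) * (B * k ^ 2)) := by exact_mod_cast hA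
  have hF : 2 * ((p : ℝ) ^ (2 * k) * k ^ (2 * (k + s)) * (k + s) * (Y : ℝ) ^ (2 * k) +
        ((k + s).factorial : ℝ) ^ 2 * p ^ (2 * s) * s * X ^ k * k ^ k * p ^ h) ≤
      (k : ℝ) ^ ((2 * B + 8) * (B * k ^ 2)) * (X ^ k * (p : ℝ) ^ (2 * s + h)) := by
    have hp1 : (1 : ℝ) ≤ p := by exact_mod_cast hp.one_le
    have e1 : (p : ℝ) ^ (2 * k) * (Y : ℝ) ^ (2 * k) ≤ 4 ^ k * (X ^ k * (p : ℝ) ^ (2 * s + h)) := by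
      calc (p : ℝ) ^ (2 * k) * (Y : ℝ) ^ (2 * k) ≤ p ^ (2 * k) * (2 * X / p) ^ (2 * k) := by gcongr
        _ = 4 ^ k * (X ^ k * X ^ k) := by
          rw [← mul_pow, mul_div_cancel₀ _ hp0.ne', pow_mul, mul_pow, ← mul_pow (X : ℝ), ← mul_pow]
          ring
        _ ≤ _ := by
          gcongr 4 ^ k * (X ^ k * ?_)
          calc (X : ℝ) ^ k ≤ ((p : ℝ) ^ k) ^ k := by gcongr; exact_mod_cast hXp
            _ = p ^ (k * k) := (pow_mul _ _ _).symm
            _ ≤ _ := pow_le_pow_right₀ hp1 (by nlinarith)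
    calc _ = 2 * ((k : ℝ) ^ (2 * (k + s)) * (k + s) * ((p : ℝ) ^ (2 * k) * (Y : ℝ) ^ (2 * k)) +
        ((k + s).factorial : ℝ) ^ 2 * s * k ^ k * (X ^ k * (p : ℝ) ^ (2 * s + h))) := by
          rw [pow_add (p : ℝ)]; ring
      _ ≤ 2 * ((k : ℝ) ^ (2 * (k + s)) * (k + s) * (4 ^ k * (X ^ k * (p : ℝ) ^ (2 * s + h))) +
        ((k + s).factorial : ℝ) ^ 2 * s * k ^ k * (X ^ k * (p : ℝ) ^ (2 * s + h))) := by gcongr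
      _ = 2 * ((k : ℝ) ^ (2 * (k + s)) * (k + s) * 4 ^ k + ((k + s).factorial : ℝ) ^ 2 * s * k ^ k) *
          (X ^ k * (p : ℝ) ^ (2 * s + h)) := by ring
      _ ≤ _ := by gcongr
  have hpp : (p : ℝ) ^ (2 * s + h) * (p : ℝ) ^ (-E) ≤ 4 ^ (k ^ 2) * (X : ℝ) ^ (k - δ / k) := by
    have hk0 : (0 : ℝ) < k := by linarith
    have e0 : ((2 * s + h : ℕ) : ℝ) + -E = k ^ 2 - δ := by
      push_cast; rw [hhR, hE]; ring
    have e1 : 0 ≤ ((k : ℝ) ^ 2 - δ) / k := by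
      apply div_nonneg _ hk0.le
      nlinarith
    rw [← Real.rpow_natCast, ← Real.rpow_add hp0, e0]
    calc (p : ℝ) ^ ((k : ℝ) ^ 2 - δ) = ((p : ℝ) ^ k) ^ (((k : ℝ) ^ 2 - δ) / k) := by
          rw [← Real.rpow_natCast (p : ℝ) k, ← Real.rpow_mul hp0.le]
          congr 1; field_simp
      _ ≤ (4 ^ k * X) ^ (((k : ℝ) ^ 2 - δ) / k) :=
          Real.rpow_le_rpow (by positivity) (by exact_mod_cast hpk) e1
      _ = (4 ^ k) ^ (((k : ℝ) ^ 2 - δ) / k) * (X : ℝ) ^ (((k : ℝ) ^ 2 - δ) / k) :=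
          Real.mul_rpow (by positivity) hX0.le
      _ ≤ _ := by
        gcongr ?_ * (X : ℝ) ^ ?_
        · rw [← Real.rpow_natCast _ k, ← Real.rpow_natCast _ (k ^ 2), ← Real.rpow_mul (by norm_num)]
          apply Real.rpow_le_rpow_of_exponent_le (by norm_num)
          rw [mul_div_cancel₀ _ hk0.ne']
          push_cast
          linarith
        · apply le_of_eq; field_simp
  calc (vinMean (Fin (k + s)) k (Ico (0 : ℤ) X) : ℝ) ≤ _ := hrecR
    _ ≤ ((k : ℝ) ^ ((2 * B + 8) * (B * k ^ 2)) * (X ^ k * (p : ℝ) ^ (2 * s + h))) *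
        (C * (2 ^ (2 * s) * ((X : ℝ) ^ E * (p : ℝ) ^ (-E)))) := by gcongr
    _ = (k : ℝ) ^ ((2 * B + 8) * (B * k ^ 2)) * 2 ^ (2 * s) * C * (X ^ k * (X : ℝ) ^ E) *
        ((p : ℝ) ^ (2 * s + h) * (p : ℝ) ^ (-E)) := by ring
    _ ≤ (k : ℝ) ^ ((2 * B + 8) * (B * k ^ 2)) * 2 ^ (2 * s) * C * (X ^ k * (X : ℝ) ^ E) *
        (4 ^ (k ^ 2) * (X : ℝ) ^ (k - δ / k)) := by gcongr
    _ = (k : ℝ) ^ ((2 * B + 8) * (B * k ^ 2)) * (2 ^ (2 * s) * 4 ^ (k ^ 2)) * C *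
        (X ^ k * (X : ℝ) ^ E * (X : ℝ) ^ (k - δ / k)) := by ring
    _ ≤ (k : ℝ) ^ ((2 * B + 8) * (B * k ^ 2)) * (k ^ ((2 * B + 2) * k ^ 2)) * C *
        (X : ℝ) ^ (2 * (k + s : ℝ) - k * (k + 1) / 2 + δ * (1 - 1 / k)) := by
      gcongr ?_ * ?_ * C * ?_
      · calc (2 : ℝ) ^ (2 * s) * 4 ^ (k ^ 2) = 2 ^ (2 * s + 2 * k ^ 2) := by
              rw [pow_add, pow_mul 2 2 (k ^ 2)]; norm_num
          _ ≤ (k : ℝ) ^ (2 * s + 2 * k ^ 2) := by gcongr; linarith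
          _ ≤ _ := pow_le_pow_right₀ (by linarith) (by rw [add_mul]; nlinarith only [hS])
      · rw [← Real.rpow_natCast, ← Real.rpow_add hX0, ← Real.rpow_add hX0]
        apply Real.rpow_le_rpow_of_exponent_le hX1'
        apply le_of_eq
        rw [hE]; field_simp; ring
    _ = _ := by rw [pow_add]

/-- Vinogradov's mean value theorem with polynomial loss in the exponent of the constant. -/
theorem vinMean_le (R : ℕ) : ∃ D : ℕ, ∀ k : ℕ, 3 ≤ k → ∀ r ≤ R * k, ∀ X : ℕ, 1 ≤ X →
    (vinMean (Fin (r * k + k ^ 2)) k (Ico (0 : ℤ) X) : ℝ) ≤ (k : ℝ) ^ (D * (r + k) * k ^ 2) *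
      (X : ℝ) ^ ((2 * (r * k + k ^ 2) : ℝ) - k * (k + 1) / 2 +
        k * (k + 1) / 2 * (1 - 1 / (k : ℝ)) ^ r) := by
  set B := R + 2 with hB
  refine ⟨(2 * B + 8) * B + (2 * B + 2) + 1, fun k hk r => ?_⟩
  set D := (2 * B + 8) * B + (2 * B + 2) + 1 with hD
  have hkR : (3 : ℝ) ≤ k := by exact_mod_cast hk
  have h1k : 0 ≤ 1 - 1 / (k : ℝ) := by
    rw [sub_nonneg, div_le_one (by linarith)]; linarith
  have h1k' : 1 - 1 / (k : ℝ) ≤ 1 := by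
    rw [sub_le_self_iff]; positivity
  induction r with
  | zero =>
    intro _ X hX
    have hX1 : (1 : ℝ) ≤ X := by exact_mod_cast hX
    have h := vinMean_trivial (0 * k + k ^ 2) k X
    have h1 : (vinMean (Fin (0 * k + k ^ 2)) k (Ico (0 : ℤ) X) : ℝ) ≤ (X : ℝ) ^ (2 * (0 * k + k ^ 2)) := by
      exact_mod_cast h
    refine h1.trans ?_
    rw [← one_mul ((X : ℝ) ^ (2 * (0 * k + k ^ 2)))]
    gcongr ?_ * ?_
    · exact one_le_pow₀ (by linarith)
    · rw [← Real.rpow_natCast]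
      apply le_of_eq
      congr 1
      push_cast; ring
  | succ r ih =>
    intro hr X hX
    have hX1 : (1 : ℝ) ≤ X := by exact_mod_cast hX
    have hsum : (r + 1) * k + k ^ 2 = k + (r * k + k ^ 2) := by ring
    have hδ1 : (1 - 1 / (k : ℝ)) ^ r ≤ 1 := pow_le_one₀ h1k h1k'
    rcases le_or_gt X (k ^ k) with hXk | hXk
    · have h := vinMean_trivial ((r + 1) * k + k ^ 2) k X
      have h1 : (vinMean (Fin ((r + 1) * k + k ^ 2)) k (Ico (0 : ℤ) X) : ℝ) ≤
          (X : ℝ) ^ (2 * ((r + 1) * k + k ^ 2)) := by exact_mod_cast h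
      refine h1.trans ?_
      have hXkR : (X : ℝ) ≤ (k : ℝ) ^ k := by exact_mod_cast hXk
      have hp1 : (X : ℝ) ^ (k ^ 2) ≤ (k : ℝ) ^ (D * (r + 1 + k) * k ^ 2) := by
        calc (X : ℝ) ^ (k ^ 2) ≤ ((k : ℝ) ^ k) ^ (k ^ 2) := by gcongr
          _ = (k : ℝ) ^ (k * k ^ 2) := (pow_mul _ _ _).symm
          _ ≤ _ := by
            apply pow_le_pow_right₀ (by linarith)
            apply Nat.mul_le_mul_right
            calc k ≤ 1 * (r + 1 + k) := by omega
              _ ≤ D * (r + 1 + k) := Nat.mul_le_mul_right _ (by omega)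
      refine le_trans ?_ (mul_le_mul_of_nonneg_right hp1 (by positivity))
      rw [← Real.rpow_natCast, ← Real.rpow_natCast, ← Real.rpow_add (by linarith)]
      apply Real.rpow_le_rpow_of_exponent_le hX1
      have : 0 ≤ (k : ℝ) * (k + 1) / 2 * (1 - 1 / (k : ℝ)) ^ (r + 1) := by positivity
      push_cast
      nlinarith
    · have h := vinMean_step (B := B) (s := r * k + k ^ 2) hk (by nlinarith) (by nlinarith) hXk
        (C := (k : ℝ) ^ (D * (r + k) * k ^ 2)) (by positivity)
        (δ := k * (k + 1) / 2 * (1 - 1 / (k : ℝ)) ^ r) (by positivity)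
        (mul_le_of_le_one_right (by positivity) hδ1)
        (fun Y hY => by
          have := ih (by nlinarith) Y hY
          push_cast
          exact this)
      rw [hsum]
      refine h.trans ?_
      gcongr ?_ * ?_
      · rw [← pow_add]
        apply pow_le_pow_right₀ (by linarith)
        have : (2 * B + 8) * (B * k ^ 2) + (2 * B + 2) * k ^ 2 + D * (r + k) * k ^ 2 + k ^ 2 =
          D * (r + 1 + k) * k ^ 2 := by rw [hD]; ring
        omega
      · apply le_of_eq
        congr 1
        push_cast
        ring

end MeanValueTheorem

section Bilinear

/-- The additive character `x ↦ exp (2 π i x)`. -/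
noncomputable def expi (x : ℝ) : ℂ := Complex.exp (2 * Real.pi * x * Complex.I)

lemma norm_expi (x : ℝ) : ‖expi x‖ = 1 := by
  rw [expi, show (2 * Real.pi * x * Complex.I : ℂ) = ((2 * Real.pi * x : ℝ) : ℂ) * Complex.I by
    push_cast; ring, Complex.norm_exp_ofReal_mul_I]

lemma expi_add (x y : ℝ) : expi (x + y) = expi x * expi y := by
  rw [expi, expi, expi, ← Complex.exp_add]; congr 1; push_cast; ring

lemma expi_zero : expi 0 = 1 := by simp [expi]

lemma expi_neg (x : ℝ) : expi (-x) = star (expi x) := by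
  rw [expi, expi, Complex.star_def, ← Complex.exp_conj]
  congr 1
  simp [Complex.conj_ofNat]

lemma expi_sum {ι : Type*} (s : Finset ι) (f : ι → ℝ) : expi (∑ i ∈ s, f i) = ∏ i ∈ s, expi (f i) := by
  classical
  induction s using Finset.induction_on with
  | empty => simp [expi_zero]
  | insert a s ha ih => rw [sum_insert ha, prod_insert ha, expi_add, ih]

/-- Pairs of `b`-tuples with entries in `A`. -/
def tuplePairs (b : ℕ) (A : Finset ℤ) : Finset ((Fin b → ℤ) × (Fin b → ℤ)) :=
  (Fintype.piFinset fun _ => A) ×ˢ (Fintype.piFinset fun _ => A)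

/-- The difference of power sums of a pair of tuples. -/
def powDiff (k : ℕ) {b : ℕ} (q : (Fin b → ℤ) × (Fin b → ℤ)) : Fin k → ℤ :=
  ∑ i, powVec k (q.1 i) - ∑ i, powVec k (q.2 i)

lemma card_tuplePairs (b : ℕ) (A : Finset ℤ) : #(tuplePairs b A) = #A ^ (2 * b) := by
  rw [tuplePairs, card_product, Fintype.card_piFinset_const, two_mul, pow_add]

lemma norm_sum_expi_pow (A : Finset ℤ) (f : ℤ → ℝ) (b : ℕ) :
    ((‖∑ y ∈ A, expi (f y)‖ ^ (2 * b) : ℝ) : ℂ) =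
      ∑ q ∈ tuplePairs b A, expi (∑ i, f (q.1 i) - ∑ i, f (q.2 i)) := by
  have h1 : ((‖∑ y ∈ A, expi (f y)‖ ^ (2 * b) : ℝ) : ℂ) =
      (∑ y ∈ A, expi (f y)) ^ b * (∑ y ∈ A, expi (-f y)) ^ b := by
    rw [pow_mul]
    push_cast
    rw [← Complex.mul_conj', mul_pow]
    simp only [expi_neg, Complex.star_def, map_sum]
  have h2 : ∀ g : ℤ → ℂ, (∑ y ∈ A, g y) ^ b =
      ∑ y ∈ Fintype.piFinset fun _ : Fin b => A, ∏ i, g (y i) := by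
    intro g
    rw [← Finset.prod_univ_sum]
    simp
  rw [h1, h2, h2, sum_mul_sum, tuplePairs, sum_product]
  refine sum_congr rfl fun y _ => sum_congr rfl fun z _ => ?_
  rw [sub_eq_add_neg, expi_add, ← sum_neg_distrib, expi_sum, expi_sum]

lemma sum_mul_powDiff {k b : ℕ} (c : Fin k → ℝ) (q : (Fin b → ℤ) × (Fin b → ℤ)) :
    ∑ i, ∑ j, c j * (q.1 i : ℝ) ^ (j.1 + 1) - ∑ i, ∑ j, c j * (q.2 i : ℝ) ^ (j.1 + 1) =
      ∑ j, c j * powDiff k q j := by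
  rw [sum_comm, sum_comm (s := univ (α := Fin b)), ← sum_sub_distrib]
  refine sum_congr rfl fun j _ => ?_
  simp only [powDiff, powVec, Pi.sub_apply, Finset.sum_apply]
  push_cast
  rw [mul_sub, mul_sum, mul_sum]

lemma norm_sum_expi_poly_pow {k : ℕ} (A : Finset ℤ) (c : Fin k → ℝ) (b : ℕ) :
    ((‖∑ y ∈ A, expi (∑ j, c j * (y : ℝ) ^ (j.1 + 1))‖ ^ (2 * b) : ℝ) : ℂ) =
      ∑ q ∈ tuplePairs b A, expi (∑ j, c j * powDiff k q j) := by
  rw [norm_sum_expi_pow]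
  exact sum_congr rfl fun q _ => by rw [sum_mul_powDiff]

lemma energy_tuplePairs_le (k b : ℕ) (A : Finset ℤ) :
    energy (tuplePairs b A) (powDiff k) ≤ vinMean (Fin b) k A * #A ^ (2 * b) := by
  have h := energy_product_le_card_mul (Fintype.piFinset fun _ : Fin b => A)
    (Fintype.piFinset fun _ : Fin b => A) (fun x => -∑ i, powVec k (x i))
    (fun x => ∑ i, powVec k (x i)) (tuplePairs b A) (fun u hu u' hu' _ _ _ _ _ =>
      mem_product.2 ⟨hu, hu'⟩)
  rw [card_tuplePairs] at h
  refine le_trans ?_ h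
  refine energy_le_of_injOn Prod.swap (Prod.swap_injective.injOn) ?_ ?_
  · intro q hq
    rw [tuplePairs, mem_product] at hq
    exact mem_product.2 hq.symm
  · intro q _ r _ h
    simp only [Prod.fst_swap, Prod.snd_swap]
    rw [neg_add_eq_sub, neg_add_eq_sub]
    exact h

lemma card_powDiff_eq_le (k b : ℕ) (A : Finset ℤ) (v : Fin k → ℤ) :
    #{q ∈ tuplePairs b A | powDiff k q = v} ≤ vinMean (Fin b) k A := by
  refine le_trans (le_of_eq ?_) (card_shift_le_energy _ (fun x : Fin b → ℤ => ∑ i, powVec k (x i)) v)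
  rw [tuplePairs]
  refine congrArg card (filter_congr fun q _ => ?_)
  rw [powDiff, sub_eq_iff_eq_add, add_comm]

/-- The box containing all differences of power sums of `b`-tuples in `[0, M)`. -/
noncomputable def powBox (k b M : ℕ) : Finset (Fin k → ℤ) :=
  Fintype.piFinset fun j => Icc (-(b * M ^ (j.1 + 1) : ℤ)) (b * M ^ (j.1 + 1))

lemma powDiff_mem_powBox {k b M : ℕ} {q : (Fin b → ℤ) × (Fin b → ℤ)}
    (hq : q ∈ tuplePairs b (Ico (0 : ℤ) M)) : powDiff k q ∈ powBox k b M := by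
  rw [tuplePairs, mem_product, Fintype.mem_piFinset, Fintype.mem_piFinset] at hq
  rw [powBox, Fintype.mem_piFinset]
  intro j
  have key : ∀ y : Fin b → ℤ, (∀ i, y i ∈ Ico (0 : ℤ) M) →
      0 ≤ ∑ i, y i ^ (j.1 + 1) ∧ ∑ i, y i ^ (j.1 + 1) ≤ (b * M ^ (j.1 + 1) : ℤ) := by
    intro y hy
    refine ⟨sum_nonneg fun i _ => pow_nonneg (mem_Ico.1 (hy i)).1 _, ?_⟩
    refine (sum_le_card_nsmul _ _ ((M : ℤ) ^ (j.1 + 1)) fun i _ => ?_).trans (by simp)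
    exact pow_le_pow_left₀ (mem_Ico.1 (hy i)).1 (mem_Ico.1 (hy i)).2.le _
  have h1 := key _ hq.1
  have h2 := key _ hq.2
  simp only [powDiff, powVec, Pi.sub_apply, Finset.sum_apply, mem_Icc]
  constructor <;> linarith [h1.1, h1.2, h2.1, h2.2]

/-- The linear sums controlling a bilinear exponential sum of degree `j`. -/
noncomputable def linearSum (Z : ℕ) (α : ℝ) : ℝ :=
  ∑ u ∈ Icc (-(Z : ℤ)) Z, ‖∑ v ∈ Icc (-(Z : ℤ)) Z, expi (α * u * v)‖

lemma pow_sum_le_card_pow_mul_sum_pow {ι : Type*} (s : Finset ι) (f : ι → ℝ)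
    (hf : ∀ i ∈ s, 0 ≤ f i) {n : ℕ} (hn : n ≠ 0) :
    (∑ i ∈ s, f i) ^ n ≤ (#s : ℝ) ^ (n - 1) * ∑ i ∈ s, f i ^ n := by
  obtain ⟨n, rfl⟩ := Nat.exists_eq_succ_of_ne_zero hn
  rcases s.eq_empty_or_nonempty with rfl | hs
  · simp
  have := pow_sum_div_card_le_sum_pow hf n
  rw [div_le_iff₀' (by have := hs.card_pos; positivity)] at this
  simpa using this

theorem bilinear_sum_le (k b M : ℕ) (hb : 0 < b) (α : Fin k → ℝ) :
    ‖∑ x ∈ Ico (0 : ℤ) M, ∑ y ∈ Ico (0 : ℤ) M,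
      expi (∑ j, α j * (x : ℝ) ^ (j.1 + 1) * (y : ℝ) ^ (j.1 + 1))‖ ^ (2 * b * (2 * b)) ≤
    (M : ℝ) ^ ((2 * b - 1) * (2 * b) + 2 * b * (2 * b - 2) + 2 * b) *
      (vinMean (Fin b) k (Ico (0 : ℤ) M) : ℝ) ^ 2 * ∏ j : Fin k, linearSum (b * M ^ (j.1 + 1)) (α j) := by
  set A := Ico (0 : ℤ) M with hA
  have hAc : #A = M := by rw [hA, Int.card_Ico, sub_zero, Int.toNat_natCast]
  set J := vinMean (Fin b) k A with hJ
  set Q := tuplePairs b A with hQ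
  have hQc : #Q = M ^ (2 * b) := by rw [hQ, card_tuplePairs, hAc]
  set T : (Fin k → ℤ) → ℂ := fun v => ∑ x ∈ A, expi (∑ j, α j * v j * (x : ℝ) ^ (j.1 + 1)) with hT
  set S := ∑ x ∈ A, ∑ y ∈ A, expi (∑ j, α j * (x : ℝ) ^ (j.1 + 1) * (y : ℝ) ^ (j.1 + 1)) with hS
  have step1 : ‖S‖ ^ (2 * b) ≤ (M : ℝ) ^ (2 * b - 1) * ∑ q ∈ Q, ‖T (powDiff k q)‖ := by
    refine (pow_le_pow_left₀ (norm_nonneg _) (norm_sum_le _ _) _).trans ?_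
    refine (pow_sum_le_card_pow_mul_sum_pow _ _ (fun _ _ => norm_nonneg _)
      (by omega : 2 * b ≠ 0)).trans ?_
    rw [hAc]
    refine mul_le_mul_of_nonneg_left ?_ (by positivity)
    refine le_trans (le_of_eq ?_) (norm_sum_le Q fun q => T (powDiff k q))
    have h2 : ((∑ x ∈ A, ‖∑ y ∈ A, expi (∑ j, α j * (x : ℝ) ^ (j.1 + 1) * (y : ℝ) ^ (j.1 + 1))‖ ^
        (2 * b) : ℝ) : ℂ) = ∑ q ∈ Q, T (powDiff k q) := by
      push_cast
      rw [hT, sum_comm]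
      refine sum_congr rfl fun x _ => ?_
      have := norm_sum_expi_poly_pow A (fun j : Fin k => α j * (x : ℝ) ^ (j.1 + 1)) b
      push_cast at this
      rw [this]
      refine sum_congr rfl fun q _ => ?_
      congr 1
      exact sum_congr rfl fun j _ => by ring
    rw [← h2, Complex.norm_real, Real.norm_of_nonneg (sum_nonneg fun _ _ => by positivity)]
  have step2 : (∑ q ∈ Q, ‖T (powDiff k q)‖) ^ (2 * b) ≤
      (M : ℝ) ^ (2 * b * (2 * b - 2)) * ((J * M ^ (2 * b) : ℕ) * ∑ v ∈ powBox k b M, ‖T v‖ ^ (2 * b)) := by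
    have h1 := pow_sum_le_card_pow_mul_sum_pow Q (fun q => ‖T (powDiff k q)‖)
      (fun _ _ => norm_nonneg _) hb.ne'
    have h2 : ∑ q ∈ Q, ‖T (powDiff k q)‖ ^ b =
        ∑ v ∈ powBox k b M, (#{q ∈ Q | powDiff k q = v} : ℝ) * ‖T v‖ ^ b := by
      rw [← sum_fiberwise_of_maps_to (fun q hq => powDiff_mem_powBox hq)]
      refine sum_congr rfl fun v _ => ?_
      rw [sum_congr rfl (g := fun _ => ‖T v‖ ^ b) fun q hq => by rw [(mem_filter.1 hq).2],
        sum_const, nsmul_eq_mul]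
    have h3 : (∑ q ∈ Q, ‖T (powDiff k q)‖ ^ b) ^ 2 ≤
        (J * M ^ (2 * b) : ℕ) * ∑ v ∈ powBox k b M, ‖T v‖ ^ (2 * b) := by
      rw [h2]
      refine (sum_mul_sq_le_sq_mul_sq _ _ _).trans ?_
      have h4 : ∑ v ∈ powBox k b M, (#{q ∈ Q | powDiff k q = v} : ℝ) ^ 2 ≤ (J * M ^ (2 * b) : ℕ) := by
        have := energy_tuplePairs_le k b A
        rw [energy_eq_sum_sq _ _ (powBox k b M) (fun q hq => powDiff_mem_powBox hq), hAc] at this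
        exact_mod_cast this
      have h5 : ∀ v, (‖T v‖ ^ b) ^ 2 = ‖T v‖ ^ (2 * b) := fun v => by rw [← pow_mul, mul_comm]
      simp only [h5]
      exact mul_le_mul_of_nonneg_right h4 (sum_nonneg fun _ _ => by positivity)
    calc (∑ q ∈ Q, ‖T (powDiff k q)‖) ^ (2 * b) = ((∑ q ∈ Q, ‖T (powDiff k q)‖) ^ b) ^ 2 := by
          rw [← pow_mul, mul_comm]
      _ ≤ ((#Q : ℝ) ^ (b - 1) * ∑ q ∈ Q, ‖T (powDiff k q)‖ ^ b) ^ 2 := by gcongr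
      _ = (M : ℝ) ^ (2 * b * (2 * b - 2)) * (∑ q ∈ Q, ‖T (powDiff k q)‖ ^ b) ^ 2 := by
          rw [mul_pow, hQc]
          push_cast
          rw [← pow_mul, ← pow_mul]
          rw [show 2 * b - 2 = (b - 1) * 2 by omega]
      _ ≤ _ := by gcongr
  have step3 : ∑ v ∈ powBox k b M, ‖T v‖ ^ (2 * b) ≤
      J * ∏ j : Fin k, linearSum (b * M ^ (j.1 + 1)) (α j) := by
    set w : Fin k → ℤ → ℝ := fun j u =>
      ‖∑ v ∈ Icc (-(b * M ^ (j.1 + 1) : ℤ)) (b * M ^ (j.1 + 1)), expi (α j * u * v)‖ with hw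
    have h1 : ((∑ v ∈ powBox k b M, ‖T v‖ ^ (2 * b) : ℝ) : ℂ) = ∑ q ∈ Q, ∏ j : Fin k,
        ∑ v ∈ Icc (-(b * M ^ (j.1 + 1) : ℤ)) (b * M ^ (j.1 + 1)), expi (α j * powDiff k q j * v) := by
      have h2 : ∀ v : Fin k → ℤ, ((‖T v‖ ^ (2 * b) : ℝ) : ℂ) =
          ∑ q ∈ Q, ∏ j : Fin k, expi (α j * powDiff k q j * v j) := by
        intro v
        rw [hT, norm_sum_expi_poly_pow]
        refine sum_congr rfl fun q _ => ?_
        rw [expi_sum]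
        refine prod_congr rfl fun j _ => ?_
        congr 1; ring
      rw [Complex.ofReal_sum, sum_congr rfl fun v _ => h2 v, sum_comm]
      refine sum_congr rfl fun q _ => ?_
      rw [Finset.prod_univ_sum]
      rfl
    have h3 : ∑ v ∈ powBox k b M, ‖T v‖ ^ (2 * b) ≤ ∑ q ∈ Q, ∏ j : Fin k, w j (powDiff k q j) := by
      have h4 : ∑ v ∈ powBox k b M, ‖T v‖ ^ (2 * b) =
          ‖((∑ v ∈ powBox k b M, ‖T v‖ ^ (2 * b) : ℝ) : ℂ)‖ := by
        rw [Complex.norm_real, Real.norm_of_nonneg (sum_nonneg fun _ _ => by positivity)]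
      rw [h4, h1]
      refine (norm_sum_le _ _).trans (sum_le_sum fun q _ => ?_)
      rw [norm_prod]
    refine h3.trans ?_
    rw [← sum_fiberwise_of_maps_to (fun q hq => powDiff_mem_powBox hq)]
    calc _ = ∑ u ∈ powBox k b M, (#{q ∈ Q | powDiff k q = u} : ℝ) * ∏ j : Fin k, w j (u j) := by
          refine sum_congr rfl fun u _ => ?_
          rw [sum_congr rfl (g := fun _ => ∏ j : Fin k, w j (u j)) fun q hq => by
            rw [(mem_filter.1 hq).2], sum_const, nsmul_eq_mul]
      _ ≤ ∑ u ∈ powBox k b M, (J : ℝ) * ∏ j : Fin k, w j (u j) := by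
          refine sum_le_sum fun u _ => mul_le_mul_of_nonneg_right ?_
            (prod_nonneg fun _ _ => norm_nonneg _)
          exact_mod_cast card_powDiff_eq_le k b A u
      _ = J * ∏ j : Fin k, linearSum (b * M ^ (j.1 + 1)) (α j) := by
          rw [← mul_sum, powBox, ← Finset.prod_univ_sum (f := w)]
          congr 1
  calc ‖S‖ ^ (2 * b * (2 * b)) = (‖S‖ ^ (2 * b)) ^ (2 * b) := pow_mul _ _ _
    _ ≤ ((M : ℝ) ^ (2 * b - 1) * ∑ q ∈ Q, ‖T (powDiff k q)‖) ^ (2 * b) := by gcongr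
    _ = (M : ℝ) ^ ((2 * b - 1) * (2 * b)) * (∑ q ∈ Q, ‖T (powDiff k q)‖) ^ (2 * b) := by
        rw [mul_pow, ← pow_mul]
    _ ≤ (M : ℝ) ^ ((2 * b - 1) * (2 * b)) * ((M : ℝ) ^ (2 * b * (2 * b - 2)) *
        ((J * M ^ (2 * b) : ℕ) * (J * ∏ j : Fin k, linearSum (b * M ^ (j.1 + 1)) (α j)))) := by
        gcongr
        exact step2.trans (by gcongr)
    _ = _ := by
        push_cast
        rw [pow_add, pow_add]
        ring

end Bilinear

section LinearSum

lemma norm_expi_sub_one (x : ℝ) : ‖expi x - 1‖ = 2 * |Real.sin (Real.pi * x)| := by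
  have := Complex.norm_exp_I_mul_ofReal_sub_one (2 * Real.pi * x)
  rw [expi]
  rw [show (2 * Real.pi * x * Complex.I : ℂ) = Complex.I * ((2 * Real.pi * x : ℝ) : ℂ) by
    push_cast; ring, this, show 2 * Real.pi * x / 2 = Real.pi * x by ring, norm_mul]
  simp

lemma expi_int (n : ℤ) : expi n = 1 := by
  rw [expi, Complex.exp_eq_one_iff]
  exact ⟨n, by push_cast; ring⟩

lemma abs_sub_round_le_norm_expi_sub_one (x : ℝ) : 4 * |x - round x| ≤ ‖expi x - 1‖ := by
  have h1 : expi x = expi (x - round x) := by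
    rw [sub_eq_add_neg, expi_add, ← Int.cast_neg, expi_int, mul_one]
  rw [h1, norm_expi_sub_one]
  have h2 := abs_sub_round x
  have h3 := Real.mul_abs_le_abs_sin (x := Real.pi * (x - round x)) (by
    rw [abs_mul, abs_of_pos Real.pi_pos]; nlinarith [Real.pi_pos])
  rw [abs_mul, abs_of_pos Real.pi_pos] at h3
  have : 2 / Real.pi * (Real.pi * |x - round x|) = 2 * |x - round x| := by
    field_simp
  linarith

lemma norm_sum_expi_mul_abs_sub_round_le (Z : ℕ) (β : ℝ) :
    ‖∑ v ∈ Icc (-(Z : ℤ)) Z, expi (β * v)‖ * |β - round β| ≤ 1 := by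
  set S := ∑ v ∈ Icc (-(Z : ℤ)) Z, expi (β * v)
  have h1 : S * (expi β - 1) = expi (β * (Z + 1)) - expi (-(β * Z)) := by
    have key : ∀ n : ℕ, (∑ v ∈ Ico (-(Z : ℤ)) (-Z + n), expi (β * v)) * (expi β - 1) =
        expi (β * (-Z + n)) - expi (-(β * Z)) := by
      intro n
      induction n with
      | zero => simp
      | succ n ih =>
        have : Ico (-(Z : ℤ)) (-Z + (n + 1 : ℕ)) = insert (-Z + n : ℤ) (Ico (-(Z : ℤ)) (-Z + n)) := by
          ext x; simp only [mem_Ico, mem_insert]; push_cast; omega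
        rw [this, sum_insert (by simp), add_mul, ih]
        push_cast
        rw [show β * (-Z + (n + 1)) = β * (-Z + n) + β by ring, expi_add (β * (-Z + n))]
        ring
    have h2 : Icc (-(Z : ℤ)) Z = Ico (-(Z : ℤ)) (-Z + (2 * Z + 1 : ℕ)) := by
      ext x; simp only [mem_Icc, mem_Ico]; push_cast; omega
    have := key (2 * Z + 1)
    rw [← h2] at this
    rw [this]
    push_cast
    congr 2; ring
  have h2 : ‖S‖ * ‖expi β - 1‖ ≤ 2 := by
    rw [← norm_mul, h1]
    refine (norm_sub_le _ _).trans ?_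
    rw [norm_expi, norm_expi]; norm_num
  have h3 := abs_sub_round_le_norm_expi_sub_one β
  nlinarith [norm_nonneg S, mul_le_mul_of_nonneg_left h3 (norm_nonneg S)]

lemma linearSum_neg (Z : ℕ) (α : ℝ) : linearSum Z (-α) = linearSum Z α := by
  refine sum_congr rfl fun u _ => ?_
  rw [← norm_star (∑ v ∈ Icc (-(Z : ℤ)) Z, expi (α * u * v)), star_sum]
  congr 1
  refine sum_congr rfl fun v _ => ?_
  rw [← expi_neg]; congr 1; ring

lemma linearSum_nonneg (Z : ℕ) (α : ℝ) : 0 ≤ linearSum Z α :=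
  sum_nonneg fun _ _ => norm_nonneg _

lemma card_Icc_neg_self (Z : ℕ) : #(Icc (-(Z : ℤ)) Z) = 2 * Z + 1 := by
  rw [Int.card_Icc]; omega

lemma norm_sum_expi_Icc_le (Z : ℕ) (β : ℝ) :
    ‖∑ v ∈ Icc (-(Z : ℤ)) Z, expi (β * v)‖ ≤ 2 * Z + 1 := by
  refine (norm_sum_le _ _).trans ?_
  simp only [norm_expi, sum_const, card_Icc_neg_self, nsmul_eq_mul]
  push_cast; linarith

lemma linearSum_le_sq (Z : ℕ) (α : ℝ) : linearSum Z α ≤ (2 * Z + 1) ^ 2 := by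
  refine (sum_le_card_nsmul _ _ (2 * Z + 1 : ℝ) fun u _ => norm_sum_expi_Icc_le Z _).trans ?_
  rw [card_Icc_neg_self]; simp; apply le_of_eq; ring

lemma card_filter_abs_sub_round_le (Z : ℕ) {α Δ : ℝ} (hα : 0 < α) (hΔ : 0 < Δ) :
    (#((Icc (-(Z : ℤ)) Z).filter (fun u : ℤ => |α * u - round (α * u)| ≤ Δ)) : ℝ) ≤
      (2 * Δ / α + 1) * (2 * α * Z + 2) := by
  set K : ℤ := ⌊α * Z + 1 / 2⌋ with hK
  have hK0 : 0 ≤ K := Int.floor_nonneg.2 (by positivity)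
  have h := card_le_mul_card_image_of_maps_to
    (s := (Icc (-(Z : ℤ)) Z).filter (fun u : ℤ => |α * u - round (α * u)| ≤ Δ)) (t := Icc (-K) K)
    (f := fun u : ℤ => round (α * u)) (by
      intro u hu
      have hu' := mem_Icc.1 (mem_filter.1 hu).1
      have h1 := abs_le.1 (abs_sub_round (α * u))
      have h2 : (u : ℝ) ≤ Z := by exact_mod_cast hu'.2
      have h3 : -(Z : ℝ) ≤ u := by exact_mod_cast hu'.1
      have h4 : round (α * u) ≤ K := Int.le_floor.2 (by nlinarith)
      have h5 : -round (α * u) ≤ K := Int.le_floor.2 (by push_cast; nlinarith)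
      rw [mem_Icc]
      omega) (⌊2 * Δ / α⌋₊ + 1) (by
      intro r _
      have hsub : ((Icc (-(Z : ℤ)) Z).filter (fun u : ℤ => |α * u - round (α * u)| ≤ Δ)).filter (fun u : ℤ => round (α * u) = r) ⊆
          Icc ⌈(r - Δ) / α⌉ (⌈(r - Δ) / α⌉ + ⌊2 * Δ / α⌋₊) := by
        intro u hu
        obtain ⟨h1, h2⟩ := mem_filter.1 hu
        have h3 := abs_le.1 (mem_filter.1 h1).2
        rw [h2] at h3
        rw [mem_Icc, Int.ceil_le, div_le_iff₀ hα]
        refine ⟨by linarith, ?_⟩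
        have h4 : u - ⌈(r - Δ) / α⌉ ≤ ⌊2 * Δ / α⌋ := by
          rw [Int.le_floor]
          push_cast
          have h5 := Int.le_ceil ((r - Δ) / α)
          have h6 : (u : ℝ) ≤ (r + Δ) / α := by rw [le_div_iff₀ hα]; linarith
          have h7 : (r + Δ) / α - (r - Δ) / α = 2 * Δ / α := by ring
          linarith
        have h5 : ((⌊2 * Δ / α⌋₊ : ℕ) : ℤ) = ⌊2 * Δ / α⌋ := Int.natCast_floor_eq_floor (by positivity)
        linarith
      refine (card_le_card hsub).trans ?_
      rw [Int.card_Icc]; omega)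
  have h' : (#((Icc (-(Z : ℤ)) Z).filter (fun u : ℤ => |α * u - round (α * u)| ≤ Δ)) : ℝ) ≤
      ((⌊2 * Δ / α⌋₊ : ℝ) + 1) * #(Icc (-K) K) := by exact_mod_cast h
  refine h'.trans (mul_le_mul ?_ ?_ (by positivity) (by positivity))
  · have := Nat.floor_le (show 0 ≤ 2 * Δ / α by positivity)
    linarith
  · have h1 : (#(Icc (-K) K) : ℤ) = 2 * K + 1 := by rw [Int.card_Icc]; omega
    have h2 : (#(Icc (-K) K) : ℝ) = 2 * K + 1 := by exact_mod_cast h1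
    have h3 := Int.floor_le (α * Z + 1 / 2)
    rw [h2]; linarith

lemma linearSum_le_of_pos (Z : ℕ) (hZ : 1 ≤ Z) {α : ℝ} (hα : 0 < α) (hα1 : α ≤ 1) :
    linearSum Z α ≤ (2 * Z + 1) ^ 2 * (3 * √α + 4 / (Z * √α)) := by
  have hs : 0 < √α := Real.sqrt_pos.2 hα
  have hs1 : √α ≤ 1 := Real.sqrt_le_one.2 hα1
  have hss : √α * √α = α := Real.mul_self_sqrt hα.le
  have hZ' : (1 : ℝ) ≤ Z := by exact_mod_cast hZ
  rw [linearSum, ← sum_filter_add_sum_filter_not _ fun u : ℤ => |α * u - round (α * u)| ≤ √α]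
  have h1 : ∑ u ∈ (Icc (-(Z : ℤ)) Z).filter (fun u : ℤ => |α * u - round (α * u)| ≤ √α),
      ‖∑ v ∈ Icc (-(Z : ℤ)) Z, expi (α * u * v)‖ ≤
      ((2 * √α / α + 1) * (2 * α * Z + 2)) * (2 * Z + 1) := by
    refine (sum_le_card_nsmul _ _ (2 * Z + 1 : ℝ) fun u _ => norm_sum_expi_Icc_le Z _).trans ?_
    rw [nsmul_eq_mul]
    exact mul_le_mul_of_nonneg_right (card_filter_abs_sub_round_le Z hα hs) (by positivity)
  have h2 : ∑ u ∈ (Icc (-(Z : ℤ)) Z).filter (fun u : ℤ => ¬ |α * u - round (α * u)| ≤ √α),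
      ‖∑ v ∈ Icc (-(Z : ℤ)) Z, expi (α * u * v)‖ ≤ (2 * Z + 1) * (1 / √α) := by
    refine (sum_le_card_nsmul _ _ (1 / √α) fun u hu => ?_).trans ?_
    · have h3 := norm_sum_expi_mul_abs_sub_round_le Z (α * u)
      have h4 := not_le.1 (mem_filter.1 hu).2
      rw [le_div_iff₀ hs]
      exact (mul_le_mul_of_nonneg_left h4.le (norm_nonneg _)).trans h3
    · rw [nsmul_eq_mul]
      refine mul_le_mul_of_nonneg_right ?_ (by positivity)
      exact_mod_cast (card_filter_le _ _).trans (card_Icc_neg_self Z).le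
  refine (add_le_add h1 h2).trans ?_
  have e1 : 2 * √α / α = 2 / √α := by rw [div_eq_div_iff hα.ne' hs.ne', mul_assoc, hss]
  rw [e1]
  have h3 : 2 / √α + 1 ≤ 3 / √α := by
    rw [div_add_one hs.ne', div_le_div_iff_of_pos_right hs]; linarith
  have h4 : (2 / √α + 1) * (2 * α * Z + 2) ≤ 3 / √α * (2 * α * Z + 2) :=
    mul_le_mul_of_nonneg_right h3 (by positivity)
  have h5 : 3 / √α * (2 * α * Z + 2) = 6 * √α * Z + 6 / √α := by
    rw [← hss]; field_simp; rw [Real.sqrt_sq hs.le]; ring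
  have h6 : (2 * Z + 1) ^ 2 * (3 * √α + 4 / (Z * √α)) =
    (2 * Z + 1) * ((2 * Z + 1) * (3 * √α) + (2 * Z + 1) / Z * (4 / √α)) := by field_simp
  rw [h6]
  have h7 : (2 : ℝ) ≤ (2 * Z + 1) / Z := by rw [le_div_iff₀ (by positivity)]; linarith
  have h8 : 0 < 1 / √α := by positivity
  have h9 : 2 * (4 / √α) ≤ (2 * Z + 1) / Z * (4 / √α) :=
    mul_le_mul_of_nonneg_right h7 (by positivity)
  have e2 : 6 / √α = 6 * (1 / √α) := by ring
  have e3 : 4 / √α = 4 * (1 / √α) := by ring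
  have h10 : (2 / √α + 1) * (2 * α * Z + 2) + 1 / √α ≤
      (2 * Z + 1) * (3 * √α) + (2 * Z + 1) / Z * (4 / √α) := by
    rw [e3] at h9 ⊢
    rw [h5, e2] at h4
    nlinarith
  nlinarith [mul_le_mul_of_nonneg_right h10 (show (0 : ℝ) ≤ 2 * Z + 1 by positivity)]

lemma linearSum_le (Z : ℕ) (hZ : 1 ≤ Z) {α : ℝ} (hα : α ≠ 0) (hα1 : |α| ≤ 1) :
    linearSum Z α ≤ (2 * Z + 1) ^ 2 * (3 * √|α| + 4 / (Z * √|α|)) := by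
  have h : linearSum Z α = linearSum Z |α| := by
    rcases abs_choice α with h | h <;> rw [h]
    rw [linearSum_neg]
  rw [h]
  exact linearSum_le_of_pos Z hZ (abs_pos.2 hα) hα1

end LinearSum

section BilinearBound

/-- The bilinear exponential sum of degree `k` with coefficients `α`. -/
noncomputable def bilinearSum (k M : ℕ) (α : Fin k → ℝ) : ℂ :=
  ∑ x ∈ Ico (0 : ℤ) M, ∑ y ∈ Ico (0 : ℤ) M,
    expi (∑ j, α j * (x : ℝ) ^ (j.1 + 1) * (y : ℝ) ^ (j.1 + 1))

lemma one_sub_inv_pow_le (k : ℕ) (hk : 1 ≤ k) : (1 - 1 / (k : ℝ)) ^ (11 * k) ≤ 1 / 2048 := by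
  have h1 : (1 - 1 / (k : ℝ)) ^ k ≤ 1 / 2 := by
    refine (Real.one_sub_div_pow_le_exp_neg (by exact_mod_cast hk)).trans ?_
    rw [Real.exp_neg, ← one_div]
    have := Real.add_one_le_exp (1 : ℝ)
    exact one_div_le_one_div_of_le (by norm_num) (by linarith)
  have h0 : 0 ≤ (1 - 1 / (k : ℝ)) ^ k := pow_nonneg (by
    have : 1 / (k : ℝ) ≤ 1 := by
      rw [div_le_one (by positivity)]; exact_mod_cast hk
    linarith) _
  calc (1 - 1 / (k : ℝ)) ^ (11 * k) = ((1 - 1 / (k : ℝ)) ^ k) ^ 11 := by rw [← pow_mul, mul_comm]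
    _ ≤ (1 / 2) ^ 11 := pow_le_pow_left₀ h0 h1 _
    _ = 1 / 2048 := by norm_num

lemma prod_linearSum_le (k b M : ℕ) (hb : 1 ≤ b) (hM : 1 ≤ M) (α : Fin k → ℝ) (G : Finset (Fin k))
    {g : ℝ}
    (hg : ∀ j ∈ G, linearSum (b * M ^ (j.1 + 1)) (α j) ≤ (2 * (b * M ^ (j.1 + 1) : ℕ) + 1) ^ 2 * g) :
    ∏ j : Fin k, linearSum (b * M ^ (j.1 + 1)) (α j) ≤
      (9 * b ^ 2) ^ k * (M : ℝ) ^ (k * (k + 1)) * g ^ #G := by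
  classical
  have h3 : ∀ j : Fin k, (2 * (b * M ^ (j.1 + 1) : ℕ) + 1 : ℝ) ^ 2 ≤
      9 * b ^ 2 * (M : ℝ) ^ (2 * (j.1 + 1)) := by
    intro j
    have h4 : 1 ≤ b * M ^ (j.1 + 1) := Nat.one_le_iff_ne_zero.2 (by positivity)
    have h5 : (1 : ℝ) ≤ (b * M ^ (j.1 + 1) : ℕ) := by exact_mod_cast h4
    calc _ ≤ (3 * ((b * M ^ (j.1 + 1) : ℕ) : ℝ)) ^ 2 := by gcongr; linarith
      _ = _ := by push_cast; ring
  calc ∏ j : Fin k, linearSum (b * M ^ (j.1 + 1)) (α j)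
      ≤ ∏ j : Fin k, (9 * b ^ 2 * (M : ℝ) ^ (2 * (j.1 + 1))) * (if j ∈ G then g else 1) := by
        refine prod_le_prod (fun _ _ => linearSum_nonneg _ _) fun j _ => ?_
        split_ifs with hj
        · have hg0 : 0 ≤ g := by
            by_contra hlt
            push Not at hlt
            have := (linearSum_nonneg _ _).trans (hg j hj)
            have h6 : (0 : ℝ) < (2 * (b * M ^ (j.1 + 1) : ℕ) + 1) ^ 2 := by positivity
            nlinarith
          exact (hg j hj).trans (mul_le_mul_of_nonneg_right (h3 j) hg0)
        · rw [mul_one]; exact (linearSum_le_sq _ _).trans (h3 j)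
    _ = _ := by
        rw [prod_mul_distrib, prod_mul_distrib, prod_const, card_univ, Fintype.card_fin,
          prod_ite, prod_const_one, prod_const, mul_one, filter_mem_eq_inter, univ_inter]
        congr 2
        rw [prod_pow_eq_pow_sum]
        congr 1
        rw [Fin.sum_univ_eq_sum_range (fun i => 2 * (i + 1)) k]
        clear hg G α h3
        induction k with
        | zero => simp
        | succ n ih => rw [sum_range_succ, ih]; ring

theorem norm_bilinearSum_pow_le : ∃ D : ℕ, ∀ k, 3 ≤ k → ∀ M : ℕ, 1 ≤ M → ∀ (α : Fin k → ℝ)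
    (G : Finset (Fin k)) (g : ℝ), (∀ j ∈ G, linearSum (12 * k ^ 2 * M ^ (j.1 + 1)) (α j) ≤
      (2 * (12 * k ^ 2 * M ^ (j.1 + 1) : ℕ) + 1) ^ 2 * g) →
    ‖bilinearSum k M α‖ ^ (576 * k ^ 4) ≤
      (k : ℝ) ^ (D * k ^ 3) * (M : ℝ) ^ ((2 * (576 * k ^ 4) : ℝ) + k * (k + 1) / 2048) * g ^ #G := by
  obtain ⟨D, hD⟩ := vinMean_le 11
  refine ⟨24 * D + 9, fun k hk M hM α G g hg => ?_⟩
  have hk' : (3 : ℝ) ≤ k := by exact_mod_cast hk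
  have hM' : (1 : ℝ) ≤ M := by exact_mod_cast hM
  have hbeq : 11 * k * k + k ^ 2 = 12 * k ^ 2 := by ring
  have h1 := hD k hk (11 * k) le_rfl M hM
  rw [hbeq] at h1
  set b := 12 * k ^ 2 with hb
  have hb1 : 1 ≤ b := Nat.one_le_iff_ne_zero.2 (by positivity)
  have h2 := bilinear_sum_le k b M (by omega) α
  have hn : 2 * b * (2 * b) = 576 * k ^ 4 := by rw [hb]; ring
  rw [← hn]
  have hg0 : 0 ≤ g ^ #G := by
    rcases G.eq_empty_or_nonempty with rfl | ⟨j, hj⟩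
    · simp
    · refine pow_nonneg ?_ _
      by_contra hlt
      push Not at hlt
      have := (linearSum_nonneg _ _).trans (hg j hj)
      have h6 : (0 : ℝ) < (2 * (b * M ^ (j.1 + 1) : ℕ) + 1) ^ 2 := by positivity
      nlinarith
  have hVe : (vinMean (Fin b) k (Ico (0 : ℤ) M) : ℝ) ≤ (k : ℝ) ^ (D * (11 * k + k) * k ^ 2) *
      (M : ℝ) ^ ((2 * b : ℝ) - k * (k + 1) / 2 + k * (k + 1) / 4096) := by
    refine h1.trans (mul_le_mul_of_nonneg_left ?_ (by positivity))
    refine Real.rpow_le_rpow_of_exponent_le hM' ?_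
    have h3 := one_sub_inv_pow_le k (by omega)
    have h4 : ((11 * k : ℕ) * k + k ^ 2 : ℝ) = b := by rw [hb]; push_cast; ring
    rw [h4]
    have h5 : (0 : ℝ) ≤ k * (k + 1) / 2 := by positivity
    nlinarith
  have hV0 : (0 : ℝ) ≤ vinMean (Fin b) k (Ico (0 : ℤ) M) := by positivity
  have hP := prod_linearSum_le k b M hb1 hM α G hg
  have hC : ((k : ℝ) ^ (D * (11 * k + k) * k ^ 2)) ^ 2 * (9 * (b : ℝ) ^ 2) ^ k ≤
      (k : ℝ) ^ ((24 * D + 9) * k ^ 3) := by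
    have h5 : 9 * (b : ℝ) ^ 2 ≤ (k : ℝ) ^ 11 := by
      have : 9 * (b : ℝ) ^ 2 = 1296 * (k : ℝ) ^ 4 := by rw [hb]; push_cast; ring
      rw [this]
      have : (1296 : ℝ) ≤ (k : ℝ) ^ 7 := by
        calc (1296 : ℝ) ≤ 3 ^ 7 := by norm_num
          _ ≤ (k : ℝ) ^ 7 := by gcongr
      calc (1296 : ℝ) * k ^ 4 ≤ k ^ 7 * k ^ 4 := by gcongr
        _ = _ := by ring
    calc _ ≤ ((k : ℝ) ^ (D * (11 * k + k) * k ^ 2)) ^ 2 * ((k : ℝ) ^ 11) ^ k := by gcongr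
      _ = (k : ℝ) ^ (24 * D * k ^ 3 + 11 * k) := by
          rw [← pow_mul, ← pow_mul, ← pow_add]; congr 1; ring
      _ ≤ _ := by
          refine pow_le_pow_right₀ (by linarith) ?_
          have : 9 ≤ k ^ 2 := by nlinarith
          have : 9 * k ≤ k ^ 3 := by nlinarith
          nlinarith
  have hE : (M : ℝ) ^ ((2 * b - 1) * (2 * b) + 2 * b * (2 * b - 2) + 2 * b) =
      (M : ℝ) ^ ((8 * b ^ 2 : ℝ) - 4 * b) := by
    rw [← Real.rpow_natCast]
    congr 1
    have h6 : ((2 * b - 1 : ℕ) : ℝ) = 2 * b - 1 := by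
      rw [Nat.cast_sub (by omega)]; push_cast; ring
    have h7 : ((2 * b - 2 : ℕ) : ℝ) = 2 * b - 2 := by
      rw [Nat.cast_sub (by omega)]; push_cast; ring
    push_cast [h6, h7]
    ring
  have hMp : 0 < (M : ℝ) := by linarith
  calc ‖bilinearSum k M α‖ ^ (2 * b * (2 * b)) ≤ _ := h2
    _ ≤ (M : ℝ) ^ ((8 * b ^ 2 : ℝ) - 4 * b) * ((k : ℝ) ^ (D * (11 * k + k) * k ^ 2) *
        (M : ℝ) ^ ((2 * b : ℝ) - k * (k + 1) / 2 + k * (k + 1) / 4096)) ^ 2 *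
        ((9 * b ^ 2) ^ k * (M : ℝ) ^ (k * (k + 1)) * g ^ #G) := by
        rw [hE]
        refine mul_le_mul ?_ hP (prod_nonneg fun _ _ => linearSum_nonneg _ _) (by positivity)
        exact mul_le_mul_of_nonneg_left (pow_le_pow_left₀ hV0 hVe 2) (by positivity)
    _ = (((k : ℝ) ^ (D * (11 * k + k) * k ^ 2)) ^ 2 * (9 * (b : ℝ) ^ 2) ^ k) *
        ((M : ℝ) ^ ((8 * b ^ 2 : ℝ) - 4 * b) *
        ((M : ℝ) ^ ((2 * b : ℝ) - k * (k + 1) / 2 + k * (k + 1) / 4096)) ^ 2 *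
        (M : ℝ) ^ (k * (k + 1))) * g ^ #G := by ring
    _ = (((k : ℝ) ^ (D * (11 * k + k) * k ^ 2)) ^ 2 * (9 * (b : ℝ) ^ 2) ^ k) *
        (M : ℝ) ^ ((2 * (576 * k ^ 4) : ℝ) + k * (k + 1) / 2048) * g ^ #G := by
        congr 2
        rw [pow_two ((M : ℝ) ^ _), ← Real.rpow_natCast (M : ℝ) (k * (k + 1)),
          ← Real.rpow_add hMp, ← Real.rpow_add hMp, ← Real.rpow_add hMp]
        congr 1
        rw [hb]; push_cast; ring
    _ ≤ _ := by gcongr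

end BilinearBound

section ZetaSum

lemma norm_expi_sub_expi_le (x y : ℝ) : ‖expi x - expi y‖ ≤ 2 * Real.pi * |x - y| := by
  have h : expi x - expi y = expi y * (expi (x - y) - 1) := by
    rw [mul_sub, ← expi_add, mul_one]; congr 2; ring
  rw [h, norm_mul, norm_expi, one_mul, norm_expi_sub_one]
  have := Real.abs_sin_le_abs (x := Real.pi * (x - y))
  rw [abs_mul, abs_of_pos Real.pi_pos] at this
  linarith

/-- Taylor coefficients of the phase of `n ^ (-it)`. -/
noncomputable def phaseCoeff (t n : ℝ) (k : ℕ) (j : Fin k) : ℝ :=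
  t / (2 * Real.pi) * (-1) ^ (j.1 + 1) / ((j.1 + 1) * n ^ (j.1 + 1))

lemma abs_phaseCoeff {t n : ℝ} (ht : 0 < t) (hn : 0 < n) (k : ℕ) (j : Fin k) :
    |phaseCoeff t n k j| = t / (2 * Real.pi * (j.1 + 1) * n ^ (j.1 + 1)) := by
  have h : phaseCoeff t n k j = (-1) ^ (j.1 + 1) * (t / (2 * Real.pi * (j.1 + 1) * n ^ (j.1 + 1))) := by
    rw [phaseCoeff]; field_simp
  rw [h, abs_mul, abs_pow, abs_neg, abs_one, one_pow, one_mul, abs_of_nonneg (by positivity)]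

lemma norm_phase_sub_le {t n z : ℝ} (ht : 0 < t) (hn : 0 < n) (hz : 0 ≤ z) (hzn : z ≤ n / 2) (k : ℕ) :
    ‖expi (-(t / (2 * Real.pi)) * Real.log (n + z)) -
      expi (-(t / (2 * Real.pi)) * Real.log n) *
        expi (∑ j : Fin k, phaseCoeff t n k j * z ^ (j.1 + 1))‖ ≤ 2 * t * (z / n) ^ (k + 1) := by
  rw [← expi_add]
  refine (norm_expi_sub_expi_le _ _).trans ?_
  have hu0 : 0 ≤ z / n := by positivity
  have hu1 : z / n ≤ 1 / 2 := by rw [div_le_iff₀ hn]; linarith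
  have h1 := Real.abs_log_sub_add_sum_range_le (x := -(z / n)) (by
    rw [abs_neg, abs_of_nonneg hu0]; linarith) k
  rw [abs_neg, abs_of_nonneg hu0, sub_neg_eq_add] at h1
  have h2 : (∑ j : Fin k, phaseCoeff t n k j * z ^ (j.1 + 1)) =
      t / (2 * Real.pi) * ∑ i ∈ range k, (-(z / n)) ^ (i + 1) / (i + 1) := by
    rw [← Fin.sum_univ_eq_sum_range (fun i => (-(z / n)) ^ (i + 1) / ((i : ℝ) + 1)) k, mul_sum]
    refine sum_congr rfl fun j _ => ?_
    rw [phaseCoeff, neg_pow (z / n), div_pow]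
    field_simp
  have h3 : Real.log (n + z) = Real.log n + Real.log (1 + z / n) := by
    rw [← Real.log_mul hn.ne' (by positivity)]; congr 1; field_simp
  rw [h2, h3]
  have h4 : -(t / (2 * Real.pi)) * (Real.log n + Real.log (1 + z / n)) -
      (-(t / (2 * Real.pi)) * Real.log n +
        t / (2 * Real.pi) * ∑ i ∈ range k, (-(z / n)) ^ (i + 1) / (i + 1)) =
      -(t / (2 * Real.pi)) * (∑ i ∈ range k, (-(z / n)) ^ (i + 1) / ((i : ℝ) + 1) +
        Real.log (1 + z / n)) := by ring
  rw [h4, abs_mul, abs_neg, abs_of_nonneg (by positivity : 0 ≤ t / (2 * Real.pi))]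
  have h5 : (z / n) ^ (k + 1) / (1 - z / n) ≤ 2 * (z / n) ^ (k + 1) := by
    rw [div_le_iff₀ (by linarith)]
    have : 0 ≤ (z / n) ^ (k + 1) := by positivity
    nlinarith
  have h6 : 2 * Real.pi * (t / (2 * Real.pi) * |∑ i ∈ range k, (-(z / n)) ^ (i + 1) / ((i : ℝ) + 1) +
        Real.log (1 + z / n)|) = t * |∑ i ∈ range k, (-(z / n)) ^ (i + 1) / ((i : ℝ) + 1) +
        Real.log (1 + z / n)| := by field_simp
  rw [h6]
  nlinarith [h1.trans h5]

lemma card_good_degrees {lam : ℝ} (hl : 9 / 10 ≤ lam) {k : ℕ} (hk : 5 * lam ≤ k) :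
    lam / 2 ≤ #({j : Fin k | 3 / 2 * lam ≤ (j.1 : ℝ) + 1 ∧ (j.1 : ℝ) + 1 ≤ 3 * lam} : Finset (Fin k)) := by
  set G := ({j : Fin k | 3 / 2 * lam ≤ (j.1 : ℝ) + 1 ∧ (j.1 : ℝ) + 1 ≤ 3 * lam} : Finset (Fin k))
  have h1 : #(Icc ⌈3 / 2 * lam⌉₊ ⌊3 * lam⌋₊) ≤ #G := by
    refine card_le_card_of_surjOn (fun j : Fin k => j.1 + 1) ?_
    intro i hi
    simp only [coe_Icc, Set.mem_Icc, Nat.ceil_le] at hi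
    have h2 := (Nat.le_floor_iff (by positivity)).1 hi.2
    have h3 : 0 < i := by
      have : (0 : ℝ) < i := by linarith [hi.1]
      exact_mod_cast this
    have h4 : i - 1 < k := by
      have : (i : ℝ) < k := by linarith
      have : i < k := by exact_mod_cast this
      omega
    refine ⟨⟨i - 1, h4⟩, ?_, by simp; omega⟩
    have h5 : ((i - 1 : ℕ) : ℝ) + 1 = i := by rw [Nat.cast_sub (by omega)]; push_cast; ring
    simp only [G, coe_filter, mem_univ, true_and, Set.mem_ofPred_eq]
    rw [h5]; exact ⟨hi.1, h2⟩
  rw [Nat.card_Icc] at h1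
  have h2 := Nat.ceil_lt_add_one (show 0 ≤ 3 / 2 * lam by positivity)
  have h3 := Nat.lt_floor_add_one (3 * lam)
  have h4 : ⌈3 / 2 * lam⌉₊ < ⌊3 * lam⌋₊ + 1 := by
    have : (⌈3 / 2 * lam⌉₊ : ℝ) < ⌊3 * lam⌋₊ + 1 := by
      by_cases h : 1 ≤ lam * (3 / 2)
      · linarith
      · exfalso; linarith
    exact_mod_cast this
  have h5 : ((⌊3 * lam⌋₊ + 1 - ⌈3 / 2 * lam⌉₊ : ℕ) : ℝ) ≤ #G := by exact_mod_cast h1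
  have h6 : (1 : ℝ) ≤ #G := by exact_mod_cast (by omega : 1 ≤ #G)
  rw [Nat.cast_sub (by omega)] at h5
  push_cast at h5
  rcases le_total lam 2 with h | h <;> linarith

lemma linearSum_phaseCoeff_le {L lam n N : ℝ} (hL : 1000 ≤ L) (hl : 9 / 10 ≤ lam)
    (hN : N = Real.exp L) (hn : N ≤ n) (hn2 : n ≤ 2 * N) {k M : ℕ} (hk : 1 ≤ k)
    (hM : Real.exp (2 / 5 * L) / 2 ≤ M) (j : Fin k)
    (hj1 : 3 / 2 * lam ≤ (j.1 : ℝ) + 1) (hj2 : (j.1 : ℝ) + 1 ≤ 3 * lam) :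
    linearSum (12 * k ^ 2 * M ^ (j.1 + 1)) (phaseCoeff (Real.exp (lam * L)) n k j) ≤
      (2 * (12 * k ^ 2 * M ^ (j.1 + 1) : ℕ) + 1) ^ 2 * Real.exp (-(9 / 50 * lam * L)) := by
  have hN0 : 0 < N := by rw [hN]; positivity
  have hn0 : 0 < n := by linarith
  have hpi := Real.pi_gt_three
  have hpi4 := Real.pi_le_four
  have habs := abs_phaseCoeff (Real.exp_pos (lam * L)) hn0 k j
  set a := phaseCoeff (Real.exp (lam * L)) n k j
  set i : ℕ := j.1 + 1 with hi
  have hicast : (j.1 : ℝ) + 1 = i := by rw [hi]; push_cast; ring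
  rw [hicast] at habs hj1 hj2
  have hi1 : (1 : ℝ) ≤ i := by rw [← hicast]; linarith [(Nat.cast_nonneg j.1 : (0 : ℝ) ≤ j.1)]
  have hik : (i : ℝ) ≤ k := by exact_mod_cast j.2
  have hpos : 0 < |a| := by rw [habs]; positivity
  have hM0 : 0 < (M : ℝ) := lt_of_lt_of_le (by positivity) hM
  have hM1 : 1 ≤ M := by exact_mod_cast hM0
  have hup : |a| ≤ Real.exp (-(1 / 2 * lam * L)) := by
    rw [habs, div_le_iff₀ (by positivity)]
    have h1 : N ^ i = Real.exp (i * L) := by rw [hN, ← Real.exp_nat_mul]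
    have h2 : Real.exp (i * L) ≤ 2 * Real.pi * i * n ^ i := by
      rw [← h1]
      have : N ^ i ≤ n ^ i := by gcongr
      have h3 : 0 < n ^ i := by positivity
      nlinarith [mul_le_mul (show (1 : ℝ) ≤ 2 * Real.pi by linarith) hi1 (by norm_num) (by linarith)]
    calc Real.exp (lam * L) ≤ Real.exp (-(1 / 2 * lam * L)) * Real.exp (i * L) := by
          rw [← Real.exp_add]; exact Real.exp_le_exp.2 (by nlinarith)
      _ ≤ _ := by gcongr
  have hle1 : |a| ≤ 1 := hup.trans (Real.exp_le_one_iff.2 (by nlinarith))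
  have hsup : √|a| ≤ Real.exp (-(1 / 4 * lam * L)) := by
    refine Real.sqrt_le_iff.2 ⟨by positivity, hup.trans (le_of_eq ?_)⟩
    rw [← Real.exp_nat_mul]; congr 1; push_cast; ring
  set Z : ℕ := 12 * k ^ 2 * M ^ i with hZ
  have hZ1 : 1 ≤ Z := Nat.one_le_iff_ne_zero.2 (by positivity)
  have hlow : Real.exp (19 / 100 * lam * L) ≤ Z * √|a| := by
    have h1 : (Real.exp (19 / 100 * lam * L)) ^ 2 ≤ (Z * √|a|) ^ 2 := by
      rw [mul_pow, Real.sq_sqrt hpos.le, habs, ← Real.exp_nat_mul, mul_div_assoc',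
        le_div_iff₀ (by positivity)]
      have h2 : n ^ i ≤ 2 ^ i * Real.exp (i * L) := by
        calc n ^ i ≤ (2 * N) ^ i := by gcongr
          _ = _ := by rw [mul_pow, hN, ← Real.exp_nat_mul]
      have h3 : Real.exp (4 / 5 * i * L) ≤ 4 ^ i * (M : ℝ) ^ (2 * i) := by
        have h4 : (Real.exp (2 / 5 * L)) ^ (2 * i) ≤ (2 * (M : ℝ)) ^ (2 * i) := by
          gcongr; linarith
        rw [← Real.exp_nat_mul, mul_pow, pow_mul 2 2 i] at h4
        norm_num at h4
        refine le_trans (le_of_eq ?_) h4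
        congr 1; ring
      have h5 : (8 : ℝ) ^ i ≤ Real.exp (9 * lam) := by
        calc (8 : ℝ) ^ i ≤ (Real.exp 3) ^ i := by
              gcongr
              have : (Real.exp 1) ^ 3 = Real.exp 3 := by rw [← Real.exp_nat_mul]; norm_num
              rw [← this]
              have := Real.add_one_le_exp (1 : ℝ)
              calc (8 : ℝ) = 2 ^ 3 := by norm_num
                _ ≤ _ := by gcongr; linarith
          _ = Real.exp (i * 3) := by rw [← Real.exp_nat_mul]
          _ ≤ _ := Real.exp_le_exp.2 (by linarith)
      have h6 : Real.exp ((2 : ℕ) * (19 / 100 * lam * L)) * Real.exp (9 * lam) * Real.exp (i * L) ≤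
          Real.exp (4 / 5 * i * L) * Real.exp (lam * L) := by
        rw [← Real.exp_add, ← Real.exp_add, ← Real.exp_add]
        refine Real.exp_le_exp.2 ?_
        push_cast
        nlinarith [mul_le_mul_of_nonneg_right hj2 (by linarith : 0 ≤ L)]
      have h7 : 2 * Real.pi * i ≤ ((12 * k ^ 2 : ℝ)) ^ 2 := by
        have hk1 : (1 : ℝ) ≤ k := by exact_mod_cast hk
        have : (k : ℝ) ≤ k ^ 4 := le_self_pow₀ hk1 (by norm_num)
        calc 2 * Real.pi * i ≤ 8 * k := by nlinarith
          _ ≤ 144 * (k : ℝ) ^ 4 := by linarith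
          _ = _ := by ring
      have h8 : (8 : ℝ) ^ i = 4 ^ i * 2 ^ i := by rw [← mul_pow]; norm_num
      have h48 : (0 : ℝ) < 4 ^ i := by positivity
      refine le_of_mul_le_mul_right ?_ h48
      calc Real.exp ((2 : ℕ) * (19 / 100 * lam * L)) * (2 * Real.pi * i * n ^ i) * 4 ^ i
          ≤ Real.exp ((2 : ℕ) * (19 / 100 * lam * L)) * ((12 * k ^ 2 : ℝ) ^ 2 *
              (2 ^ i * Real.exp (i * L))) * 4 ^ i := by gcongr
        _ = (Real.exp ((2 : ℕ) * (19 / 100 * lam * L)) * 8 ^ i * Real.exp (i * L)) *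
              (12 * k ^ 2 : ℝ) ^ 2 := by rw [h8]; ring
        _ ≤ (Real.exp ((2 : ℕ) * (19 / 100 * lam * L)) * Real.exp (9 * lam) * Real.exp (i * L)) *
              (12 * k ^ 2 : ℝ) ^ 2 := by gcongr
        _ ≤ (Real.exp (4 / 5 * i * L) * Real.exp (lam * L)) * (12 * k ^ 2 : ℝ) ^ 2 := by gcongr
        _ ≤ (4 ^ i * (M : ℝ) ^ (2 * i) * Real.exp (lam * L)) * (12 * k ^ 2 : ℝ) ^ 2 := by gcongr
        _ = _ := by rw [hZ]; push_cast; ring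
    exact le_of_sq_le_sq h1 (by positivity)
  refine (linearSum_le Z hZ1 (abs_pos.1 hpos) hle1).trans ?_
  refine mul_le_mul_of_nonneg_left ?_ (by positivity)
  have e1 : Real.exp (-(1 / 4 * lam * L)) ≤ Real.exp (-(19 / 100 * lam * L)) :=
    Real.exp_le_exp.2 (by nlinarith)
  have e2 : 4 / (Z * √|a|) ≤ 4 * Real.exp (-(19 / 100 * lam * L)) := by
    rw [Real.exp_neg, ← div_eq_mul_inv]; gcongr
  have e3 : (7 : ℝ) ≤ Real.exp (1 / 100 * lam * L) := by
    have := Real.add_one_le_exp (1 / 100 * lam * L)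
    nlinarith
  have e4 : Real.exp (-(9 / 50 * lam * L)) =
      Real.exp (1 / 100 * lam * L) * Real.exp (-(19 / 100 * lam * L)) := by
    rw [← Real.exp_add]; congr 1; ring
  rw [e4]
  have := Real.exp_pos (-(19 / 100 * lam * L))
  nlinarith

end ZetaSum

section ZetaSumBound

lemma norm_bilinearSum_phaseCoeff_le : ∃ D : ℝ, 0 ≤ D ∧ ∀ (L lam n : ℝ) (M : ℕ), 1000 ≤ L →
    9 / 10 ≤ lam → Real.exp L ≤ n → n ≤ 2 * Real.exp L →
    Real.exp (2 / 5 * L) / 2 ≤ M → M ≤ Real.exp (2 / 5 * L) →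
    ‖bilinearSum ⌈5 * lam⌉₊ M (phaseCoeff (Real.exp (lam * L)) n ⌈5 * lam⌉₊)‖ ≤
      (M : ℝ) ^ 2 * Real.exp (D - L / (10 ^ 8 * lam ^ 2)) := by
  obtain ⟨D, hD⟩ := norm_bilinearSum_pow_le
  refine ⟨D, by positivity, fun L lam n M hL hl hn hn2 hM1 hM2 => ?_⟩
  set k := ⌈5 * lam⌉₊ with hk
  have hk1 : 5 * lam ≤ k := Nat.le_ceil _
  have hk2 : (k : ℝ) ≤ 5 * lam + 1 := (Nat.ceil_lt_add_one (by positivity)).le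
  have hk3 : 3 ≤ k := by
    have : (4 : ℝ) < k := by linarith
    have : 4 < k := by exact_mod_cast this
    omega
  have hM0 : 0 < (M : ℝ) := lt_of_lt_of_le (by positivity) hM1
  have hMn : 1 ≤ M := by exact_mod_cast hM0
  set G := ({j : Fin k | 3 / 2 * lam ≤ (j.1 : ℝ) + 1 ∧ (j.1 : ℝ) + 1 ≤ 3 * lam} : Finset (Fin k))
  have hG : lam / 2 ≤ #G := card_good_degrees hl hk1
  have h := hD k hk3 M hMn (phaseCoeff (Real.exp (lam * L)) n k) G
    (Real.exp (-(9 / 50 * lam * L))) (fun j hj => by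
      have hj' := (mem_filter.1 hj).2
      exact linearSum_phaseCoeff_le hL hl rfl hn hn2 (by omega) hM1 j hj'.1 hj'.2)
  have hlam : 0 < lam := by linarith
  have hL0 : 0 < L := by linarith
  refine le_of_pow_le_pow_left₀ (n := 576 * k ^ 4) (by positivity) (by positivity) (h.trans ?_)
  have hkR : (3 : ℝ) ≤ k := by exact_mod_cast hk3
  have hk612 : (k : ℝ) ≤ 612 / 100 * lam := by linarith
  have hklam : (k : ℝ) * (k + 1) ≤ 45 * lam ^ 2 := by nlinarith
  have hk4 : (k : ℝ) ^ 4 ≤ 1500 * lam ^ 4 := by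
    calc (k : ℝ) ^ 4 ≤ (612 / 100 * lam) ^ 4 := by gcongr
      _ = (612 / 100) ^ 4 * lam ^ 4 := by ring
      _ ≤ _ := by gcongr; norm_num
  have e1 : (k : ℝ) ^ (D * k ^ 3) ≤ Real.exp (D * (576 * k ^ 4)) := by
    calc (k : ℝ) ^ (D * k ^ 3) ≤ (Real.exp k) ^ (D * k ^ 3) := by
          gcongr; linarith [Real.add_one_le_exp (k : ℝ)]
      _ = Real.exp (D * k ^ 4) := by rw [← Real.exp_nat_mul]; congr 1; push_cast; ring
      _ ≤ _ := by
          refine Real.exp_le_exp.2 (mul_le_mul_of_nonneg_left ?_ (by positivity))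
          have : (0 : ℝ) < k ^ 4 := by positivity
          linarith
  have e2 : (M : ℝ) ^ ((2 * (576 * k ^ 4) : ℝ) + k * (k + 1) / 2048) ≤
      ((M : ℝ) ^ 2) ^ (576 * k ^ 4) * Real.exp (2 / 5 * L * (45 * lam ^ 2 / 2048)) := by
    rw [Real.rpow_add hM0]
    refine mul_le_mul (le_of_eq ?_) ?_ (by positivity) (by positivity)
    · rw [← pow_mul, ← Real.rpow_natCast (M : ℝ)]; congr 1; push_cast; ring
    · calc (M : ℝ) ^ ((k : ℝ) * (k + 1) / 2048) ≤ (Real.exp (2 / 5 * L)) ^ ((k : ℝ) * (k + 1) / 2048) :=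
            Real.rpow_le_rpow hM0.le hM2 (by positivity)
        _ = Real.exp (2 / 5 * L * (k * (k + 1) / 2048)) := by rw [← Real.exp_mul]
        _ ≤ _ := by
            refine Real.exp_le_exp.2 (mul_le_mul_of_nonneg_left ?_ (by positivity))
            linarith
  have e3 : Real.exp (-(9 / 50 * lam * L)) ^ #G ≤ Real.exp (-(9 / 100 * lam ^ 2 * L)) := by
    rw [← Real.exp_nat_mul]
    refine Real.exp_le_exp.2 ?_
    have : 0 < 9 / 50 * lam * L := by positivity
    nlinarith [mul_le_mul_of_nonneg_right hG this.le]
  calc _ ≤ Real.exp (D * (576 * k ^ 4)) * (((M : ℝ) ^ 2) ^ (576 * k ^ 4) *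
        Real.exp (2 / 5 * L * (45 * lam ^ 2 / 2048))) * Real.exp (-(9 / 100 * lam ^ 2 * L)) := by
        gcongr
    _ = ((M : ℝ) ^ 2) ^ (576 * k ^ 4) * Real.exp (D * (576 * k ^ 4) +
        2 / 5 * L * (45 * lam ^ 2 / 2048) + -(9 / 100 * lam ^ 2 * L)) := by
        rw [Real.exp_add, Real.exp_add]; ring
    _ ≤ ((M : ℝ) ^ 2) ^ (576 * k ^ 4) * Real.exp ((576 * k ^ 4 : ℕ) *
          (D - L / (10 ^ 8 * lam ^ 2))) := by
        gcongr
        push_cast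
        have h1 : (576 * (k : ℝ) ^ 4) * (L / (10 ^ 8 * lam ^ 2)) ≤ 1 / 100 * lam ^ 2 * L := by
          rw [mul_div_assoc', div_le_iff₀ (by positivity)]
          nlinarith [mul_le_mul_of_nonneg_right hk4 hL0.le,
            (by positivity : 0 < lam ^ 4 * L)]
        have h2 : 0 < lam ^ 2 * L := by positivity
        nlinarith
    _ = _ := by rw [mul_pow, Real.exp_nat_mul]

lemma norm_sum_Ioc_shift_le (f : ℕ → ℂ) (hf : ∀ n, ‖f n‖ ≤ 1) (A B h : ℕ) :
    ‖∑ n ∈ Ioc A B, f n - ∑ n ∈ Ioc A B, f (n + h)‖ ≤ 2 * h := by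
  induction h with
  | zero => simp
  | succ h ih =>
    have h1 : ‖∑ n ∈ Ioc A B, f (n + h) - ∑ n ∈ Ioc A B, f (n + (h + 1))‖ ≤ 2 := by
      rcases le_total B A with hBA | hAB
      · simp [Ioc_eq_empty_of_le hBA]
      · have : ∀ n, A ≤ n → ∑ i ∈ Ioc A n, f (i + h) - ∑ i ∈ Ioc A n, f (i + (h + 1)) =
            f (A + 1 + h) - f (n + 1 + h) := by
          intro n hn
          induction n, hn using Nat.le_induction with
          | base => simp
          | succ n hn ih =>
            rw [sum_Ioc_succ_top hn, sum_Ioc_succ_top hn]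
            rw [show n + 1 + (h + 1) = n + 1 + 1 + h by ring]
            linear_combination ih
        rw [this B hAB]
        refine (norm_sub_le _ _).trans ?_
        linarith [hf (A + 1 + h), hf (B + 1 + h)]
    calc _ = ‖(∑ n ∈ Ioc A B, f n - ∑ n ∈ Ioc A B, f (n + h)) +
          (∑ n ∈ Ioc A B, f (n + h) - ∑ n ∈ Ioc A B, f (n + (h + 1)))‖ := by congr 1; ring
      _ ≤ _ := by
          refine (norm_add_le _ _).trans ?_
          push_cast; linarith

lemma sum_Ico_zero_natCast (m : ℕ) (g : ℤ → ℂ) : ∑ x ∈ Ico (0 : ℤ) m, g x = ∑ x ∈ range m, g x := by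
  induction m with
  | zero => simp
  | succ m ih =>
    rw [sum_range_succ, ← ih, show Ico (0 : ℤ) (m + 1 : ℕ) = insert (m : ℤ) (Ico (0 : ℤ) m) by
      ext x; simp only [mem_Ico, mem_insert]; push_cast; omega, sum_insert (by simp), add_comm]

lemma norm_sum_sum_expi_log_le {t L lam B : ℝ} {M n k : ℕ} (ht : 0 < t) (hL : 1000 ≤ L)
    (htexp : Real.exp (lam * L) = t) (hn1 : Real.exp L ≤ n)
    (hMM : (M : ℝ) ^ 2 ≤ Real.exp (4 / 5 * L)) (hk1 : 5 * lam ≤ k)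
    (hB : ‖bilinearSum k M (phaseCoeff t n k)‖ ≤ (M : ℝ) ^ 2 * B) :
    ‖∑ x ∈ range M, ∑ y ∈ range M,
      expi (-(t / (2 * Real.pi)) * Real.log (n + x * y : ℕ))‖ ≤
      (M : ℝ) ^ 2 * (B + 2 * Real.exp (-(1 / 5 * L))) := by
  set f : ℕ → ℂ := fun n => expi (-(t / (2 * Real.pi)) * Real.log n) with hf
  have hn0 : (0 : ℝ) < n := lt_of_lt_of_le (by positivity) hn1
  have hBeq : bilinearSum k M (phaseCoeff t n k) = ∑ x ∈ range M, ∑ y ∈ range M,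
      expi (∑ j : Fin k, phaseCoeff t n k j * ((x * y : ℕ) : ℝ) ^ (j.1 + 1)) := by
    rw [bilinearSum, sum_Ico_zero_natCast]
    refine sum_congr rfl fun x _ => ?_
    rw [sum_Ico_zero_natCast]
    refine sum_congr rfl fun y _ => ?_
    congr 1
    refine sum_congr rfl fun j _ => ?_
    push_cast; rw [mul_pow]; ring
  have hdiff : ‖∑ x ∈ range M, ∑ y ∈ range M, f (n + x * y) -
      f n * bilinearSum k M (phaseCoeff t n k)‖ ≤ (M : ℝ) ^ 2 * (2 * Real.exp (-(1 / 5 * L))) := by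
    rw [hBeq, mul_sum, ← sum_sub_distrib]
    refine (norm_sum_le _ _).trans ?_
    refine (sum_le_card_nsmul _ _ (M * (2 * Real.exp (-(1 / 5 * L)))) fun x hx => ?_).trans
      (le_of_eq (by rw [card_range, nsmul_eq_mul]; ring))
    rw [mul_sum, ← sum_sub_distrib]
    refine (norm_sum_le _ _).trans ?_
    refine (sum_le_card_nsmul _ _ (2 * Real.exp (-(1 / 5 * L))) fun y hy => ?_).trans
      (le_of_eq (by rw [card_range, nsmul_eq_mul]))
    rw [mem_range] at hx hy
    have hxy : ((x * y : ℕ) : ℝ) ≤ Real.exp (4 / 5 * L) := by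
      refine le_trans ?_ hMM
      rw [pow_two]; exact_mod_cast Nat.mul_le_mul hx.le hy.le
    have hu : ((x * y : ℕ) : ℝ) / n ≤ Real.exp (-(1 / 5 * L)) := by
      rw [div_le_iff₀ hn0]
      calc ((x * y : ℕ) : ℝ) ≤ Real.exp (-(1 / 5 * L)) * Real.exp L := by
            rw [← Real.exp_add]
            exact hxy.trans (Real.exp_le_exp.2 (by linarith))
        _ ≤ _ := by gcongr
    have hhalf : Real.exp (-(1 / 5 * L)) ≤ 1 / 2 := by
      rw [Real.exp_neg, ← one_div]
      refine one_div_le_one_div_of_le (by norm_num) ?_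
      linarith [Real.add_one_le_exp (1 / 5 * L)]
    have hz : ((x * y : ℕ) : ℝ) ≤ n / 2 := by
      rw [div_le_iff₀ hn0] at hu
      nlinarith
    have := norm_phase_sub_le ht hn0 (Nat.cast_nonneg (x * y)) hz k
    simp only [hf]
    rw [Nat.cast_add n (x * y)]
    refine this.trans ?_
    calc 2 * t * (((x * y : ℕ) : ℝ) / n) ^ (k + 1) ≤ 2 * t * Real.exp (-(1 / 5 * L)) ^ (k + 1) := by
          gcongr
      _ = 2 * Real.exp (lam * L + (k + 1 : ℕ) * (-(1 / 5 * L))) := by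
          rw [Real.exp_add, htexp, ← Real.exp_nat_mul]; ring
      _ ≤ _ := by
          gcongr
          push_cast
          nlinarith
  have hfn : ‖f n * bilinearSum k M (phaseCoeff t n k)‖ ≤
      (M : ℝ) ^ 2 * B := by
    rw [norm_mul, hf]; simp only [norm_expi, one_mul]; exact hB
  calc _ = ‖(∑ x ∈ range M, ∑ y ∈ range M, f (n + x * y) -
      f n * bilinearSum k M (phaseCoeff t n k)) + f n * bilinearSum k M (phaseCoeff t n k)‖ := by
        congr 1; ring
    _ ≤ _ := (norm_add_le _ _).trans (by linarith)

theorem norm_sum_Ioc_expi_log_le_of_large : ∃ C : ℝ, 0 ≤ C ∧ ∀ (N N' : ℕ) (t : ℝ), 1000 ≤ Real.log N →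
    N' ≤ 2 * N → 9 / 10 * Real.log N ≤ Real.log t → 0 < t →
    ‖∑ n ∈ Ioc N N', expi (-(t / (2 * Real.pi)) * Real.log n)‖ ≤
      C * Real.exp (Real.log N - (Real.log N) ^ 3 / (10 ^ 8 * (Real.log t) ^ 2)) := by
  obtain ⟨D, hD0, hD⟩ := norm_bilinearSum_phaseCoeff_le
  refine ⟨Real.exp D + 4, by positivity, fun N N' t hL hN' hlt ht => ?_⟩
  set L := Real.log N with hLdef
  have hL0 : 0 < L := by linarith
  have hNpos : (0 : ℝ) < N := by
    rcases Nat.eq_zero_or_pos N with h | h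
    · rw [hLdef, h] at hL0; simp at hL0
    · exact_mod_cast h
  have hNexp : Real.exp L = N := Real.exp_log hNpos
  set lam := Real.log t / L with hlam
  have hl : 9 / 10 ≤ lam := by rw [hlam, le_div_iff₀ hL0]; exact hlt
  have hlamL : lam * L = Real.log t := by rw [hlam]; field_simp
  have htexp : Real.exp (lam * L) = t := by rw [hlamL, Real.exp_log ht]
  have hlam0 : 0 < lam := by linarith
  have hexpo : L - L ^ 3 / (10 ^ 8 * (Real.log t) ^ 2) = L - L / (10 ^ 8 * lam ^ 2) := by
    rw [← hlamL]; field_simp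
  rw [hexpo]
  set M := ⌊Real.exp (2 / 5 * L)⌋₊ with hM
  have hM2 : (M : ℝ) ≤ Real.exp (2 / 5 * L) := Nat.floor_le (by positivity)
  have hM1 : Real.exp (2 / 5 * L) / 2 ≤ M := by
    have := Nat.lt_floor_add_one (Real.exp (2 / 5 * L))
    have h2 := Real.add_one_le_exp (2 / 5 * L)
    linarith
  have hM0 : 0 < (M : ℝ) := lt_of_lt_of_le (by positivity) hM1
  set k := ⌈5 * lam⌉₊ with hk
  have hk1 : 5 * lam ≤ k := Nat.le_ceil _
  set f : ℕ → ℂ := fun n => expi (-(t / (2 * Real.pi)) * Real.log n) with hf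
  have hMM : (M : ℝ) ^ 2 ≤ Real.exp (4 / 5 * L) := by
    calc (M : ℝ) ^ 2 ≤ Real.exp (2 / 5 * L) ^ 2 := by gcongr
      _ = _ := by rw [← Real.exp_nat_mul]; congr 1; push_cast; ring
  have hinner : ∀ n ∈ Ioc N N', ‖∑ x ∈ range M, ∑ y ∈ range M, f (n + x * y)‖ ≤
      (M : ℝ) ^ 2 * (Real.exp (D - L / (10 ^ 8 * lam ^ 2)) + 2 * Real.exp (-(1 / 5 * L))) := by
    intro n hn
    rw [mem_Ioc] at hn
    have hn1 : Real.exp L ≤ n := by rw [hNexp]; exact_mod_cast hn.1.le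
    have hn2 : (n : ℝ) ≤ 2 * Real.exp L := by rw [hNexp]; exact_mod_cast hn.2.trans hN'
    have hB := hD L lam n M hL hl hn1 hn2 hM1 hM2
    rw [htexp] at hB
    exact norm_sum_sum_expi_log_le ht hL htexp hn1 hMM hk1 hB
  have hcard : (#(Ioc N N') : ℝ) ≤ N := by
    rw [Nat.card_Ioc]; exact_mod_cast (by omega)
  have htotal : ‖∑ n ∈ Ioc N N', ∑ x ∈ range M, ∑ y ∈ range M, f (n + x * y)‖ ≤
      N * ((M : ℝ) ^ 2 * (Real.exp (D - L / (10 ^ 8 * lam ^ 2)) + 2 * Real.exp (-(1 / 5 * L)))) := by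
    refine (norm_sum_le _ _).trans ((sum_le_card_nsmul _ _ _ hinner).trans ?_)
    rw [nsmul_eq_mul]
    exact mul_le_mul_of_nonneg_right hcard (by positivity)
  set S := ∑ n ∈ Ioc N N', f n with hS
  have hshift : ‖(M : ℂ) ^ 2 * S - ∑ n ∈ Ioc N N', ∑ x ∈ range M, ∑ y ∈ range M, f (n + x * y)‖ ≤
      (M : ℝ) ^ 2 * (2 * (M : ℝ) ^ 2) := by
    have e1 : (M : ℂ) ^ 2 * S = ∑ x ∈ range M, ∑ y ∈ range M, S := by
      simp only [sum_const, card_range, nsmul_eq_mul]; ring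
    have e2 : ∑ n ∈ Ioc N N', ∑ x ∈ range M, ∑ y ∈ range M, f (n + x * y) =
        ∑ x ∈ range M, ∑ y ∈ range M, ∑ n ∈ Ioc N N', f (n + x * y) := by
      rw [sum_comm]; exact sum_congr rfl fun x _ => sum_comm
    rw [e1, e2, ← sum_sub_distrib]
    refine (norm_sum_le _ _).trans ?_
    refine (sum_le_card_nsmul _ _ (M * (2 * (M : ℝ) ^ 2)) fun x hx => ?_).trans
      (le_of_eq (by rw [card_range, nsmul_eq_mul]; ring))
    rw [← sum_sub_distrib]
    refine (norm_sum_le _ _).trans ?_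
    refine (sum_le_card_nsmul _ _ (2 * (M : ℝ) ^ 2) fun y hy => ?_).trans
      (le_of_eq (by rw [card_range, nsmul_eq_mul]))
    rw [mem_range] at hx hy
    refine (norm_sum_Ioc_shift_le f (fun n => (norm_expi _).le) N N' (x * y)).trans ?_
    have : ((x * y : ℕ) : ℝ) ≤ (M : ℝ) ^ 2 := by
      rw [pow_two]; exact_mod_cast Nat.mul_le_mul hx.le hy.le
    linarith
  have hfin : (M : ℝ) ^ 2 * ‖S‖ ≤ (M : ℝ) ^ 2 *
      (N * (Real.exp (D - L / (10 ^ 8 * lam ^ 2)) + 2 * Real.exp (-(1 / 5 * L))) + 2 * (M : ℝ) ^ 2) := by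
    have h1 : (M : ℝ) ^ 2 * ‖S‖ = ‖(M : ℂ) ^ 2 * S‖ := by rw [norm_mul, norm_pow]; simp
    rw [h1]
    have h2 := norm_add_le ((M : ℂ) ^ 2 * S -
      ∑ n ∈ Ioc N N', ∑ x ∈ range M, ∑ y ∈ range M, f (n + x * y))
      (∑ n ∈ Ioc N N', ∑ x ∈ range M, ∑ y ∈ range M, f (n + x * y))
    rw [sub_add_cancel] at h2
    nlinarith
  have hS' := le_of_mul_le_mul_left hfin (by positivity)
  refine hS'.trans ?_
  have hc : L / (10 ^ 8 * lam ^ 2) ≤ 1 / 5 * L := by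
    rw [div_le_iff₀ (by positivity)]
    nlinarith [mul_le_mul hl hl (by norm_num) hlam0.le]
  have g1 : (N : ℝ) * Real.exp (D - L / (10 ^ 8 * lam ^ 2)) =
      Real.exp D * Real.exp (L - L / (10 ^ 8 * lam ^ 2)) := by
    rw [← hNexp, ← Real.exp_add, ← Real.exp_add]; congr 1; ring
  have g2 : (N : ℝ) * Real.exp (-(1 / 5 * L)) ≤ Real.exp (L - L / (10 ^ 8 * lam ^ 2)) := by
    rw [← hNexp, ← Real.exp_add]; exact Real.exp_le_exp.2 (by linarith)
  have g3 : (M : ℝ) ^ 2 ≤ Real.exp (L - L / (10 ^ 8 * lam ^ 2)) :=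
    hMM.trans (Real.exp_le_exp.2 (by linarith))
  nlinarith

end ZetaSumBound

section ZetaApprox

lemma hasDerivAt_ofReal_cpow {u : ℝ} (hu : 0 < u) (z : ℂ) :
    HasDerivAt (fun u : ℝ => (u : ℂ) ^ z) (z * (u : ℂ) ^ (z - 1)) u := by
  have h := ((hasDerivAt_id (u : ℂ)).cpow_const (c := z) (by simp [Complex.slitPlane, hu]))
  simpa using h.comp_ofReal

lemma norm_cpow_sub_cpow_le {m : ℝ} (hm : 0 < m) {s : ℂ} (hs : 0 < s.re) {u v : ℝ}
    (hu : u ∈ Set.Icc m (m + 1)) (hv : v ∈ Set.Icc m (m + 1)) :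
    ‖(v : ℂ) ^ (-s) - (u : ℂ) ^ (-s)‖ ≤ ‖s‖ * m ^ (-s.re - 1) := by
  have h := Convex.norm_image_sub_le_of_norm_hasDerivWithin_le (𝕜 := ℝ)
    (f := fun u : ℝ => (u : ℂ) ^ (-s)) (f' := fun u : ℝ => -s * (u : ℂ) ^ (-s - 1))
    (C := ‖s‖ * m ^ (-s.re - 1)) (s := Set.Icc m (m + 1))
    (fun x hx => (hasDerivAt_ofReal_cpow (hm.trans_le hx.1) (-s)).hasDerivWithinAt)
    (fun x hx => by
      rw [norm_mul, norm_neg, Complex.norm_cpow_eq_rpow_re_of_pos (hm.trans_le hx.1)]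
      simp only [Complex.sub_re, Complex.neg_re, Complex.one_re]
      refine mul_le_mul_of_nonneg_left ?_ (norm_nonneg _)
      exact Real.rpow_le_rpow_of_nonpos hm hx.1 (by linarith))
    (convex_Icc _ _) hu hv
  refine h.trans (mul_le_of_le_one_right (by positivity) ?_)
  rw [Real.norm_eq_abs, abs_le]
  constructor <;> linarith [hu.1, hu.2, hv.1, hv.2]

/-- The Euler–Maclaurin correction between a term of `(s - 1) ζ(s)` and the corresponding integral. -/
noncomputable def zetaTerm (s : ℂ) (m : ℕ) : ℂ :=
  (s - 1) * ((m + 1 : ℕ) : ℂ) ^ (-s) + (((m + 1 : ℕ) : ℂ) ^ (1 - s) - (m : ℂ) ^ (1 - s))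

lemma norm_zetaTerm_le {s : ℂ} (hs : 0 < s.re) {m : ℕ} (hm : 1 ≤ m) :
    ‖zetaTerm s m‖ ≤ ‖s - 1‖ * ‖s‖ * (m : ℝ) ^ (-s.re - 1) := by
  have hm' : (0 : ℝ) < m := by exact_mod_cast hm
  have hmem : (m : ℝ) ∈ Set.Icc (m : ℝ) (m + 1) := ⟨le_rfl, by linarith⟩
  have hmem' : (m : ℝ) + 1 ∈ Set.Icc (m : ℝ) (m + 1) := ⟨by linarith, le_rfl⟩
  have h := Convex.norm_image_sub_le_of_norm_hasDerivWithin_le (𝕜 := ℝ)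
    (f := fun u : ℝ => (u : ℂ) ^ (1 - s) - (1 - s) * ((m + 1 : ℝ) : ℂ) ^ (-s) * (u : ℂ))
    (f' := fun u : ℝ => (1 - s) * (u : ℂ) ^ (-s) - (1 - s) * ((m + 1 : ℝ) : ℂ) ^ (-s))
    (C := ‖s - 1‖ * ‖s‖ * (m : ℝ) ^ (-s.re - 1)) (s := Set.Icc (m : ℝ) (m + 1))
    (fun x hx => by
      refine HasDerivAt.hasDerivWithinAt ?_
      have h1 := hasDerivAt_ofReal_cpow (hm'.trans_le hx.1) (1 - s)
      rw [show 1 - s - 1 = -s by ring] at h1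
      have h2 := (hasDerivAt_id (x : ℂ)).comp_ofReal.const_mul ((1 - s) * ((m + 1 : ℝ) : ℂ) ^ (-s))
      simp only [mul_one, id] at h2
      exact h1.sub h2)
    (fun x hx => by
      rw [← mul_sub, norm_mul, mul_assoc, norm_sub_rev 1 s]
      exact mul_le_mul_of_nonneg_left (norm_cpow_sub_cpow_le hm' hs hmem' hx) (norm_nonneg _))
    (convex_Icc _ _) hmem hmem'
  have e : zetaTerm s m = ((m + 1 : ℝ) : ℂ) ^ (1 - s) - (1 - s) * ((m + 1 : ℝ) : ℂ) ^ (-s) *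
      ((m + 1 : ℝ) : ℂ) - (((m : ℝ) : ℂ) ^ (1 - s) - (1 - s) * ((m + 1 : ℝ) : ℂ) ^ (-s) *
      ((m : ℝ) : ℂ)) := by
    rw [zetaTerm]; push_cast; ring
  rw [e]
  refine h.trans (le_of_eq ?_)
  simp

lemma sum_Ico_rpow_neg_le {σ : ℝ} (hσ : 1 / 2 ≤ σ) {X : ℕ} (hX : 1 ≤ X) (Y : ℕ) :
    ∑ m ∈ Ico X Y, (m : ℝ) ^ (-σ - 1) ≤ 3 * (X : ℝ) ^ (-σ) := by
  have hX' : (1 : ℝ) ≤ X := by exact_mod_cast hX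
  have key : ∀ m : ℕ, 1 ≤ m → ((m : ℝ) + 1) ^ (-σ - 1) ≤ 2 * ((m : ℝ) ^ (-σ) - (m + 1 : ℝ) ^ (-σ)) := by
    intro m hm
    have hm' : (0 : ℝ) < m := by exact_mod_cast hm
    obtain ⟨c, hc, hc'⟩ := exists_hasDerivAt_eq_slope (fun u : ℝ => u ^ (-σ))
      (fun u => -σ * u ^ (-σ - 1)) (show (m : ℝ) < m + 1 by linarith)
      (ContinuousOn.rpow_const continuousOn_id (fun x hx => Or.inl (by
        have := hx.1; simp; linarith)))
      (fun x hx => Real.hasDerivAt_rpow_const (Or.inl (by have := hx.1; linarith)))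
    have h1 : ((m : ℝ) + 1) ^ (-σ - 1) ≤ c ^ (-σ - 1) :=
      Real.rpow_le_rpow_of_nonpos (by linarith [hc.1]) hc.2.le (by linarith)
    rw [add_sub_cancel_left, div_one] at hc'
    have h2 : 0 ≤ c ^ (-σ - 1) := Real.rpow_nonneg (by linarith [hc.1]) _
    nlinarith
  have h2 : ∀ n, ∑ m ∈ Ico X (X + n), ((m : ℝ) + 1) ^ (-σ - 1) ≤
      2 * ((X : ℝ) ^ (-σ) - ((X + n : ℕ) : ℝ) ^ (-σ)) := by
    intro n
    induction n with
    | zero => simp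
    | succ n ih =>
      rw [← add_assoc, sum_Ico_succ_top (by omega)]
      have := key (X + n) (by omega)
      push_cast at this ih ⊢
      linarith
  rcases le_or_gt Y X with h | h
  · rw [Ico_eq_empty_of_le h, sum_empty]; positivity
  · rw [sum_eq_sum_Ico_succ_bot h]
    obtain ⟨n, rfl⟩ : ∃ n, Y = X + n + 1 := ⟨Y - X - 1, by omega⟩
    have h3 : ∑ m ∈ Ico (X + 1) (X + n + 1), (m : ℝ) ^ (-σ - 1) =
        ∑ m ∈ Ico X (X + n), ((m : ℝ) + 1) ^ (-σ - 1) := by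
      rw [← sum_Ico_add' (fun m : ℕ => (m : ℝ) ^ (-σ - 1))]
      push_cast; rfl
    rw [h3]
    have h4 : (X : ℝ) ^ (-σ - 1) ≤ (X : ℝ) ^ (-σ) :=
      Real.rpow_le_rpow_of_exponent_le hX' (by linarith)
    have h5 : 0 ≤ ((X + n : ℕ) : ℝ) ^ (-σ) := by positivity
    linarith [h2 n]

lemma differentiable_zetaTerm {m : ℕ} (hm : 1 ≤ m) : Differentiable ℂ fun s => zetaTerm s m := by
  have h1 : ∀ n : ℕ, 1 ≤ n → ∀ f : ℂ → ℂ, Differentiable ℂ f →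
      Differentiable ℂ fun s => (n : ℂ) ^ f s := fun n hn f hf s =>
    (hf s).const_cpow (Or.inl (by exact_mod_cast (by omega : n ≠ 0)))
  unfold zetaTerm
  exact ((differentiable_id.sub_const 1).mul (h1 _ (by omega) _ differentiable_neg)).add
    ((h1 _ (by omega) _ (differentiable_id.const_sub 1)).sub
      (h1 _ hm _ (differentiable_id.const_sub 1)))

lemma summable_bound_zetaTerm {σ : ℝ} (hσ : 0 < σ) (X : ℕ) :
    Summable fun i : ℕ => ((X + i : ℕ) : ℝ) ^ (-σ - 1) := by
  have h := (Real.summable_nat_rpow.2 (show -σ - 1 < -1 by linarith))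
  simpa only [add_comm] using (summable_nat_add_iff X).2 h

lemma summable_zetaTerm {s : ℂ} (hs : 0 < s.re) {X : ℕ} (hX : 1 ≤ X) :
    Summable fun i : ℕ => zetaTerm s (X + i) :=
  Summable.of_norm_bounded ((summable_bound_zetaTerm hs X).mul_left (‖s - 1‖ * ‖s‖))
    fun i => norm_zetaTerm_le hs (by omega)

lemma norm_tsum_zetaTerm_le {s : ℂ} (hs : 1 / 2 ≤ s.re) {X : ℕ} (hX : 1 ≤ X) :
    ‖∑' i : ℕ, zetaTerm s (X + i)‖ ≤ ‖s - 1‖ * ‖s‖ * (3 * (X : ℝ) ^ (-s.re)) := by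
  have hs0 : 0 < s.re := by linarith
  refine (tsum_of_norm_bounded ((summable_bound_zetaTerm hs0 X).mul_left (‖s - 1‖ * ‖s‖)).hasSum
    fun i => norm_zetaTerm_le hs0 (by omega)).trans ?_
  rw [tsum_mul_left]
  refine mul_le_mul_of_nonneg_left ?_ (by positivity)
  refine Real.tsum_le_of_sum_range_le (fun _ => by positivity) fun n => ?_
  have := sum_Ico_rpow_neg_le hs hX (X + n)
  rw [sum_Ico_eq_sum_range] at this
  simpa using this

lemma differentiableOn_tsum_zetaTerm {X : ℕ} (hX : 1 ≤ X) :
    DifferentiableOn ℂ (fun s => ∑' i : ℕ, zetaTerm s (X + i)) {s | 1 / 2 < s.re} := by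
  intro s hs
  set U : Set ℂ := {z | 1 / 2 < z.re} ∩ Metric.ball 0 (‖s‖ + 1) with hU
  have hUo : IsOpen U := (isOpen_lt continuous_const Complex.continuous_re).inter Metric.isOpen_ball
  have hsU : s ∈ U := ⟨hs, by simp⟩
  have h := Complex.differentiableOn_tsum_of_summable_norm (F := fun (i : ℕ) s => zetaTerm s (X + i))
    (u := fun i : ℕ => (‖s‖ + 2) * (‖s‖ + 1) * ((X + i : ℕ) : ℝ) ^ (-(1 / 2 : ℝ) - 1))
    ((summable_bound_zetaTerm (by norm_num) X).mul_left _)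
    (fun i => (differentiable_zetaTerm (by omega)).differentiableOn) hUo (fun i w hw => by
      have hw1 : 1 / 2 < w.re := hw.1
      have hw2 : ‖w‖ < ‖s‖ + 1 := by simpa using hw.2
      have hw3 : ‖w - 1‖ ≤ ‖s‖ + 2 := (norm_sub_le _ _).trans (by rw [norm_one]; linarith)
      refine (norm_zetaTerm_le (by linarith) (by omega)).trans ?_
      refine mul_le_mul (mul_le_mul hw3 hw2.le (norm_nonneg _) (by positivity)) ?_ (by positivity)
        (by positivity)
      exact Real.rpow_le_rpow_of_exponent_le (by exact_mod_cast (by omega)) (by linarith))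
  exact ((h s hsU).differentiableAt (hUo.mem_nhds hsU)).differentiableWithinAt

/-- The approximation to `(s - 1) ζ(s)` by a finite Dirichlet polynomial. -/
lemma riemannZeta₁_eq_of_one_lt_re {s : ℂ} (hs : 1 < s.re) {X : ℕ} (hX : 1 ≤ X) :
    riemannZeta₁ s = (s - 1) * ∑ n ∈ Icc 1 X, (n : ℂ) ^ (-s) + (X : ℂ) ^ (1 - s) +
      ∑' i : ℕ, zetaTerm s (X + i) := by
  have hs1 : s ≠ 1 := fun h => by rw [h] at hs; simp at hs
  have h0 : riemannZeta₁ s = (s - 1) * riemannZeta s := by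
    rw [riemannZeta_eq_inv_sub_mul hs1, ← mul_assoc, mul_inv_cancel₀ (sub_ne_zero.2 hs1), one_mul]
  have hz := zeta_eq_tsum_one_div_nat_add_one_cpow hs
  have hsum : Summable fun n : ℕ => ((n + 1 : ℕ) : ℂ) ^ (-s) := by
    have := (summable_nat_add_iff 1).2 (Complex.summable_one_div_nat_cpow.2 hs)
    refine this.congr fun n => ?_
    rw [Complex.cpow_neg, one_div]
  have hz' : riemannZeta s = ∑' n : ℕ, ((n + 1 : ℕ) : ℂ) ^ (-s) := by
    rw [hz]; refine tsum_congr fun n => ?_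
    rw [Complex.cpow_neg, one_div]; push_cast; rfl
  have htend : Tendsto (fun K : ℕ => ((X + K : ℕ) : ℂ) ^ (1 - s)) atTop (nhds 0) := by
    rw [tendsto_zero_iff_norm_tendsto_zero]
    have h1 : Tendsto (fun x : ℝ => x ^ (-(s.re - 1))) atTop (nhds 0) :=
      tendsto_rpow_neg_atTop (by linarith)
    have h2 : Tendsto (fun K : ℕ => ((X + K : ℕ) : ℝ)) atTop atTop :=
      tendsto_natCast_atTop_atTop.comp (tendsto_atTop_mono (fun K => Nat.le_add_left K X) tendsto_id)
    refine (h1.comp h2).congr fun K => ?_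
    simp only [Function.comp]
    rw [Complex.norm_natCast_cpow_of_pos (by omega)]
    simp
  have hpart : ∀ K : ℕ, ∑ i ∈ range K, zetaTerm s (X + i) =
      (s - 1) * (∑ n ∈ range (X + K), ((n + 1 : ℕ) : ℂ) ^ (-s) -
        ∑ n ∈ range X, ((n + 1 : ℕ) : ℂ) ^ (-s)) +
      (((X + K : ℕ) : ℂ) ^ (1 - s) - (X : ℂ) ^ (1 - s)) := by
    intro K
    induction K with
    | zero => simp
    | succ K ih =>
      rw [sum_range_succ, ih, ← add_assoc, sum_range_succ, zetaTerm]; ring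
  have hlim1 : Tendsto (fun K => ∑ i ∈ range K, zetaTerm s (X + i)) atTop
      (nhds (∑' i : ℕ, zetaTerm s (X + i))) :=
    (summable_zetaTerm (by linarith) hX).hasSum.tendsto_sum_nat
  have hlim2 : Tendsto (fun K => ∑ i ∈ range K, zetaTerm s (X + i)) atTop
      (nhds ((s - 1) * (riemannZeta s - ∑ n ∈ range X, ((n + 1 : ℕ) : ℂ) ^ (-s)) +
        (0 - (X : ℂ) ^ (1 - s)))) := by
    simp only [hpart]
    refine ((Tendsto.sub_const ?_ _).const_mul _).add (htend.sub_const _)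
    rw [hz']
    have h2 : Tendsto (fun K : ℕ => X + K) atTop atTop :=
      tendsto_atTop_mono (fun K => Nat.le_add_left K X) tendsto_id
    exact hsum.hasSum.tendsto_sum_nat.comp h2
  have hIcc : ∑ n ∈ Icc 1 X, (n : ℂ) ^ (-s) = ∑ n ∈ range X, ((n + 1 : ℕ) : ℂ) ^ (-s) := by
    rw [← Ico_add_one_right_eq_Icc, sum_Ico_eq_sum_range]
    simp [add_comm]
  rw [tendsto_nhds_unique hlim1 hlim2, h0, hIcc]
  ring

lemma riemannZeta₁_eq {s : ℂ} (hs : 1 / 2 < s.re) {X : ℕ} (hX : 1 ≤ X) :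
    riemannZeta₁ s = (s - 1) * ∑ n ∈ Icc 1 X, (n : ℂ) ^ (-s) + (X : ℂ) ^ (1 - s) +
      ∑' i : ℕ, zetaTerm s (X + i) := by
  have hopen : IsOpen {s : ℂ | 1 / 2 < s.re} := isOpen_lt continuous_const Complex.continuous_re
  have hconv : IsPreconnected {s : ℂ | 1 / 2 < s.re} :=
    (convex_halfSpace_re_gt _).isPreconnected
  have h1 : ∀ n : ℕ, 1 ≤ n → ∀ f : ℂ → ℂ, Differentiable ℂ f →
      Differentiable ℂ fun s => (n : ℂ) ^ f s := fun n hn f hf s =>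
    (hf s).const_cpow (Or.inl (by exact_mod_cast (by omega : n ≠ 0)))
  have hd : DifferentiableOn ℂ (fun s => (s - 1) * ∑ n ∈ Icc 1 X, (n : ℂ) ^ (-s) + (X : ℂ) ^ (1 - s) +
      ∑' i : ℕ, zetaTerm s (X + i)) {s | 1 / 2 < s.re} := by
    refine DifferentiableOn.add (Differentiable.differentiableOn ?_) (differentiableOn_tsum_zetaTerm hX)
    refine ((differentiable_id.sub_const 1).mul ?_).add (h1 _ hX _ (differentiable_id.const_sub 1))
    exact Differentiable.fun_sum fun n hn => h1 n (mem_Icc.1 hn).1 _ differentiable_neg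
  refine (differentiable_riemannZeta₁.differentiableOn.analyticOnNhd hopen).eqOn_of_preconnected_of_eventuallyEq
    (hd.analyticOnNhd hopen) hconv (z₀ := 2) (by simp; norm_num) ?_ hs
  filter_upwards [(isOpen_lt continuous_const Complex.continuous_re).mem_nhds
    (show (2 : ℂ) ∈ {z : ℂ | 1 < z.re} by simp)] with z hz
  exact riemannZeta₁_eq_of_one_lt_re hz hX

theorem norm_riemannZeta_sub_sum_le {s : ℂ} (hs : 1 / 2 < s.re) (hs1 : s ≠ 1) {X : ℕ} (hX : 1 ≤ X) :
    ‖riemannZeta s - ∑ n ∈ Icc 1 X, (n : ℂ) ^ (-s)‖ ≤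
      (X : ℝ) ^ (1 - s.re) / ‖s - 1‖ + 3 * ‖s‖ * (X : ℝ) ^ (-s.re) := by
  have h0 : s - 1 ≠ 0 := sub_ne_zero.2 hs1
  have hpos : 0 < ‖s - 1‖ := norm_pos_iff.2 h0
  have e : riemannZeta s - ∑ n ∈ Icc 1 X, (n : ℂ) ^ (-s) =
      ((X : ℂ) ^ (1 - s) + ∑' i : ℕ, zetaTerm s (X + i)) / (s - 1) := by
    rw [riemannZeta_eq_inv_sub_mul hs1, riemannZeta₁_eq hs hX]
    field_simp; ring
  rw [e, norm_div, div_le_iff₀ hpos]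
  refine (norm_add_le _ _).trans ?_
  have h1 := norm_tsum_zetaTerm_le hs.le hX
  rw [Complex.norm_natCast_cpow_of_pos (by omega)]
  have h2 : ((X : ℝ) ^ (1 - s.re) / ‖s - 1‖ + 3 * ‖s‖ * (X : ℝ) ^ (-s.re)) * ‖s - 1‖ =
    (X : ℝ) ^ (1 - s.re) + ‖s - 1‖ * ‖s‖ * (3 * (X : ℝ) ^ (-s.re)) := by field_simp
  rw [h2]
  simpa using h1

end ZetaApprox

section ZetaBound

lemma norm_sum_Ioc_expi_log_le : ∃ C : ℝ, 0 ≤ C ∧ ∀ (N N' : ℕ) (t : ℝ), 1 ≤ N → N' ≤ 2 * N →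
    1 ≤ Real.log t → 9 / 10 * Real.log N ≤ Real.log t → 0 < t →
    ‖∑ n ∈ Ioc N N', expi (-(t / (2 * Real.pi)) * Real.log n)‖ ≤
      C * Real.exp (Real.log N - (Real.log N) ^ 3 / (10 ^ 8 * (Real.log t) ^ 2)) := by
  obtain ⟨C, hC, h⟩ := norm_sum_Ioc_expi_log_le_of_large
  refine ⟨max C (Real.exp 1000), hC.trans (le_max_left _ _), fun N N' t hN hN' hT hNt ht => ?_⟩
  rcases le_or_gt 1000 (Real.log N) with h1 | h1
  · exact (h N N' t h1 hN' hNt ht).trans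
      (mul_le_mul_of_nonneg_right (le_max_left _ _) (Real.exp_pos _).le)
  · have hN0 : (0 : ℝ) < N := by exact_mod_cast hN
    have hL : 0 ≤ Real.log N := Real.log_nonneg (by exact_mod_cast hN)
    have h2 : ‖∑ n ∈ Ioc N N', expi (-(t / (2 * Real.pi)) * Real.log n)‖ ≤ Real.exp 1000 := by
      refine (norm_sum_le _ _).trans ?_
      simp only [norm_expi, sum_const, Nat.card_Ioc, nsmul_eq_mul, mul_one]
      have : ((N' - N : ℕ) : ℝ) ≤ N := by exact_mod_cast (by omega)
      refine this.trans ?_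
      rw [← Real.exp_log hN0]
      exact Real.exp_le_exp.2 h1.le
    have h3 : 0 ≤ Real.log N - (Real.log N) ^ 3 / (10 ^ 8 * (Real.log t) ^ 2) := by
      rw [sub_nonneg, div_le_iff₀ (by positivity)]
      have : (9 / 10 * Real.log N) ^ 2 ≤ Real.log t ^ 2 := pow_le_pow_left₀ (by positivity) hNt 2
      nlinarith
    calc _ ≤ Real.exp 1000 * 1 := by rw [mul_one]; exact h2
      _ ≤ _ := mul_le_mul (le_max_right _ _) (Real.one_le_exp h3) zero_le_one
        (hC.trans (le_max_left _ _))

lemma norm_sum_Ioc_mul_le {f : ℕ → ℂ} {w : ℕ → ℝ} {N N' : ℕ} {B : ℝ} (hNN : N ≤ N')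
    (hw : ∀ n, N ≤ n → w (n + 1) ≤ w n) (hw0 : ∀ n, 0 ≤ w n)
    (hB : ∀ M, M ≤ N' → ‖∑ n ∈ Ioc N M, f n‖ ≤ B) :
    ‖∑ n ∈ Ioc N N', (w n : ℂ) * f n‖ ≤ B * w N := by
  have key : ∀ M, N ≤ M → M ≤ N' →
      ‖∑ n ∈ Ioc N M, (w n : ℂ) * f n - w M * ∑ n ∈ Ioc N M, f n‖ ≤ B * (w N - w M) := by
    intro M hM
    induction M, hM using Nat.le_induction with
    | base => simp
    | succ M hM ih =>
      intro hM'
      rw [sum_Ioc_succ_top hM, sum_Ioc_succ_top hM]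
      have h1 := ih (by omega)
      have h2 : ‖((w M - w (M + 1) : ℝ) : ℂ) * ∑ n ∈ Ioc N M, f n‖ ≤ (w M - w (M + 1)) * B := by
        rw [norm_mul, Complex.norm_real, Real.norm_of_nonneg (sub_nonneg.2 (hw M hM))]
        exact mul_le_mul_of_nonneg_left (hB M (by omega)) (sub_nonneg.2 (hw M hM))
      calc _ = ‖(∑ n ∈ Ioc N M, (w n : ℂ) * f n - w M * ∑ n ∈ Ioc N M, f n) +
            ((w M - w (M + 1) : ℝ) : ℂ) * ∑ n ∈ Ioc N M, f n‖ := by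
            congr 1; push_cast; ring
        _ ≤ _ := norm_add_le _ _
        _ ≤ B * (w N - w M) + (w M - w (M + 1)) * B := add_le_add h1 h2
        _ = _ := by ring
  have h1 := key N' hNN le_rfl
  have h2 : ‖(w N' : ℂ) * ∑ n ∈ Ioc N N', f n‖ ≤ w N' * B := by
    rw [norm_mul, Complex.norm_real, Real.norm_of_nonneg (hw0 _)]
    exact mul_le_mul_of_nonneg_left (hB N' le_rfl) (hw0 _)
  calc _ = ‖(∑ n ∈ Ioc N N', (w n : ℂ) * f n - w N' * ∑ n ∈ Ioc N N', f n) +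
        w N' * ∑ n ∈ Ioc N N', f n‖ := by congr 1; ring
    _ ≤ _ := norm_add_le _ _
    _ ≤ B * (w N - w N') + w N' * B := add_le_add h1 h2
    _ = _ := by ring

lemma natCast_cpow_neg_eq {n : ℕ} (hn : 1 ≤ n) (s : ℂ) :
    (n : ℂ) ^ (-s) = (((n : ℝ) ^ (-s.re) : ℝ) : ℂ) *
      expi (-(s.im / (2 * Real.pi)) * Real.log n) := by
  have hn0 : (0 : ℝ) < n := by exact_mod_cast hn
  rw [Complex.cpow_def_of_ne_zero (by exact_mod_cast hn0.ne'), Real.rpow_def_of_pos hn0, expi,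
    Complex.ofReal_exp, ← Complex.exp_add, ← Complex.natCast_log]
  congr 1
  have : (Real.pi : ℂ) ≠ 0 := by exact_mod_cast Real.pi_ne_zero
  conv_lhs => rw [← Complex.re_add_im s]
  push_cast
  field_simp
  ring

lemma exponent_le_of_cube_mul_sq_le {η L T l : ℝ} (hη : 0 ≤ η) (hL : 0 ≤ L) (hT : 1 ≤ T)
    (hl : 0 ≤ l) (h : η ^ 3 * T ^ 2 ≤ l ^ 2) : η * L - L ^ 3 / (10 ^ 8 * T ^ 2) ≤ 10 ^ 4 * l := by
  have hT0 : 0 < T := by linarith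
  set q := Real.sqrt η with hq
  have hq0 : 0 ≤ q := Real.sqrt_nonneg _
  have hqq : q ^ 2 = η := Real.sq_sqrt hη
  have hqT : q ^ 3 * T ≤ l := by
    apply le_of_sq_le_sq _ hl
    calc (q ^ 3 * T) ^ 2 = η ^ 3 * T ^ 2 := by rw [← hqq]; ring
      _ ≤ _ := h
  have hcube : 0 ≤ L ^ 3 / (10 ^ 8 * T ^ 2) := by positivity
  rcases le_or_gt L (10 ^ 4 * T * q) with h1 | h1
  · have : η * L ≤ η * (10 ^ 4 * T * q) := mul_le_mul_of_nonneg_left h1 hη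
    have h3 : η * (10 ^ 4 * T * q) = 10 ^ 4 * (q ^ 3 * T) := by rw [← hqq]; ring
    linarith
  · have h2 : (10 ^ 4 * T * q) ^ 2 ≤ L ^ 2 := pow_le_pow_left₀ (by positivity) h1.le 2
    have h3 : η * L ≤ L ^ 3 / (10 ^ 8 * T ^ 2) := by
      rw [le_div_iff₀ (by positivity)]
      calc η * L * (10 ^ 8 * T ^ 2) = L * (10 ^ 4 * T * q) ^ 2 := by rw [← hqq]; ring
        _ ≤ L * L ^ 2 := mul_le_mul_of_nonneg_left h2 hL
        _ = _ := by ring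
    nlinarith

lemma norm_sum_Ioc_dyadic_le {f : ℕ → ℂ} {B : ℝ} {X : ℕ} (hX : 1 ≤ X)
    (hB : ∀ N M : ℕ, 1 ≤ N → N ≤ X → N ≤ M → M ≤ 2 * N → ‖∑ n ∈ Ioc N M, f n‖ ≤ B) :
    ‖∑ n ∈ Ioc 1 X, f n‖ ≤ (Nat.log 2 X + 1) * B := by
  have key : ∀ K : ℕ, ‖∑ n ∈ Ioc 1 (min (2 ^ K) X), f n‖ ≤ K * B := by
    intro K
    induction K with
    | zero => simp [hX]
    | succ K ih =>
      have h1 : 1 ≤ min (2 ^ K) X := le_min Nat.one_le_two_pow hX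
      have h2 : min (2 ^ K) X ≤ min (2 ^ (K + 1)) X :=
        min_le_min_right _ (Nat.pow_le_pow_right (by norm_num) (by omega))
      have h3 : min (2 ^ (K + 1)) X ≤ 2 * min (2 ^ K) X := by rw [pow_succ]; omega
      rw [← sum_Ioc_consecutive _ h1 h2]
      calc _ ≤ _ := norm_add_le _ _
        _ ≤ K * B + B := add_le_add ih (hB _ _ h1 (min_le_right _ _) h2 h3)
        _ = _ := by push_cast; ring
  have := key (Nat.log 2 X + 1)
  rwa [min_eq_right (Nat.lt_pow_succ_log_self (by norm_num) X).le, Nat.cast_add, Nat.cast_one]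
    at this

/-- A Vinogradov–Korobov type bound for the zeta function near the line `Re s = 1`. -/
theorem norm_riemannZeta_le : ∃ C : ℝ, 0 < C ∧ ∀ (η : ℝ) (s : ℂ), 3 ≤ s.im → 0 ≤ η →
    η ≤ 1 / 10 → η ^ 3 * (Real.log s.im) ^ 2 ≤ (Real.log (Real.log s.im)) ^ 2 →
    1 - η ≤ s.re → s.re ≤ 3 → ‖riemannZeta s‖ ≤ C * Real.log s.im ^ 10001 := by
  obtain ⟨C, hC, hsum⟩ := norm_sum_Ioc_expi_log_le
  refine ⟨4 * C + 14, by positivity, fun η s ht hη hη1 hηt hs1 hs3 => ?_⟩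
  set t := s.im with htdef
  set T := Real.log t with hT
  have ht0 : 0 < t := by linarith
  have hT1 : 1 ≤ T := by
    rw [hT, Real.le_log_iff_exp_le ht0]
    linarith [Real.exp_one_lt_d9]
  have hl0 : 0 ≤ Real.log T := Real.log_nonneg hT1
  set X := ⌊t ^ (10 / 9 : ℝ)⌋₊ with hXdef
  have htpow : 1 ≤ t ^ (10 / 9 : ℝ) := Real.one_le_rpow (by linarith) (by norm_num)
  have hX1 : 1 ≤ X := Nat.le_floor (by exact_mod_cast htpow)
  have hX1' : (1 : ℝ) ≤ X := by exact_mod_cast hX1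
  have hXle : (X : ℝ) ≤ t ^ (10 / 9 : ℝ) := Nat.floor_le (by positivity)
  have hXge : t ^ (10 / 9 : ℝ) / 2 ≤ X := by
    have := Nat.lt_floor_add_one (t ^ (10 / 9 : ℝ))
    rw [← hXdef] at this
    linarith
  have hlogX : 9 / 10 * Real.log X ≤ T := by
    have := Real.log_le_log (by positivity) hXle
    rw [Real.log_rpow ht0] at this
    linarith
  -- blocks
  have hblock : ∀ N M : ℕ, 1 ≤ N → N ≤ X → N ≤ M → M ≤ 2 * N →
      ‖∑ n ∈ Ioc N M, (n : ℂ) ^ (-s)‖ ≤ C * T ^ 10000 := by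
    intro N M hN hNX hNM hM
    have hN0 : (0 : ℝ) < N := by exact_mod_cast hN
    have hL : 0 ≤ Real.log N := Real.log_nonneg (by exact_mod_cast hN)
    have hNlog : 9 / 10 * Real.log N ≤ T :=
      le_trans (mul_le_mul_of_nonneg_left (Real.log_le_log hN0 (by exact_mod_cast hNX))
        (by norm_num)) hlogX
    have h1 : ∑ n ∈ Ioc N M, (n : ℂ) ^ (-s) = ∑ n ∈ Ioc N M, (((n : ℝ) ^ (-s.re) : ℝ) : ℂ) *
        expi (-(t / (2 * Real.pi)) * Real.log n) :=
      sum_congr rfl fun n hn => natCast_cpow_neg_eq (by have := (mem_Ioc.1 hn).1; omega) s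
    rw [h1]
    have h2 := norm_sum_Ioc_mul_le (f := fun n : ℕ => expi (-(t / (2 * Real.pi)) * Real.log n))
      (w := fun n : ℕ => (n : ℝ) ^ (-s.re)) hNM
      (fun n hn => Real.rpow_le_rpow_of_nonpos (by exact_mod_cast (by omega))
        (by exact_mod_cast (by omega)) (by linarith)) (fun n => by positivity)
      (fun M' hM' => hsum N M' t hN (by omega) hT1 hNlog ht0)
    refine h2.trans ?_
    rw [Real.rpow_def_of_pos hN0, mul_assoc, ← Real.exp_add]
    refine mul_le_mul_of_nonneg_left ?_ hC
    have h3 := exponent_le_of_cube_mul_sq_le hη hL hT1 hl0 hηt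
    have h4 : (1 - η) * Real.log N ≤ s.re * Real.log N := mul_le_mul_of_nonneg_right hs1 hL
    calc _ ≤ Real.exp (10000 * Real.log T) := Real.exp_le_exp.2 (by linarith)
      _ = T ^ 10000 := by
        rw [mul_comm, ← Real.rpow_def_of_pos (by linarith), ← Real.rpow_natCast]; norm_num
  have hK : (Nat.log 2 X + 1 : ℝ) ≤ 4 * T := by
    have h1 : (Nat.log 2 X : ℝ) ≤ Real.logb 2 X := by
      exact_mod_cast Real.natLog_le_logb X 2
    have h2 : Real.logb 2 X ≤ 2 * Real.log X := by
      rw [Real.logb, div_le_iff₀ (Real.log_pos (by norm_num))]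
      nlinarith [Real.log_two_gt_d9, Real.log_nonneg hX1']
    linarith
  have hTpow : 1 ≤ T ^ 10000 := one_le_pow₀ hT1
  have hTpow' : 1 ≤ T ^ 10001 := one_le_pow₀ hT1
  have hD : ‖∑ n ∈ Icc 1 X, (n : ℂ) ^ (-s)‖ ≤ 1 + 4 * C * T ^ 10001 := by
    have : Icc 1 X = insert 1 (Ioc 1 X) := by ext n; simp; omega
    rw [this, sum_insert (by simp)]
    refine (norm_add_le _ _).trans (add_le_add (by simp) ?_)
    refine (norm_sum_Ioc_dyadic_le hX1 hblock).trans ?_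
    calc _ ≤ 4 * T * (C * T ^ 10000) := mul_le_mul_of_nonneg_right hK (by positivity)
      _ = _ := by rw [pow_succ T 10000]; ring
  have hsne : s ≠ 1 := fun h => by rw [htdef, h] at ht; norm_num at ht
  have happ := norm_riemannZeta_sub_sum_le (by linarith : 1 / 2 < s.re) hsne hX1
  have hXp : (X : ℝ) ^ (1 - s.re) / ‖s - 1‖ ≤ 1 := by
    have h1 : t ≤ ‖s - 1‖ := by
      have := Complex.abs_im_le_norm (s - 1)
      simp only [Complex.sub_im, Complex.one_im, sub_zero] at this
      exact (le_abs_self _).trans this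
    rw [div_le_one (by linarith)]
    refine le_trans ?_ h1
    calc (X : ℝ) ^ (1 - s.re) ≤ (X : ℝ) ^ (9 / 10 : ℝ) :=
          Real.rpow_le_rpow_of_exponent_le hX1' (by linarith)
      _ ≤ (t ^ (10 / 9 : ℝ)) ^ (9 / 10 : ℝ) := Real.rpow_le_rpow (by positivity) hXle (by norm_num)
      _ = t := by rw [← Real.rpow_mul ht0.le]; norm_num
  have hXm : 3 * ‖s‖ * (X : ℝ) ^ (-s.re) ≤ 12 := by
    have h1 : ‖s‖ ≤ 2 * t := by
      refine (Complex.norm_le_abs_re_add_abs_im s).trans ?_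
      rw [abs_of_nonneg (by linarith : 0 ≤ s.re), abs_of_nonneg ht0.le]
      linarith
    have h2 : (X : ℝ) ^ (-s.re) ≤ 2 / t := by
      calc (X : ℝ) ^ (-s.re) ≤ (X : ℝ) ^ (-(9 / 10) : ℝ) :=
            Real.rpow_le_rpow_of_exponent_le hX1' (by linarith)
        _ ≤ (t ^ (10 / 9 : ℝ) / 2) ^ (-(9 / 10) : ℝ) :=
            Real.rpow_le_rpow_of_nonpos (by positivity) hXge (by norm_num)
        _ = 2 ^ (9 / 10 : ℝ) / t := by
            rw [Real.div_rpow (by positivity) (by norm_num), ← Real.rpow_mul ht0.le,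
              Real.rpow_neg (by norm_num) (9 / 10 : ℝ)]
            norm_num
            rw [Real.rpow_neg_one, mul_comm]; rfl
        _ ≤ 2 / t := by
            gcongr
            calc (2 : ℝ) ^ (9 / 10 : ℝ) ≤ 2 ^ (1 : ℝ) :=
                  Real.rpow_le_rpow_of_exponent_le (by norm_num) (by norm_num)
              _ = 2 := by norm_num
    calc 3 * ‖s‖ * (X : ℝ) ^ (-s.re) ≤ 3 * (2 * t) * (2 / t) := by gcongr
      _ = 12 := by field_simp; norm_num
  have := norm_sub_norm_le (riemannZeta s) (∑ n ∈ Icc 1 X, (n : ℂ) ^ (-s))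
  nlinarith

end ZetaBound

section ZetaNearOne

open ArithmeticFunction in
lemma hasSum_log_norm_riemannZeta {s : ℂ} (hs : 1 < s.re) :
    HasSum (fun n : ℕ => vonMangoldt n / Real.log n *
      ((n : ℝ) ^ (-s.re) * Real.cos (s.im * Real.log n))) (Real.log ‖riemannZeta s‖) := by
  have hsum : LSeriesSummable (fun n : ℕ => (vonMangoldt n : ℂ) / Real.log n) s := by
    refine LSeriesSummable_of_bounded_of_one_lt_re (m := 1) (fun n hn => ?_) hs
    rw [norm_div, Complex.norm_real, Complex.norm_real, Real.norm_of_nonneg vonMangoldt_nonneg,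
      Real.norm_of_nonneg (Real.log_natCast_nonneg n)]
    exact div_le_one_of_le₀ vonMangoldt_le_log (Real.log_natCast_nonneg n)
  have h1 := Complex.hasSum_re hsum.LSeriesHasSum
  rw [← riemannZeta_eq_exp_LSeries hs, Complex.norm_exp, Real.log_exp]
  convert h1 using 1
  funext n
  rcases Nat.eq_zero_or_pos n with rfl | hn
  · simp
  rw [LSeries.term_def₀ (by simp), natCast_cpow_neg_eq hn, ← Complex.ofReal_div, Complex.re_ofReal_mul,
    Complex.re_ofReal_mul, expi, show (2 * Real.pi * ((-(s.im / (2 * Real.pi)) * Real.log n : ℝ) : ℂ) * Complex.I)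
      = ((-(s.im * Real.log n) : ℝ) : ℂ) * Complex.I by
        have : (Real.pi : ℂ) ≠ 0 := by exact_mod_cast Real.pi_ne_zero
        push_cast; field_simp, Complex.exp_ofReal_mul_I_re, Real.cos_neg]

lemma vonMangoldt_div_log_nonneg (n : ℕ) : 0 ≤ ArithmeticFunction.vonMangoldt n / Real.log n :=
  div_nonneg ArithmeticFunction.vonMangoldt_nonneg (Real.log_natCast_nonneg n)

lemma norm_inv_riemannZeta_le {s : ℂ} (hs : 1 < s.re) :
    ‖(riemannZeta s)⁻¹‖ ≤ ‖riemannZeta (s.re : ℂ)‖ := by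
  have h1 := (hasSum_log_norm_riemannZeta hs).neg
  have h2 := hasSum_log_norm_riemannZeta (s := (s.re : ℂ)) (by simpa using hs)
  have h3 := hasSum_le (fun n => ?_) h1 h2
  · rw [norm_inv]
    have h4 : 0 < ‖riemannZeta s‖ := norm_pos_iff.2 (riemannZeta_ne_zero_of_one_lt_re hs)
    have h5 : 0 < ‖riemannZeta (s.re : ℂ)‖ :=
      norm_pos_iff.2 (riemannZeta_ne_zero_of_one_lt_re (by simpa using hs))
    rw [← Real.log_inv] at h3
    exact (Real.log_le_log_iff (by positivity) h5).1 h3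
  · rw [← mul_neg]
    refine mul_le_mul_of_nonneg_left ?_ (vonMangoldt_div_log_nonneg n)
    rw [← mul_neg]
    refine mul_le_mul_of_nonneg_left ?_ (by positivity)
    simp only [Complex.ofReal_im, zero_mul, Real.cos_zero]
    linarith [Real.neg_one_le_cos (s.im * Real.log n)]

lemma one_le_riemannZeta_ratio {σ₁ σ₂ : ℝ} (t : ℝ) (h1 : 1 < σ₁) (h12 : σ₁ ≤ σ₂) :
    ‖riemannZeta σ₂‖ ^ 3 * ‖riemannZeta (σ₂ + t * Complex.I)‖ ^ 4 *
        ‖riemannZeta (σ₂ + (2 * t : ℝ) * Complex.I)‖ ≤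
      ‖riemannZeta σ₁‖ ^ 3 * ‖riemannZeta (σ₁ + t * Complex.I)‖ ^ 4 *
        ‖riemannZeta (σ₁ + (2 * t : ℝ) * Complex.I)‖ := by
  have hre (σ u : ℝ) : (σ + u * Complex.I : ℂ).re = σ := by simp
  have him (σ u : ℝ) : (σ + u * Complex.I : ℂ).im = u := by simp
  have key (σ : ℝ) (hσ : 1 < σ) : HasSum (fun n : ℕ => ArithmeticFunction.vonMangoldt n / Real.log n *
      ((n : ℝ) ^ (-σ) * (3 + 4 * Real.cos (t * Real.log n) + Real.cos (2 * t * Real.log n))))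
      (Real.log (‖riemannZeta σ‖ ^ 3 * ‖riemannZeta (σ + t * Complex.I)‖ ^ 4 *
        ‖riemannZeta (σ + (2 * t : ℝ) * Complex.I)‖)) := by
    have hpos (u : ℝ) : 0 < ‖riemannZeta (σ + u * Complex.I)‖ :=
      norm_pos_iff.2 (riemannZeta_ne_zero_of_one_lt_re (by rwa [hre]))
    have hs (u : ℝ) := hasSum_log_norm_riemannZeta (s := σ + u * Complex.I) (by rwa [hre])
    simp only [hre, him] at hs
    have hpos0 : 0 < ‖riemannZeta σ‖ := by simpa using hpos 0
    have hs0 := hs 0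
    simp only [Complex.ofReal_zero, zero_mul, add_zero, Real.cos_zero] at hs0
    rw [Real.log_mul (by have := hpos t; positivity) (hpos _).ne',
      Real.log_mul (by positivity) (by have := hpos t; positivity), Real.log_pow, Real.log_pow]
    convert ((hs0.mul_left 3).add ((hs t).mul_left 4)).add (hs (2 * t)) using 1
    · rfl
    · funext n
      ring
    · norm_num
  have h3 := hasSum_le (fun n => ?_) (key σ₂ (h1.trans_le h12)) (key σ₁ h1)
  · have hpos (σ u : ℝ) (hσ : 1 < σ) : 0 < ‖riemannZeta (σ + u * Complex.I)‖ :=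
      norm_pos_iff.2 (riemannZeta_ne_zero_of_one_lt_re (by rwa [hre]))
    have hp (σ : ℝ) (hσ : 1 < σ) : 0 < ‖riemannZeta σ‖ ^ 3 * ‖riemannZeta (σ + t * Complex.I)‖ ^ 4 *
        ‖riemannZeta (σ + (2 * t : ℝ) * Complex.I)‖ := by
      have h := hpos σ 0 hσ
      simp only [Complex.ofReal_zero, zero_mul, add_zero] at h
      have h' := hpos σ t hσ
      have h'' := hpos σ (2 * t) hσ
      positivity
    exact (Real.log_le_log_iff (hp _ (h1.trans_le h12)) (hp _ h1)).1 h3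
  · refine mul_le_mul_of_nonneg_left ?_ (vonMangoldt_div_log_nonneg n)
    rcases Nat.eq_zero_or_pos n with rfl | hn
    · rw [Nat.cast_zero, Real.zero_rpow (by linarith), Real.zero_rpow (by linarith)]
    refine mul_le_mul_of_nonneg_right (Real.rpow_le_rpow_of_exponent_le (by exact_mod_cast hn)
      (by linarith)) ?_
    rw [mul_assoc, Real.cos_two_mul]
    nlinarith [sq_nonneg (1 + Real.cos (t * Real.log n))]

lemma exists_norm_riemannZeta_real_le : ∃ C : ℝ, 1 ≤ C ∧ ∀ σ : ℝ, 1 < σ → σ ≤ 3 →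
    ‖riemannZeta σ‖ ≤ C / (σ - 1) := by
  obtain ⟨C, hC⟩ := (isCompact_Icc (a := (1 : ℝ)) (b := 3)).exists_bound_of_continuousOn
    (f := fun σ : ℝ => riemannZeta₁ σ)
    (differentiable_riemannZeta₁.continuous.comp Complex.continuous_ofReal).continuousOn
  refine ⟨max C 1, le_max_right _ _, fun σ h1 h3 => ?_⟩
  have hs : (σ : ℂ) ≠ 1 := by exact_mod_cast h1.ne'
  rw [riemannZeta_eq_inv_sub_mul hs, norm_mul, norm_inv, ← Complex.ofReal_one, ← Complex.ofReal_sub,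
    Complex.norm_real, Real.norm_of_nonneg (by linarith), inv_mul_eq_div]
  exact div_le_div_of_nonneg_right ((hC σ ⟨h1.le, h3⟩).trans (le_max_left _ _)) (by linarith)

lemma exists_riemannZeta_real_ratio_le : ∃ δ : ℝ, 0 < δ ∧ ∀ u : ℝ, 0 < u → u ≤ δ →
    ‖riemannZeta ((1 + u : ℝ) : ℂ)‖ ≤ 2.02 * ‖riemannZeta ((1 + 2 * u : ℝ) : ℂ)‖ := by
  have hc : ContinuousAt (fun u : ℝ => ‖riemannZeta₁ ((1 + u : ℝ) : ℂ)‖) 0 := by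
    have := differentiable_riemannZeta₁.continuous
    fun_prop
  rw [Metric.continuousAt_iff] at hc
  obtain ⟨δ, hδ, h⟩ := hc (1 / 1000) (by norm_num)
  simp only [add_zero, Complex.ofReal_one, riemannZeta₁_one, norm_one, Real.dist_eq, sub_zero] at h
  refine ⟨δ / 4, by positivity, fun u hu hu' => ?_⟩
  have e1 := abs_lt.1 (h (x := u) (by rw [abs_of_pos hu]; linarith))
  have e2 := abs_lt.1 (h (x := 2 * u) (by rw [abs_of_pos (by linarith)]; linarith))
  have key (v : ℝ) (hv : 0 < v) :
      ‖riemannZeta ((1 + v : ℝ) : ℂ)‖ = ‖riemannZeta₁ ((1 + v : ℝ) : ℂ)‖ / v := by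
    have hs : ((1 + v : ℝ) : ℂ) ≠ 1 := by
      intro h
      have : (1 + v : ℝ) = 1 := by exact_mod_cast h
      linarith
    rw [riemannZeta_eq_inv_sub_mul hs, norm_mul, norm_inv, ← Complex.ofReal_one,
      ← Complex.ofReal_sub, Complex.norm_real, add_sub_cancel_left, Real.norm_of_nonneg hv.le,
      inv_mul_eq_div]
  rw [key u hu, key (2 * u) (by linarith), div_le_iff₀ hu]
  calc ‖riemannZeta₁ ((1 + u : ℝ) : ℂ)‖ ≤ 1.01 * ‖riemannZeta₁ ((1 + 2 * u : ℝ) : ℂ)‖ := by linarith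
    _ = _ := by field_simp; norm_num; ring

end ZetaNearOne

section HalfDisc

lemma norm_le_of_norm_le_halfDisc {R B : ℝ} {g : ℂ → ℂ} {U : Set ℂ}
    (hsub : ∀ z : ℂ, 0 ≤ z.re → ‖z‖ ≤ R → z ∈ U) (hg : DifferentiableOn ℂ g U)
    (hdiam : ∀ z : ℂ, z.re = 0 → ‖z‖ ≤ R → ‖g z‖ ≤ B)
    (harc : ∀ z : ℂ, 0 ≤ z.re → ‖z‖ = R → ‖g z‖ ≤ B) {z : ℂ} (hz : 0 < z.re) (hzR : ‖z‖ < R) :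
    ‖g z‖ ≤ B := by
  set V : Set ℂ := {z | 0 < z.re} ∩ Metric.ball 0 R with hV
  have hVo : IsOpen V := (isOpen_lt continuous_const Complex.continuous_re).inter Metric.isOpen_ball
  have hcl : closure V ⊆ {z : ℂ | 0 ≤ z.re ∧ ‖z‖ ≤ R} := by
    refine closure_minimal (fun z hz => ⟨le_of_lt hz.1, by simpa using (Metric.mem_ball.1 hz.2).le⟩) ?_
    exact (isClosed_le continuous_const Complex.continuous_re).inter
      (isClosed_le continuous_norm continuous_const)
  have hd : DiffContOnCl ℂ g V :=
    (hg.mono fun z hz => hsub z (hcl hz).1 (hcl hz).2).diffContOnCl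
  refine Complex.norm_le_of_forall_mem_frontier_norm_le
    (Metric.isBounded_ball.subset Set.inter_subset_right) hd (fun z hz => ?_)
    (subset_closure ⟨hz, by simpa using hzR⟩)
  rw [frontier, hVo.interior_eq] at hz
  obtain ⟨h1, h2⟩ := hcl hz.1
  rcases h1.eq_or_lt with h | h
  · exact hdiam z h.symm h2
  · rcases h2.eq_or_lt with h' | h'
    · exact harc z h1 h'
    · exact absurd ⟨h, by simpa using h'⟩ hz.2

lemma exists_norm_le_one_halfDisc {R M : ℝ} (hR : 0 < R) (hM : 0 ≤ M) {F : ℂ → ℂ} {U : Set ℂ}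
    (hF : DifferentiableOn ℂ F U)
    (hdiam : ∀ z : ℂ, z.re = 0 → ‖z‖ ≤ R → ‖F z‖ ≤ 1)
    (harc : ∀ z : ℂ, 0 ≤ z.re → ‖z‖ = R → ‖F z‖ ≤ Real.exp M) :
    ∃ G : ℂ → ℂ, DifferentiableOn ℂ G U ∧ (∀ z : ℂ, z.re = 0 → ‖z‖ ≤ R → ‖G z‖ ≤ 1) ∧
      (∀ z : ℂ, 0 ≤ z.re → ‖z‖ = R → ‖G z‖ ≤ 1) ∧
      ∀ x : ℝ, 0 ≤ x → x ≤ R → ‖G x‖ ≤ ‖F x‖ ∧ ‖F x‖ ≤ Real.exp (2 * M * x / R) * ‖G x‖ := by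
  set w : ℂ → ℂ := fun z => 2 * z / R - (z / R) ^ 2 with hw
  have hwre (z : ℂ) : (w z).re = 2 * z.re / R - (z.re ^ 2 - z.im ^ 2) / R ^ 2 := by
    have h1 : (2 * z / (R : ℂ)).re = 2 * z.re / R := by rw [Complex.div_ofReal_re]; simp
    have h2 : ((z / (R : ℂ)) ^ 2).re = (z.re ^ 2 - z.im ^ 2) / R ^ 2 := by
      rw [sq, Complex.mul_re, Complex.div_ofReal_re, Complex.div_ofReal_im]
      field_simp
    rw [hw, Complex.sub_re, h1, h2]
  have hG (z : ℂ) : ‖F z * Complex.exp (-(M * w z))‖ = ‖F z‖ * Real.exp (-(M * (w z).re)) := by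
    rw [norm_mul, Complex.norm_exp, Complex.neg_re, Complex.re_ofReal_mul]
  refine ⟨fun z => F z * Complex.exp (-(M * w z)), ?_, fun z hz hzR => ?_, fun z hz hzR => ?_,
    fun x hx hxR => ?_⟩
  · refine hF.mul (Differentiable.differentiableOn ?_)
    simp only [hw]
    fun_prop
  · simp only [hG]
    have h1 : 0 ≤ (w z).re := by rw [hwre, hz]; ring_nf; positivity
    have h2 : Real.exp (-(M * (w z).re)) ≤ 1 := Real.exp_le_one_iff.2 (by nlinarith)
    exact mul_le_one₀ (hdiam z hz hzR) (Real.exp_pos _).le h2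
  · simp only [hG]
    have h1 : 1 ≤ (w z).re := by
      have h3 : z.re ^ 2 + z.im ^ 2 = R ^ 2 := by
        rw [← hzR, Complex.sq_norm, Complex.normSq_apply]; ring
      have h4 : z.re ≤ R := (Complex.re_le_norm z).trans hzR.le
      rw [hwre, div_sub_div _ _ hR.ne' (by positivity), le_div_iff₀ (by positivity)]
      have h5 : z.im ^ 2 = R ^ 2 - z.re ^ 2 := by linarith
      rw [h5]
      nlinarith [mul_nonneg (mul_nonneg hz (sub_nonneg.2 h4)) hR.le]
    calc _ ≤ Real.exp M * Real.exp (-M) := by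
          refine mul_le_mul (harc z hz hzR) (Real.exp_le_exp.2 (by nlinarith)) (Real.exp_pos _).le
            (Real.exp_pos _).le
      _ = 1 := by rw [← Real.exp_add]; simp
  · have h1 : (w x).re = 2 * x / R - x ^ 2 / R ^ 2 := by rw [hwre]; simp
    have h2 : x ^ 2 / R ^ 2 ≤ x / R := by
      rw [div_le_div_iff₀ (by positivity) hR]
      nlinarith [mul_nonneg (mul_nonneg hx (sub_nonneg.2 hxR)) hR.le]
    have h3 : 0 ≤ x / R := by positivity
    have h4 : 2 * x / R = 2 * (x / R) := by ring
    have h5 : 0 ≤ (w x).re := by rw [h1, h4]; linarith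
    have h6 : (w x).re ≤ 2 * x / R := by rw [h1]; linarith [show 0 ≤ x ^ 2 / R ^ 2 by positivity]
    refine ⟨?_, ?_⟩
    · simp only [hG]
      exact mul_le_of_le_one_right (norm_nonneg _) (Real.exp_le_one_iff.2 (by nlinarith))
    · simp only [hG]
      have h7 : 1 ≤ Real.exp (2 * M * x / R) * Real.exp (-(M * (w x).re)) := by
        rw [← Real.exp_add]
        refine Real.one_le_exp ?_
        have := mul_le_mul_of_nonneg_left h6 hM
        have e : 2 * M * x / R = M * (2 * x / R) := by ring
        linarith
      nlinarith [norm_nonneg (F x)]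

lemma norm_le_exp_of_halfDisc {R M : ℝ} (hR : 0 < R) (hM : 0 ≤ M) {F : ℂ → ℂ} {U : Set ℂ}
    (hsub : ∀ z : ℂ, 0 ≤ z.re → ‖z‖ ≤ R → z ∈ U) (hF : DifferentiableOn ℂ F U)
    (hdiam : ∀ z : ℂ, z.re = 0 → ‖z‖ ≤ R → ‖F z‖ ≤ 1)
    (harc : ∀ z : ℂ, 0 ≤ z.re → ‖z‖ = R → ‖F z‖ ≤ Real.exp M) {x : ℝ} (hx : 0 < x) (hxR : x < R) :
    ‖F x‖ ≤ Real.exp (2 * M * x / R) := by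
  obtain ⟨G, hG, h1, h2, h3⟩ := exists_norm_le_one_halfDisc hR hM hF hdiam harc
  have h4 := norm_le_of_norm_le_halfDisc hsub hG h1 h2 (z := x) (by simpa)
    (by rwa [Complex.norm_real, Real.norm_of_nonneg hx.le])
  exact (h3 x hx.le hxR.le).2.trans (mul_le_of_le_one_right (Real.exp_pos _).le h4)

/-- A function on a half disc that is bounded by `1` on the diameter and small at an interior point
is small near that point. -/
lemma norm_le_of_halfDisc {R M a : ℝ} (hR : 0 < R) (hM : 0 ≤ M) {F : ℂ → ℂ} {U : Set ℂ}
    (hU : IsOpen U) (hsub : ∀ z : ℂ, 0 ≤ z.re → ‖z‖ ≤ R → z ∈ U) (hF : DifferentiableOn ℂ F U)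
    (hdiam : ∀ z : ℂ, z.re = 0 → ‖z‖ ≤ R → ‖F z‖ ≤ 1)
    (harc : ∀ z : ℂ, 0 ≤ z.re → ‖z‖ = R → ‖F z‖ ≤ Real.exp M) {x : ℝ} (hx : 0 < x) (hxa : x < a)
    (haR : 3 * a ≤ R) :
    ‖F x‖ ≤ Real.exp (2 * M * x / R) *
      (‖F a‖ + (1 + ‖F a‖) * (1 + 3 * a / R) * ((a - x) / (a + x))) := by
  have ha : 0 < a := hx.trans hxa
  obtain ⟨G, hG, h1, h2, h3⟩ := exists_norm_le_one_halfDisc hR hM hF hdiam harc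
  have haU : U ∈ nhds (a : ℂ) := hU.mem_nhds (hsub a (by simpa using ha.le)
    (by rw [Complex.norm_real, Real.norm_of_nonneg ha.le]; linarith))
  set κ := G a with hκ
  have hκF : ‖κ‖ ≤ ‖F a‖ := (h3 a ha.le (by linarith)).1
  set Q : ℂ → ℂ := fun z => dslope G a z * (z + a) with hQ
  have hQd : DifferentiableOn ℂ Q U :=
    ((Complex.differentiableOn_dslope haU).2 hG).mul (by fun_prop)
  have hQn (z : ℂ) (hz : z ≠ a) : ‖Q z‖ = ‖G z - κ‖ * (‖z + a‖ / ‖z - a‖) := by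
    rw [hQ, norm_mul, dslope_of_ne _ hz, slope_def_field, norm_div]
    ring
  have hsubone (z : ℂ) (h : ‖G z‖ ≤ 1) : ‖G z - κ‖ ≤ 1 + ‖F a‖ :=
    (norm_sub_le _ _).trans (add_le_add h hκF)
  have hB : 0 ≤ 3 * a / R := by positivity
  have hbd : ‖Q x‖ ≤ (1 + ‖F a‖) * (1 + 3 * a / R) := by
    refine norm_le_of_norm_le_halfDisc hsub hQd (fun z hz hzR => ?_) (fun z hz hzR => ?_)
      (by simpa using hx) (by rw [Complex.norm_real, Real.norm_of_nonneg hx.le]; linarith)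
    · have hne : z ≠ a := fun h => by rw [h] at hz; simp at hz; linarith
      have e : ‖z + a‖ = ‖z - a‖ := by
        have : ‖z + a‖ ^ 2 = ‖z - a‖ ^ 2 := by
          rw [Complex.sq_norm, Complex.sq_norm, Complex.normSq_apply, Complex.normSq_apply]
          simp [hz]
        exact (sq_eq_sq₀ (norm_nonneg _) (norm_nonneg _)).1 this
      rw [hQn z hne, e, div_self (norm_ne_zero_iff.2 (sub_ne_zero.2 hne)), mul_one]
      exact (hsubone z (h1 z hz hzR)).trans (le_mul_of_one_le_right (by positivity) (by linarith))
    · have hne : z ≠ a := fun h => by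
        rw [h, Complex.norm_real, Real.norm_of_nonneg ha.le] at hzR; linarith
      rw [hQn z hne]
      refine mul_le_mul (hsubone z (h2 z hz hzR)) ?_ (by positivity) (by positivity)
      have e1 : ‖z + a‖ ≤ R + a := by
        refine (norm_add_le _ _).trans ?_
        rw [hzR, Complex.norm_real, Real.norm_of_nonneg ha.le]
      have e2 : R - a ≤ ‖z - a‖ := by
        have := norm_sub_norm_le z a
        rwa [hzR, Complex.norm_real, Real.norm_of_nonneg ha.le] at this
      rw [div_le_iff₀ (by linarith)]
      have e3 : R + a ≤ (1 + 3 * a / R) * (R - a) := by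
        have : 3 * a / R * (R - a) = 3 * a - 3 * a * a / R := by field_simp
        have e4 : 3 * a * a / R ≤ a := by rw [div_le_iff₀ hR]; nlinarith
        linarith
      exact (e1.trans e3).trans (mul_le_mul_of_nonneg_left e2 (by positivity))
  have hne : (x : ℂ) ≠ a := by exact_mod_cast hxa.ne
  rw [hQn _ hne, ← Complex.ofReal_add, ← Complex.ofReal_sub, Complex.norm_real, Complex.norm_real,
    Real.norm_of_nonneg (by linarith), Real.norm_of_nonpos (by linarith), neg_sub] at hbd
  have hGx : ‖G x - κ‖ ≤ (1 + ‖F a‖) * (1 + 3 * a / R) * ((a - x) / (a + x)) := by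
    rw [← div_le_iff₀ (by apply div_pos <;> linarith)]
    refine le_trans (le_of_eq ?_) hbd
    rw [div_div_eq_mul_div, mul_div_assoc, add_comm a x]
  refine (h3 x hx.le (by linarith)).2.trans (mul_le_mul_of_nonneg_left ?_ (Real.exp_pos _).le)
  have := norm_le_norm_add_norm_sub' (G x) κ
  rw [show G x = (G x - κ) + κ by ring]
  refine (norm_add_le _ _).trans ?_
  linarith

end HalfDisc

section ZetaInverse

lemma norm_riemannZeta_star_sub (w z : ℂ) :
    ‖riemannZeta ((starRingEnd ℂ) w - z)‖ = ‖riemannZeta (w - (starRingEnd ℂ) z)‖ := by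
  rw [← RCLike.norm_conj (riemannZeta (w - (starRingEnd ℂ) z)), ← riemannZeta_conj, map_sub,
    Complex.conj_conj]

lemma riemannZeta_halfDisc {σ₀ t R B B' M : ℝ} (hσ : 1 < σ₀) (hR : 0 < R) (hRt : R < t)
    (hM : 0 ≤ M)
    (hbd : ∀ s : ℂ, σ₀ - R ≤ s.re → s.re ≤ σ₀ → |s.im - t| ≤ R → ‖riemannZeta s‖ ≤ B)
    (hinv : ∀ s : ℂ, σ₀ ≤ s.re → s.re ≤ σ₀ + R → ‖(riemannZeta s)⁻¹‖ ≤ B')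
    (hBM : B * B' ≤ Real.exp M) {x : ℝ} (hx : 0 < x) :
    (x < R → ‖riemannZeta ((σ₀ - x : ℝ) + t * Complex.I)‖ ≤
      Real.exp (2 * M * x / R) * ‖riemannZeta ((σ₀ + x : ℝ) + t * Complex.I)‖) ∧
    ∀ a k : ℝ, x < a → 3 * a ≤ R → ‖riemannZeta ((σ₀ - a : ℝ) + t * Complex.I)‖ ≤
        k * ‖riemannZeta ((σ₀ + a : ℝ) + t * Complex.I)‖ →
      ‖riemannZeta ((σ₀ - x : ℝ) + t * Complex.I)‖ ≤ Real.exp (2 * M * x / R) *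
        (k + (1 + k) * (1 + 3 * a / R) * ((a - x) / (a + x))) *
        ‖riemannZeta ((σ₀ + x : ℝ) + t * Complex.I)‖ := by
  set s₀ : ℂ := σ₀ + t * Complex.I with hs₀
  have hre : s₀.re = σ₀ := by simp [hs₀]
  have him : s₀.im = t := by simp [hs₀]
  set U : Set ℂ := {z | 1 - σ₀ < z.re} ∩ Metric.ball 0 t with hUdef
  have hU : IsOpen U := (isOpen_lt continuous_const Complex.continuous_re).inter Metric.isOpen_ball
  have hsub : ∀ z : ℂ, 0 ≤ z.re → ‖z‖ ≤ R → z ∈ U := fun z hz hzR =>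
    ⟨by rw [Set.mem_ofPred_eq]; linarith, by simpa using hzR.trans_lt hRt⟩
  set F : ℂ → ℂ := fun z => riemannZeta ((starRingEnd ℂ) s₀ - z) / riemannZeta (s₀ + z) with hF
  have hne (z : ℂ) (hz : 1 - σ₀ < z.re) : riemannZeta (s₀ + z) ≠ 0 :=
    riemannZeta_ne_zero_of_one_lt_re (by rw [Complex.add_re, hre]; linarith)
  have hFd : DifferentiableOn ℂ F U := by
    intro z hz
    have h1 : (1 : ℝ) < (s₀ + z).re := by
      have := hz.1; rw [Set.mem_ofPred_eq] at this; rw [Complex.add_re, hre]; linarith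
    have h2 : s₀ + z ≠ 1 := fun h => by rw [h] at h1; simp at h1
    have h3 : (starRingEnd ℂ) s₀ - z ≠ 1 := fun h => by
      have h4 := congrArg Complex.im h
      rw [Complex.sub_im, Complex.conj_im, him, Complex.one_im] at h4
      have h5 : |z.im| < t := (Complex.abs_im_le_norm z).trans_lt (by simpa using hz.2)
      have := (abs_lt.1 h5).1
      linarith
    have d1 : DifferentiableAt ℂ (fun z => riemannZeta ((starRingEnd ℂ) s₀ - z)) z :=
      (differentiableAt_riemannZeta h3).comp z (by fun_prop)
    have d2 : DifferentiableAt ℂ (fun z => riemannZeta (s₀ + z)) z :=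
      (differentiableAt_riemannZeta h2).comp z (by fun_prop)
    exact (d1.div d2 (hne z (by simpa using hz.1))).differentiableWithinAt
  have hFn (z : ℂ) : ‖F z‖ = ‖riemannZeta (s₀ - (starRingEnd ℂ) z)‖ / ‖riemannZeta (s₀ + z)‖ := by
    rw [hF, norm_div, norm_riemannZeta_star_sub]
  have hdiam : ∀ z : ℂ, z.re = 0 → ‖z‖ ≤ R → ‖F z‖ ≤ 1 := by
    intro z hz _
    have : -(starRingEnd ℂ) z = z := by
      apply Complex.ext <;> simp [hz]
    rw [hFn, sub_eq_add_neg, this]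
    exact div_self_le_one _
  have harc : ∀ z : ℂ, 0 ≤ z.re → ‖z‖ = R → ‖F z‖ ≤ Real.exp M := by
    intro z hz hzR
    have h1 : z.re ≤ R := (Complex.re_le_norm z).trans hzR.le
    have h2 : |z.im| ≤ R := (Complex.abs_im_le_norm z).trans hzR.le
    rw [hFn, div_eq_mul_inv, ← norm_inv]
    refine le_trans (mul_le_mul (hbd _ ?_ ?_ ?_) (hinv _ ?_ ?_) (norm_nonneg _) ?_) hBM
    · rw [Complex.sub_re, hre, Complex.conj_re]; linarith
    · rw [Complex.sub_re, hre, Complex.conj_re]; linarith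
    · rw [Complex.sub_im, him, Complex.conj_im]; simpa using h2
    · rw [Complex.add_re, hre]; linarith
    · rw [Complex.add_re, hre]; linarith
    · exact (norm_nonneg _).trans (hbd s₀ (by rw [hre]; linarith) (by rw [hre])
        (by rw [him]; simpa using hR.le))
  have e1 (u : ℝ) : ((σ₀ - u : ℝ) : ℂ) + t * Complex.I = s₀ - u := by rw [hs₀]; push_cast; ring
  have e2 (u : ℝ) : ((σ₀ + u : ℝ) : ℂ) + t * Complex.I = s₀ + u := by rw [hs₀]; push_cast; ring
  simp only [e1, e2]
  have hFx (u : ℝ) : ‖F u‖ = ‖riemannZeta (s₀ - u)‖ / ‖riemannZeta (s₀ + u)‖ := by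
    rw [hFn, Complex.conj_ofReal]
  have hpos (u : ℝ) (hu : 0 < u) : 0 < ‖riemannZeta (s₀ + u)‖ :=
    norm_pos_iff.2 (hne u (by rw [Complex.ofReal_re]; linarith))
  refine ⟨fun hxR => ?_, fun a k hxa haR hk => ?_⟩
  · have := norm_le_exp_of_halfDisc hR hM hsub hFd hdiam harc hx hxR
    rwa [hFx, div_le_iff₀ (hpos x hx)] at this
  · have ha : 0 < a := hx.trans hxa
    have := norm_le_of_halfDisc hR hM hU hsub hFd hdiam harc hx hxa haR
    rw [hFx x, div_le_iff₀ (hpos x hx)] at this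
    refine this.trans (mul_le_mul_of_nonneg_right (mul_le_mul_of_nonneg_left ?_
      (Real.exp_pos _).le) (norm_nonneg _))
    have hFa : ‖F a‖ ≤ k := by rwa [hFx, div_le_iff₀ (hpos a ha)]
    have hq : 0 ≤ (1 + 3 * a / R) * ((a - x) / (a + x)) :=
      mul_nonneg (by positivity) (div_nonneg (by linarith) (by linarith))
    rw [mul_assoc, mul_assoc]
    have := mul_le_mul_of_nonneg_right (add_le_add_right hFa 1) hq
    linarith

lemma exp_le_of_le_small {u : ℝ} (hu : u ≤ 1 / 50000) : Real.exp u ≤ 1.0001 := by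
  have h1 := Real.add_one_le_exp (-u)
  have h2 : Real.exp u * Real.exp (-u) = 1 := by rw [← Real.exp_add]; simp
  nlinarith [Real.exp_pos u]

/-- A lower bound for zeta to the left of `Re s = 1`, given an upper bound on a larger region. -/
lemma norm_riemannZeta_ge_of_bound {ε t R B B' M δ : ℝ} (hε : 0 < ε) (hRt : R < t)
    (hM : 0 ≤ M) (hεR : 10 ^ 6 * ε ≤ R) (hMR : 10 ^ 6 * M * ε ≤ R)
    (hbd : ∀ s : ℂ, 1 - R ≤ s.re → s.re ≤ 1 + 30 * ε → |s.im - t| ≤ R ∨ |s.im - 2 * t| ≤ R →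
      ‖riemannZeta s‖ ≤ B)
    (hinv : ∀ s : ℂ, 1 + 30 * ε ≤ s.re → s.re ≤ 1 + 30 * ε + R → ‖(riemannZeta s)⁻¹‖ ≤ B')
    (hBM : B * B' ≤ Real.exp M)
    (hδ : ∀ u : ℝ, 0 < u → u ≤ δ →
      ‖riemannZeta ((1 + u : ℝ) : ℂ)‖ ≤ 2.02 * ‖riemannZeta ((1 + 2 * u : ℝ) : ℂ)‖)
    (hεδ : 20 * ε ≤ δ) {a : ℝ} (ha : 10 * ε < a) (ha' : a ≤ 31 * ε) :
    1 / 100 * ‖riemannZeta ((1 + 30 * ε + a : ℝ) + t * Complex.I)‖ ≤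
      ‖riemannZeta ((1 + 30 * ε - a : ℝ) + t * Complex.I)‖ := by
  have hR : 0 < R := by linarith
  by_contra! hcon
  obtain ⟨-, h1⟩ := riemannZeta_halfDisc (σ₀ := 1 + 30 * ε) (by linarith) hR hRt hM
    (fun s h1 h2 h3 => hbd s (by linarith) h2 (Or.inl h3)) hinv hBM (x := 10 * ε) (by linarith)
  have h1 := h1 a (1 / 100) ha (by linarith) hcon.le
  have h2 := (riemannZeta_halfDisc (σ₀ := 1 + 30 * ε) (t := 2 * t) (by linarith) hR (by linarith) hM
    (fun s h1 h2 h3 => hbd s (by linarith) h2 (Or.inr h3)) hinv hBM (x := 10 * ε)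
    (by linarith)).1 (by linarith)
  have h3 := one_le_riemannZeta_ratio (σ₁ := 1 + 20 * ε) (σ₂ := 1 + 40 * ε) t (by linarith)
    (by linarith)
  have h4 := hδ (20 * ε) (by linarith) hεδ
  have hexp : Real.exp (2 * M * (10 * ε) / R) ≤ 1.0001 := by
    refine exp_le_of_le_small ?_
    rw [div_le_iff₀ hR]
    linarith
  rw [show 1 + 30 * ε - 10 * ε = 1 + 20 * ε by ring, show 1 + 30 * ε + 10 * ε = 1 + 40 * ε by ring]
    at h1 h2
  rw [show 1 + 2 * (20 * ε) = 1 + 40 * ε by ring] at h4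
  have hq : (a - 10 * ε) / (a + 10 * ε) ≤ 21 / 41 := by
    rw [div_le_div_iff₀ (by linarith) (by norm_num)]; linarith
  have hq0 : 0 ≤ (a - 10 * ε) / (a + 10 * ε) := div_nonneg (by linarith) (by linarith)
  have hq1 : 1 + 3 * a / R ≤ 1.0001 := by
    have : 3 * a / R ≤ 0.0001 := by rw [div_le_iff₀ hR]; linarith
    linarith
  have hq2 : 0 ≤ 3 * a / R := div_nonneg (by linarith) hR.le
  have hp : Real.exp (2 * M * (10 * ε) / R) * (1 / 100 + (1 + 1 / 100) * (1 + 3 * a / R) *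
      ((a - 10 * ε) / (a + 10 * ε))) ≤ 0.53 := by
    have : Real.exp (2 * M * (10 * ε) / R) * (1 / 100 + (1 + 1 / 100) * (1 + 3 * a / R) *
        ((a - 10 * ε) / (a + 10 * ε))) ≤ 1.0001 * (1 / 100 + (1 + 1 / 100) * 1.0001 * (21 / 41)) := by
      gcongr
    exact this.trans (by norm_num)
  set Z₁ := ‖riemannZeta ((1 + 20 * ε : ℝ) : ℂ)‖
  set Z₂ := ‖riemannZeta ((1 + 40 * ε : ℝ) : ℂ)‖
  set A₁ := ‖riemannZeta ((1 + 20 * ε : ℝ) + t * Complex.I)‖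
  set A₂ := ‖riemannZeta ((1 + 40 * ε : ℝ) + t * Complex.I)‖
  set B₁ := ‖riemannZeta ((1 + 20 * ε : ℝ) + (2 * t : ℝ) * Complex.I)‖
  set B₂ := ‖riemannZeta ((1 + 40 * ε : ℝ) + (2 * t : ℝ) * Complex.I)‖
  have hZ : 0 < Z₂ := norm_pos_iff.2 (riemannZeta_ne_zero_of_one_lt_re (by simp; linarith))
  have hA : 0 < A₂ := norm_pos_iff.2 (riemannZeta_ne_zero_of_one_lt_re (by simp; linarith))
  have hB : 0 < B₂ := norm_pos_iff.2 (riemannZeta_ne_zero_of_one_lt_re (by simp; linarith))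
  have hA1 : A₁ ≤ 0.53 * A₂ := h1.trans (mul_le_mul_of_nonneg_right hp hA.le)
  have hB1 : B₁ ≤ 1.0001 * B₂ := h2.trans (mul_le_mul_of_nonneg_right hexp hB.le)
  have h5 : Z₁ ^ 3 * A₁ ^ 4 * B₁ ≤ (2.02 * Z₂) ^ 3 * (0.53 * A₂) ^ 4 * (1.0001 * B₂) := by
    have : 0 ≤ Z₁ := norm_nonneg _
    have : 0 ≤ A₁ := norm_nonneg _
    have : 0 ≤ B₁ := norm_nonneg _
    gcongr
  have h6 : 0 < Z₂ ^ 3 * A₂ ^ 4 * B₂ := by positivity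
  have h7 : (2.02 * Z₂) ^ 3 * (0.53 * A₂) ^ 4 * (1.0001 * B₂) =
    (2.02 ^ 3 * 0.53 ^ 4 * 1.0001) * (Z₂ ^ 3 * A₂ ^ 4 * B₂) := by ring
  norm_num at h7
  linarith

end ZetaInverse

section ZeroFree

lemma tendsto_log_div_rpow_atTop :
    Tendsto (fun T : ℝ => (Real.log T / (4 * T)) ^ (2 / 3 : ℝ)) atTop (nhds 0) := by
  have h1 : Tendsto (fun T : ℝ => Real.log T / (4 * T)) atTop (nhds 0) := by
    have := (Real.isLittleO_log_id_atTop.tendsto_div_nhds_zero).const_mul (1 / 4)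
    simp only [id, mul_zero] at this
    refine this.congr fun T => ?_
    rw [div_mul_div_comm, one_mul]
  have := h1.rpow_const (p := 2 / 3) (Or.inr (by norm_num))
  rwa [Real.zero_rpow (by norm_num)] at this

lemma zeroFree_width_le {c T l : ℝ} (hc : 0 ≤ c) (hT : 0 < T) (hl : 0 < l) :
    c / 4 / (T ^ (2 / 3 : ℝ) * l ^ (1 / 3 : ℝ)) ≤ c * (l / (4 * T)) ^ (2 / 3 : ℝ) / l := by
  have h1 : l ^ (2 / 3 : ℝ) * l ^ (1 / 3 : ℝ) = l := by
    rw [← Real.rpow_add hl]; norm_num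
  have h4 : (4 : ℝ) ^ (2 / 3 : ℝ) ≤ 4 := by
    calc (4 : ℝ) ^ (2 / 3 : ℝ) ≤ 4 ^ (1 : ℝ) :=
          Real.rpow_le_rpow_of_exponent_le (by norm_num) (by norm_num)
      _ = 4 := by norm_num
  rw [Real.div_rpow hl.le (by positivity), Real.mul_rpow (by norm_num) hT.le]
  have hl3 : 0 < l ^ (1 / 3 : ℝ) := by positivity
  have hl2 : 0 < l ^ (2 / 3 : ℝ) := by positivity
  have hT2 : 0 < T ^ (2 / 3 : ℝ) := by positivity
  have h4' : 0 < (4 : ℝ) ^ (2 / 3 : ℝ) := by positivity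
  calc c / 4 / (T ^ (2 / 3 : ℝ) * l ^ (1 / 3 : ℝ))
      ≤ c / 4 ^ (2 / 3 : ℝ) / (T ^ (2 / 3 : ℝ) * l ^ (1 / 3 : ℝ)) := by gcongr
    _ = c * (l ^ (2 / 3 : ℝ) / (4 ^ (2 / 3 : ℝ) * T ^ (2 / 3 : ℝ))) /
        (l ^ (2 / 3 : ℝ) * l ^ (1 / 3 : ℝ)) := by field_simp
    _ = _ := by rw [h1]

lemma log_mem_of_near {t τ R : ℝ} (ht : 16 ≤ t) (hR : R ≤ 1)
    (h : |τ - t| ≤ R ∨ |τ - 2 * t| ≤ R) :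
    3 ≤ τ ∧ Real.log t / 2 ≤ Real.log τ ∧ Real.log τ ≤ 2 * Real.log t := by
  have h1 : t - 1 ≤ τ ∧ τ ≤ 2 * t + 1 := by
    rcases h with h | h <;> obtain ⟨h1, h2⟩ := abs_le.1 h <;> constructor <;> linarith
  refine ⟨by linarith, ?_, ?_⟩
  · have h2 : Real.sqrt t ≤ τ := by
      rw [Real.sqrt_le_left (by linarith)]
      nlinarith
    rw [← Real.log_sqrt (by linarith)]
    exact Real.log_le_log (Real.sqrt_pos.2 (by linarith)) h2
  · have h3 : 2 * Real.log t = Real.log (t ^ 2) := by rw [Real.log_pow]; norm_num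
    rw [h3]
    exact Real.log_le_log (by linarith) (by nlinarith)

/-- The Vinogradov–Korobov zero-free region, with a bound for `1 / ζ`, for large height. -/
theorem exists_norm_inv_riemannZeta_le_of_large : ∃ c C t₀ : ℝ, 0 < c ∧ 0 < C ∧ 16 ≤ t₀ ∧
    ∀ s : ℂ, t₀ ≤ s.im → 1 - c / (Real.log s.im ^ (2 / 3 : ℝ) *
      Real.log (Real.log s.im) ^ (1 / 3 : ℝ)) ≤ s.re → s.re ≤ 2 →
      riemannZeta s ≠ 0 ∧ ‖(riemannZeta s)⁻¹‖ ≤ C * Real.log s.im := by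
  obtain ⟨A, C₁, hC₁, hζ⟩ : ∃ A : ℕ, ∃ C : ℝ, 0 < C ∧ ∀ (η : ℝ) (s : ℂ), 3 ≤ s.im → 0 ≤ η →
    η ≤ 1 / 10 → η ^ 3 * (Real.log s.im) ^ 2 ≤ (Real.log (Real.log s.im)) ^ 2 →
    1 - η ≤ s.re → s.re ≤ 3 → ‖riemannZeta s‖ ≤ C * Real.log s.im ^ A :=
    ⟨10001, norm_riemannZeta_le⟩
  obtain ⟨C₂, hC₂, hreal⟩ := exists_norm_riemannZeta_real_le
  obtain ⟨δ, hδ, hratio⟩ := exists_riemannZeta_real_ratio_le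
  have hC₂0 : 0 < C₂ := by linarith
  set c : ℝ := 1 / (10 ^ 6 * (A + 2)) with hc
  have hc0 : 0 < c := by positivity
  have hcA : 10 ^ 6 * (A + 2) * c = 1 := by rw [hc]; field_simp
  have hc1 : 10 ^ 6 * c ≤ 1 := by
    have : (0 : ℝ) ≤ A := Nat.cast_nonneg A
    nlinarith
  have hev : ∀ᶠ T : ℝ in atTop, 2 ≤ Real.log T ∧
      (Real.log T / (4 * T)) ^ (2 / 3 : ℝ) ≤ min (1 / 10) δ ∧ C₁ * 2 ^ A * C₂ / c ≤ T := by
    filter_upwards [Real.tendsto_log_atTop.eventually_ge_atTop 2,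
      (tendsto_log_div_rpow_atTop.eventually_lt_const (lt_min (by norm_num : (0 : ℝ) < 1 / 10) hδ)),
      eventually_ge_atTop (C₁ * 2 ^ A * C₂ / c)] with T h1 h2 h3
    exact ⟨h1, h2.le, h3⟩
  have hev' := Real.tendsto_log_atTop.eventually hev
  obtain ⟨t₁, ht₁⟩ := eventually_atTop.1 hev'
  refine ⟨c / 4, 16 * C₂ / c, max 16 t₁, by positivity, by positivity, le_max_left _ _,
    fun s hs hre hre2 => ?_⟩
  set t := s.im with ht
  set T := Real.log t with hT
  set l := Real.log T with hl
  obtain ⟨hl2, hη, hTC⟩ := ht₁ t ((le_max_right _ _).trans hs)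
  have ht16 : 16 ≤ t := (le_max_left _ _).trans hs
  have hT1 : 1 ≤ T := by
    rw [hT, Real.le_log_iff_exp_le (by linarith)]
    linarith [Real.exp_one_lt_d9]
  have hT0 : 0 < T := by linarith
  set η := (l / (4 * T)) ^ (2 / 3 : ℝ) with hηdef
  have hη1 : η ≤ 1 / 10 := hη.trans (min_le_left _ _)
  have hηδ : η ≤ δ := hη.trans (min_le_right _ _)
  have hl0 : 0 < l := by linarith
  have hη0 : 0 < η := by positivity
  have hlT : l / (4 * T) ≤ 1 := by
    rw [div_le_one (by positivity)]
    have := Real.log_le_sub_one_of_pos hT0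
    linarith
  have hηlow : l / (4 * T) ≤ η := by
    calc l / (4 * T) = (l / (4 * T)) ^ (1 : ℝ) := (Real.rpow_one _).symm
      _ ≤ _ := Real.rpow_le_rpow_of_exponent_ge (by positivity) hlT (by norm_num)
  have hη3 : η ^ 3 = (l / (4 * T)) ^ 2 := by
    rw [hηdef, ← Real.rpow_natCast, ← Real.rpow_mul (by positivity), ← Real.rpow_natCast]
    norm_num
  set ε := c * η / l with hε
  have hε0 : 0 < ε := by positivity
  have hεinv : 1 / ε ≤ 4 * T / c := by
    rw [hε, one_div_div, div_le_div_iff₀ (by positivity) hc0]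
    rw [div_le_iff₀ (by positivity)] at hηlow
    nlinarith
  have hεη : 10 ^ 6 * ε ≤ η := by
    rw [hε, ← mul_div_assoc, div_le_iff₀ hl0]
    nlinarith
  have hεre : 1 - ε ≤ s.re := by
    have := zeroFree_width_le hc0.le hT0 hl0
    rw [← hηdef] at this
    linarith
  have hinv : ∀ s : ℂ, 1 < s.re → s.re ≤ 3 → ‖(riemannZeta s)⁻¹‖ ≤ C₂ / (s.re - 1) :=
    fun s h1 h3 => (norm_inv_riemannZeta_le h1).trans (hreal _ h1 h3)
  have hfin : C₂ / (ε / 4) ≤ 16 * C₂ / c * T := by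
    calc C₂ / (ε / 4) = 4 * C₂ * (1 / ε) := by field_simp
      _ ≤ 4 * C₂ * (4 * T / c) := by gcongr
      _ = _ := by ring
  rcases le_or_gt (1 + 20 * ε) s.re with hcase | hcase
  · refine ⟨riemannZeta_ne_zero_of_one_lt_re (by linarith), ?_⟩
    refine (hinv s (by linarith) (by linarith)).trans (le_trans ?_ hfin)
    exact div_le_div_of_nonneg_left hC₂0.le (by positivity) (by linarith)
  · have hkey := norm_riemannZeta_ge_of_bound (ε := ε) (t := t) (R := η) (B := C₁ * (2 * T) ^ A)
      (B' := C₂ / (30 * ε)) (M := (A + 2 : ℕ) * l) (δ := δ) hε0 (by linarith) (by positivity)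
      hεη (by
        rw [hε]
        have : 10 ^ 6 * ((A + 2 : ℕ) * l) * (c * η / l) = (10 ^ 6 * (A + 2) * c) * η := by
          push_cast; field_simp
        rw [this, hcA, one_mul])
      (fun w h1 h2 h3 => by
        obtain ⟨hw3, hwl, hwu⟩ := log_mem_of_near ht16 (by linarith) h3
        rw [← hT] at hwl hwu
        have hw0 : 0 ≤ Real.log w.im := by linarith
        refine (hζ η w hw3 hη0.le hη1 ?_ h1 (by linarith)).trans
          (mul_le_mul_of_nonneg_left (pow_le_pow_left₀ hw0 hwu A) hC₁.le)
        have e1 : l / 2 ≤ Real.log (Real.log w.im) := by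
          calc l / 2 ≤ Real.log (T / 2) := by
                rw [Real.log_div hT0.ne' (by norm_num), ← hl]
                linarith [Real.log_two_lt_d9]
            _ ≤ _ := Real.log_le_log (by positivity) hwl
        calc η ^ 3 * Real.log w.im ^ 2 ≤ η ^ 3 * (2 * T) ^ 2 := by gcongr
          _ = (l / 2) ^ 2 := by rw [hη3]; field_simp; norm_num
          _ ≤ _ := pow_le_pow_left₀ (by positivity) e1 2)
      (fun w h1 h2 => (hinv w (by linarith) (by linarith)).trans
        (div_le_div_of_nonneg_left hC₂0.le (by positivity) (by linarith)))
      (by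
        rw [← Real.log_rpow hT0, Real.exp_log (by positivity), Real.rpow_natCast]
        rw [div_le_iff₀ hc0] at hTC
        have e1 : C₂ / (30 * ε) ≤ C₂ * (T / c) := by
          calc C₂ / (30 * ε) = C₂ * (1 / ε / 30) := by field_simp
            _ ≤ C₂ * (4 * T / c / 30) := by gcongr
            _ ≤ C₂ * (T / c) := by
              refine mul_le_mul_of_nonneg_left ?_ hC₂0.le
              have : 0 ≤ T / c := by positivity
              rw [mul_div_assoc]; linarith
        calc C₁ * (2 * T) ^ A * (C₂ / (30 * ε)) ≤ C₁ * (2 * T) ^ A * (C₂ * (T / c)) := by gcongr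
          _ = (C₁ * 2 ^ A * C₂ / c) * (T ^ A * T) := by rw [mul_pow]; ring
          _ ≤ T * (T ^ A * T) := by
            refine mul_le_mul_of_nonneg_right ?_ (by positivity)
            rwa [div_le_iff₀ hc0]
          _ = _ := by ring)
      hratio (by linarith) (a := 1 + 30 * ε - s.re) (by linarith) (by linarith)
    rw [sub_sub_cancel, show ((s.re : ℝ) : ℂ) + t * Complex.I = s from Complex.re_add_im s] at hkey
    set w : ℂ := ((1 + 30 * ε + (1 + 30 * ε - s.re) : ℝ) : ℂ) + t * Complex.I with hw
    have hwre : w.re = 1 + 30 * ε + (1 + 30 * ε - s.re) := by simp [hw]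
    have hwi := hinv w (by rw [hwre]; linarith) (by rw [hwre]; linarith)
    have hw0 : 0 < ‖riemannZeta w‖ :=
      norm_pos_iff.2 (riemannZeta_ne_zero_of_one_lt_re (by rw [hwre]; linarith))
    have hwlow : 30 * ε / C₂ ≤ ‖riemannZeta w‖ := by
      rw [norm_inv, inv_le_comm₀ hw0 (div_pos hC₂0 (by rw [hwre]; linarith)), inv_div] at hwi
      refine le_trans ?_ hwi
      exact div_le_div_of_nonneg_right (by rw [hwre]; linarith) hC₂0.le
    have hs0 : ε / 4 / C₂ ≤ ‖riemannZeta s‖ := by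
      have : ε / 4 / C₂ ≤ 1 / 100 * (30 * ε / C₂) := by
        have : 0 < ε / C₂ := by positivity
        have e1 : ε / 4 / C₂ = 1 / 4 * (ε / C₂) := by ring
        have e2 : 1 / 100 * (30 * ε / C₂) = 3 / 10 * (ε / C₂) := by ring
        rw [e1, e2]; linarith
      linarith
    have hs1 : 0 < ε / 4 / C₂ := by positivity
    refine ⟨norm_pos_iff.1 (hs1.trans_le hs0), ?_⟩
    rw [norm_inv]
    calc ‖riemannZeta s‖⁻¹ ≤ (ε / 4 / C₂)⁻¹ := inv_anti₀ hs1 hs0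
      _ = C₂ / (ε / 4) := by rw [inv_div]
      _ ≤ _ := hfin

end ZeroFree

section InverseZeta

lemma riemannZeta₁_ne_zero_of_one_le_re {s : ℂ} (hs : 1 ≤ s.re) : riemannZeta₁ s ≠ 0 := by
  rcases eq_or_ne s 1 with rfl | h
  · rw [riemannZeta₁_one]; exact one_ne_zero
  · have := riemannZeta_ne_zero_of_one_le_re hs
    rw [riemannZeta_eq_inv_sub_mul h] at this
    exact right_ne_zero_of_mul this

lemma exists_norm_div_riemannZeta₁_le_of_small (t₀ : ℝ) : ∃ δ C : ℝ, 0 < δ ∧ 0 < C ∧ ∀ s : ℂ,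
    |s.im| ≤ t₀ → 1 - δ ≤ s.re → s.re ≤ 2 →
      riemannZeta₁ s ≠ 0 ∧ ‖(s - 1) / riemannZeta₁ s‖ ≤ C := by
  have hcont := differentiable_riemannZeta₁.continuous
  have hK : IsCompact (Set.Icc (1 : ℝ) 2 ×ℂ Set.Icc (-t₀) t₀) := isCompact_Icc.reProdIm isCompact_Icc
  have hU : IsOpen {s : ℂ | riemannZeta₁ s ≠ 0} := isOpen_ne_fun hcont continuous_const
  obtain ⟨δ, hδ, hsub⟩ := hK.exists_cthickening_subset_open hU
    (fun s hs => riemannZeta₁_ne_zero_of_one_le_re hs.1.1)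
  obtain ⟨C, hC⟩ := (hK.cthickening (r := δ)).exists_bound_of_continuousOn
    (f := fun s => (s - 1) / riemannZeta₁ s)
    (ContinuousOn.div (by fun_prop) hcont.continuousOn (fun s hs => hsub hs))
  refine ⟨δ, max C 1, hδ, by positivity, fun s h1 h2 h3 => ?_⟩
  have hmem : s ∈ Metric.cthickening δ (Set.Icc (1 : ℝ) 2 ×ℂ Set.Icc (-t₀) t₀) := by
    refine Metric.mem_cthickening_of_dist_le s ((max 1 s.re : ℝ) + s.im * Complex.I) δ _ ?_ ?_
    · rw [Complex.mem_reProdIm]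
      simp only [Complex.add_re, Complex.ofReal_re, Complex.mul_re, Complex.I_re, Complex.ofReal_im,
        Complex.I_im, Complex.add_im, Complex.mul_im]
      norm_num
      exact ⟨h3, abs_le.1 h1⟩
    · rw [dist_eq_norm]
      have : s - ((max 1 s.re : ℝ) + s.im * Complex.I) = ((s.re - max 1 s.re : ℝ) : ℂ) := by
        apply Complex.ext <;> simp
      rw [this, Complex.norm_real, Real.norm_of_nonpos (by linarith [le_max_right 1 s.re])]
      rcases max_cases 1 s.re with ⟨h, _⟩ | ⟨h, _⟩ <;> rw [h] <;> linarith
  exact ⟨hsub hmem, (hC s hmem).trans (le_max_left _ _)⟩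

lemma div_riemannZeta₁_eq_inv {s : ℂ} (hs : s ≠ 1) :
    (s - 1) / riemannZeta₁ s = (riemannZeta s)⁻¹ := by
  rw [riemannZeta_eq_inv_sub_mul hs, mul_inv, inv_inv, div_eq_mul_inv]

/-- The bound for `1 / ζ` in the Vinogradov–Korobov region. -/
theorem exists_norm_div_riemannZeta₁_le : ∃ c C : ℝ, 0 < c ∧ 0 < C ∧ ∀ (T : ℝ) (s : ℂ), 16 ≤ T →
    |s.im| ≤ T → 1 - c / (Real.log T ^ (2 / 3 : ℝ) * Real.log (Real.log T) ^ (1 / 3 : ℝ)) ≤ s.re →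
    s.re ≤ 2 → riemannZeta₁ s ≠ 0 ∧ ‖(s - 1) / riemannZeta₁ s‖ ≤ C * Real.log T := by
  obtain ⟨c, C, t₀, hc, hC, ht₀, h⟩ := exists_norm_inv_riemannZeta_le_of_large
  obtain ⟨δ, C', hδ, hC', h'⟩ := exists_norm_div_riemannZeta₁_le_of_small t₀
  have hlog {T : ℝ} (hT : 16 ≤ T) : Real.exp 1 ≤ Real.log T := by
    have h1 : Real.log 16 = 4 * Real.log 2 := by
      rw [show (16 : ℝ) = 2 ^ 4 by norm_num, Real.log_pow]; norm_num
    have h2 := Real.log_le_log (by norm_num) hT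
    linarith [Real.log_two_gt_d9, Real.exp_one_lt_d9]
  have hlog1 {T : ℝ} (hT : 16 ≤ T) : 1 ≤ Real.log T :=
    (Real.one_le_exp (by norm_num)).trans (hlog hT)
  have hloglog {T : ℝ} (hT : 16 ≤ T) : 1 ≤ Real.log (Real.log T) := by
    rw [Real.le_log_iff_exp_le (by linarith [hlog1 hT])]
    exact hlog hT
  have hlarge : ∀ (T : ℝ) (s : ℂ), 16 ≤ T → t₀ ≤ s.im → s.im ≤ T →
      1 - c / (Real.log T ^ (2 / 3 : ℝ) * Real.log (Real.log T) ^ (1 / 3 : ℝ)) ≤ s.re →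
      s.re ≤ 2 → riemannZeta s ≠ 0 ∧ ‖(riemannZeta s)⁻¹‖ ≤ C * Real.log T := by
    intro T s hT h1 h2 h3 h4
    have hs16 := ht₀.trans h1
    have e1 : Real.log s.im ≤ Real.log T := Real.log_le_log (by linarith) h2
    have e2 := hlog1 hs16
    have e3 := hloglog hs16
    have e4 : Real.log (Real.log s.im) ≤ Real.log (Real.log T) := Real.log_le_log (by linarith) e1
    have e5 : Real.log s.im ^ (2 / 3 : ℝ) * Real.log (Real.log s.im) ^ (1 / 3 : ℝ) ≤
        Real.log T ^ (2 / 3 : ℝ) * Real.log (Real.log T) ^ (1 / 3 : ℝ) :=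
      mul_le_mul (Real.rpow_le_rpow (by linarith) e1 (by norm_num))
        (Real.rpow_le_rpow (by linarith) e4 (by norm_num)) (Real.rpow_nonneg (by linarith) _)
        (Real.rpow_nonneg (by linarith) _)
    obtain ⟨r1, r2⟩ := h s h1 (le_trans (sub_le_sub_left
      (div_le_div_of_nonneg_left hc.le (mul_pos (Real.rpow_pos_of_pos (by linarith) _)
        (Real.rpow_pos_of_pos (by linarith) _)) e5) 1) h3) h4
    exact ⟨r1, r2.trans (mul_le_mul_of_nonneg_left e1 hC.le)⟩
  refine ⟨min c δ, C + C', lt_min hc hδ, by positivity, fun T s hT h1 h2 h3 => ?_⟩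
  have hT1 := hlog1 hT
  have hT2 := hloglog hT
  have hden : 1 ≤ Real.log T ^ (2 / 3 : ℝ) * Real.log (Real.log T) ^ (1 / 3 : ℝ) :=
    one_le_mul_of_one_le_of_one_le (Real.one_le_rpow hT1 (by norm_num))
      (Real.one_le_rpow hT2 (by norm_num))
  rcases le_or_gt |s.im| t₀ with hsm | hsm
  · have e : min c δ / (Real.log T ^ (2 / 3 : ℝ) * Real.log (Real.log T) ^ (1 / 3 : ℝ)) ≤ δ :=
      (div_le_self (lt_min hc hδ).le hden).trans (min_le_right _ _)
    obtain ⟨r1, r2⟩ := h' s hsm (by linarith) h3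
    refine ⟨r1, r2.trans ?_⟩
    nlinarith
  · have h2' : 1 - c / (Real.log T ^ (2 / 3 : ℝ) * Real.log (Real.log T) ^ (1 / 3 : ℝ)) ≤ s.re := by
      refine le_trans (sub_le_sub_left ?_ 1) h2
      exact div_le_div_of_nonneg_right (min_le_left _ _) (by linarith)
    have hne : s ≠ 1 := fun h => by rw [h] at hsm; simp at hsm; linarith
    have hζ : riemannZeta s ≠ 0 ∧ ‖(riemannZeta s)⁻¹‖ ≤ C * Real.log T := by
      rcases le_or_gt 0 s.im with hs | hs
      · rw [abs_of_nonneg hs] at hsm h1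
        exact hlarge T s hT hsm.le h1 h2' h3
      · rw [abs_of_neg hs] at hsm h1
        obtain ⟨r1, r2⟩ := hlarge T ((starRingEnd ℂ) s) hT (by simpa using hsm.le) (by simpa using h1)
          (by simpa using h2') (by simpa using h3)
        rw [riemannZeta_conj] at r1 r2
        refine ⟨fun h => r1 (by rw [h, map_zero]), ?_⟩
        rwa [← map_inv₀, RCLike.norm_conj] at r2
    rw [div_riemannZeta₁_eq_inv hne]
    refine ⟨fun h => hζ.1 (by rw [riemannZeta_eq_inv_sub_mul hne, h, mul_zero]), ?_⟩
    refine hζ.2.trans (mul_le_mul_of_nonneg_right (by linarith) (by linarith))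

end InverseZeta

section Perron

lemma hasMellin_one_sub_pos_part {s : ℂ} (hs : 0 < s.re) :
    HasMellin (fun t : ℝ => ((max 0 (1 - t) : ℝ) : ℂ)) s (1 / (s * (s + 1))) := by
  have h1 := hasMellin_one_Ioc hs
  have h2 := hasMellin_cpow_Ioc 1 (s := s) (by simp; linarith)
  have h3 := hasMellin_sub h1.1 h2.1
  rw [h1.2, h2.2] at h3
  have hs0 : s ≠ 0 := fun h => by simp [h] at hs
  have hs1 : s + 1 ≠ 0 := fun h => by
    have := congrArg Complex.re h
    simp at this; linarith
  have e : 1 / s - 1 / (s + 1) = 1 / (s * (s + 1)) := by field_simp; ring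
  rw [e] at h3
  have hEq : Set.EqOn
      (fun t : ℝ => (t : ℂ) ^ (s - 1) • ((Set.Ioc (0 : ℝ) 1).indicator (fun _ => (1 : ℂ)) t -
        (Set.Ioc (0 : ℝ) 1).indicator (fun t : ℝ => (t : ℂ) ^ (1 : ℂ)) t))
      (fun t : ℝ => (t : ℂ) ^ (s - 1) • ((max 0 (1 - t) : ℝ) : ℂ)) (Set.Ioi 0) := by
    intro t ht
    have ht : 0 < t := ht
    dsimp only
    congr 1
    by_cases h : t ≤ 1
    · have hm : t ∈ Set.Ioc (0 : ℝ) 1 := ⟨ht, h⟩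
      rw [Set.indicator_of_mem hm, Set.indicator_of_mem hm, max_eq_right (by linarith)]
      simp
    · have hm : t ∉ Set.Ioc (0 : ℝ) 1 := fun h' => h h'.2
      rw [Set.indicator_of_notMem hm, Set.indicator_of_notMem hm,
        max_eq_left (by linarith)]
      simp
  refine ⟨IntegrableOn.congr_fun h3.1 hEq measurableSet_Ioi, ?_⟩
  rw [← h3.2]
  exact (setIntegral_congr_fun measurableSet_Ioi hEq).symm

lemma norm_vertical_ge {σ y : ℝ} (hσ : 0 < σ) :
    min (σ ^ 2) 1 * (1 + y ^ 2) ≤ ‖((σ : ℂ) + y * Complex.I) * (σ + y * Complex.I + 1)‖ := by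
  have h1 : ‖((σ : ℂ) + y * Complex.I)‖ ^ 2 = σ ^ 2 + y ^ 2 := by
    rw [← Complex.normSq_eq_norm_sq, Complex.normSq_add_mul_I]
  have h2 : ‖((σ : ℂ) + y * Complex.I)‖ ≤ ‖((σ : ℂ) + y * Complex.I + 1)‖ := by
    rw [show (σ : ℂ) + y * Complex.I + 1 = ((σ + 1 : ℝ) : ℂ) + y * Complex.I by push_cast; ring]
    refine abs_le_of_sq_le_sq' ?_ (norm_nonneg _) |>.2
    rw [h1, ← Complex.normSq_eq_norm_sq, Complex.normSq_add_mul_I]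
    nlinarith
  rw [norm_mul]
  calc min (σ ^ 2) 1 * (1 + y ^ 2) ≤ σ ^ 2 + y ^ 2 := by
        nlinarith [min_le_left (σ ^ 2) 1, min_le_right (σ ^ 2) 1, sq_nonneg y]
    _ = ‖((σ : ℂ) + y * Complex.I)‖ * ‖((σ : ℂ) + y * Complex.I)‖ := by rw [← h1]; ring
    _ ≤ _ := by gcongr

lemma vertical_ne_zero {σ : ℝ} (hσ : 0 < σ) (y : ℝ) :
    ((σ : ℂ) + y * Complex.I) * (σ + y * Complex.I + 1) ≠ 0 := by
  rw [← norm_pos_iff]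
  refine lt_of_lt_of_le ?_ (norm_vertical_ge hσ)
  have : 0 < min (σ ^ 2) 1 := lt_min (by positivity) one_pos
  positivity

lemma norm_one_div_vertical_le {σ : ℝ} (hσ : 0 < σ) (y : ℝ) :
    ‖1 / (((σ : ℂ) + y * Complex.I) * (σ + y * Complex.I + 1))‖ ≤
      (min (σ ^ 2) 1)⁻¹ * (1 + y ^ 2)⁻¹ := by
  have : 0 < min (σ ^ 2) 1 := lt_min (by positivity) one_pos
  rw [norm_div, norm_one, one_div, ← mul_inv]
  exact inv_anti₀ (by positivity) (norm_vertical_ge hσ)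

lemma integrable_one_div_vertical {σ : ℝ} (hσ : 0 < σ) :
    Integrable (fun y : ℝ => 1 / (((σ : ℂ) + y * Complex.I) * (σ + y * Complex.I + 1))) := by
  refine Integrable.mono' (integrable_inv_one_add_sq.const_mul (min (σ ^ 2) 1)⁻¹) ?_
    (ae_of_all _ (norm_one_div_vertical_le hσ))
  refine Continuous.aestronglyMeasurable ?_
  exact continuous_const.div (by fun_prop) (vertical_ne_zero hσ)

lemma one_sub_pos_part_eq_integral {σ : ℝ} (hσ : 0 < σ) {u : ℝ} (hu : 0 < u) :
    ((max 0 (1 - u) : ℝ) : ℂ) = 1 / (2 * Real.pi) * ∫ y : ℝ, (u : ℂ) ^ (-((σ : ℂ) + y * Complex.I)) *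
      (1 / (((σ : ℂ) + y * Complex.I) * (σ + y * Complex.I + 1))) := by
  have hm : ∀ y : ℝ, mellin (fun t : ℝ => ((max 0 (1 - t) : ℝ) : ℂ)) ((σ : ℂ) + y * Complex.I) =
      1 / (((σ : ℂ) + y * Complex.I) * (σ + y * Complex.I + 1)) := fun y =>
    (hasMellin_one_sub_pos_part (by simpa using hσ)).2
  have := mellinInv_mellin_eq σ (fun t : ℝ => ((max 0 (1 - t) : ℝ) : ℂ)) hu
    (hasMellin_one_sub_pos_part (by simpa using hσ)).1
    (by
      unfold Complex.VerticalIntegrable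
      simp_rw [hm]
      exact integrable_one_div_vertical hσ)
    (Continuous.continuousAt (by fun_prop))
  rw [← this, mellinInv]
  simp_rw [hm, smul_eq_mul, Complex.real_smul]
  push_cast
  rfl

/-- Perron's formula with the smooth kernel `1 / (s (s + 1))`. -/
theorem sum_moebius_div_mul_eq_integral {σ z : ℝ} (hσ : 0 < σ) (hz : 0 < z) :
    ((∑ n ∈ Icc 1 ⌊z⌋₊, (ArithmeticFunction.moebius n : ℝ) / n * (1 - n / z) : ℝ) : ℂ) =
      1 / (2 * Real.pi) * ∫ y : ℝ, (z : ℂ) ^ ((σ : ℂ) + y * Complex.I) *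
        (riemannZeta (1 + ((σ : ℂ) + y * Complex.I)))⁻¹ *
        (1 / (((σ : ℂ) + y * Complex.I) * (σ + y * Complex.I + 1))) := by
  set k : ℝ → ℂ := fun y => 1 / (((σ : ℂ) + y * Complex.I) * (σ + y * Complex.I + 1)) with hk
  set F : ℕ → ℝ → ℂ := fun n y => (ArithmeticFunction.moebius n : ℂ) / n *
    (((n : ℝ) / z : ℝ) : ℂ) ^ (-((σ : ℂ) + y * Complex.I)) * k y with hF
  have hkint := integrable_one_div_vertical hσ
  have hFint : ∀ n, Integrable (F n) := by
    intro n
    rcases Nat.eq_zero_or_pos n with rfl | hn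
    · simp [hF]
    refine Integrable.bdd_mul (c := ‖(ArithmeticFunction.moebius n : ℂ) / n‖ * ((n : ℝ) / z) ^ (-σ)) hkint ?_ (ae_of_all _ fun y => ?_)
    · refine Continuous.aestronglyMeasurable ?_
      refine continuous_const.mul (Continuous.const_cpow (by fun_prop) (Or.inl ?_))
      have : (n : ℝ) / z ≠ 0 := by positivity
      exact_mod_cast this
    · rw [norm_mul, Complex.norm_cpow_eq_rpow_re_of_pos (by positivity)]
      simp
  have hFnorm : ∀ n y, ‖F n y‖ ≤ z ^ σ * ((n : ℝ) ^ (1 + σ))⁻¹ * ‖k y‖ := by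
    intro n y
    rcases Nat.eq_zero_or_pos n with rfl | hn
    · simp only [hF]; simp
      positivity
    have hn' : (0 : ℝ) < n := by exact_mod_cast hn
    simp only [hF]
    rw [norm_mul, norm_mul, norm_div, Complex.norm_cpow_eq_rpow_re_of_pos (by positivity)]
    refine mul_le_mul_of_nonneg_right ?_ (norm_nonneg _)
    have h1 : ‖(ArithmeticFunction.moebius n : ℂ)‖ ≤ 1 := by
      rw [Complex.norm_intCast]
      exact_mod_cast ArithmeticFunction.abs_moebius_le_one
    have e : (-((σ : ℂ) + y * Complex.I)).re = -σ := by simp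
    rw [e, Real.rpow_neg (by positivity), Real.div_rpow (by positivity) hz.le, Real.rpow_add hn',
      Real.rpow_one, Complex.norm_natCast, inv_div]
    calc ‖(ArithmeticFunction.moebius n : ℂ)‖ / n * (z ^ σ / n ^ σ) ≤ 1 / n * (z ^ σ / n ^ σ) := by
          gcongr
      _ = _ := by field_simp
  have hsum : Summable fun n => ∫ y, ‖F n y‖ := by
    refine Summable.of_nonneg_of_le (f := fun n : ℕ => z ^ σ * ((n : ℝ) ^ (1 + σ))⁻¹ * ∫ y, ‖k y‖)
      (fun n => integral_nonneg fun y => norm_nonneg _) (fun n => ?_)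
      (((Real.summable_nat_rpow_inv.2 (by linarith)).mul_left _).mul_right _)
    rw [← integral_const_mul]
    exact integral_mono (hFint n).norm (hkint.norm.const_mul _) (hFnorm n)
  have hS := hasSum_integral_of_summable_integral_norm hFint hsum
  have hval : ∀ n, ∫ y, F n y = 2 * Real.pi * (if n ∈ Icc 1 ⌊z⌋₊ then
      (((ArithmeticFunction.moebius n : ℝ) / n * (1 - n / z) : ℝ) : ℂ) else 0) := by
    intro n
    rcases Nat.eq_zero_or_pos n with rfl | hn
    · simp [hF]
    have hn' : (0 : ℝ) < n := by exact_mod_cast hn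
    have h0 := one_sub_pos_part_eq_integral hσ (u := n / z) (by positivity)
    have h1 : ∫ y, F n y = (ArithmeticFunction.moebius n : ℂ) / n *
        (2 * Real.pi * ((max 0 (1 - n / z) : ℝ) : ℂ)) := by
      rw [h0, ← mul_assoc (2 * (Real.pi : ℂ)), mul_one_div_cancel, one_mul, ← integral_const_mul]
      · simp only [hF, hk, mul_assoc]
      · simp [Real.pi_ne_zero]
    rw [h1]
    split_ifs with h
    · have : (n : ℝ) ≤ z := (Nat.le_floor_iff hz.le).1 (mem_Icc.1 h).2
      rw [max_eq_right (sub_nonneg.2 ((div_le_one hz).2 this))]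
      push_cast; ring
    · have : z < n := by
        by_contra h'
        exact h (mem_Icc.2 ⟨hn, Nat.le_floor (not_lt.1 h')⟩)
      rw [max_eq_left (sub_nonpos.2 ((one_le_div hz).2 this.le))]
      simp
  simp_rw [hval] at hS
  have heq := hS.tsum_eq
  rw [tsum_eq_sum (s := Icc 1 ⌊z⌋₊) (fun n hn => by rw [if_neg hn, mul_zero])] at heq
  have hintegral : ∀ y : ℝ, ∑' n, F n y = (z : ℂ) ^ ((σ : ℂ) + y * Complex.I) *
        (riemannZeta (1 + ((σ : ℂ) + y * Complex.I)))⁻¹ * k y := by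
    intro y
    have hre : 1 < (1 + ((σ : ℂ) + y * Complex.I)).re := by simpa using hσ
    have h1 := LSeries_one_mul_Lseries_moebius hre
    rw [LSeries_one_eq_riemannZeta hre] at h1
    rw [← eq_inv_of_mul_eq_one_right h1, LSeries, tsum_mul_right]
    rw [← tsum_mul_left]
    congr 2
    ext n
    rcases Nat.eq_zero_or_pos n with rfl | hn
    · simp
    have hn' : (0 : ℝ) < n := by exact_mod_cast hn
    have hnc : (n : ℂ) ≠ 0 := by exact_mod_cast hn.ne'
    have hzc : (z : ℂ) ≠ 0 := by exact_mod_cast hz.ne'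
    rw [LSeries.term_of_ne_zero hn.ne', Complex.ofReal_div,
      Complex.div_cpow_ofReal_nonneg hn'.le hz.le, Complex.cpow_neg, Complex.cpow_neg,
      Complex.ofReal_natCast, Complex.cpow_add 1 _ hnc, Complex.cpow_one]
    have e1 : (z : ℂ) ^ ((σ : ℂ) + y * Complex.I) ≠ 0 := by simp [Complex.cpow_eq_zero_iff, hzc]
    have e2 : (n : ℂ) ^ ((σ : ℂ) + y * Complex.I) ≠ 0 := by simp [Complex.cpow_eq_zero_iff, hnc]
    field_simp
  simp_rw [hintegral] at heq
  rw [← heq, ← mul_sum, ← mul_assoc, one_div_mul_cancel (by simp [Real.pi_ne_zero]), one_mul]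
  push_cast
  refine sum_congr rfl fun n hn => by rw [if_pos hn]

end Perron

section Contour

lemma norm_integral_Ioi_le_of_norm_le_inv_sq {f : ℝ → ℂ} {K a : ℝ} (ha : 0 < a)
    (hf : ∀ y, a < y → ‖f y‖ ≤ K * y ^ (-2 : ℝ)) : ‖∫ y in Set.Ioi a, f y‖ ≤ K / a := by
  have h := integral_Ioi_rpow_of_lt (a := -2) (by norm_num) ha
  have hi : IntegrableOn (fun y : ℝ => K * y ^ (-2 : ℝ)) (Set.Ioi a) :=
    (integrableOn_Ioi_rpow_of_lt (by norm_num) ha).const_mul K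
  refine (norm_integral_le_of_norm_le hi
    ((ae_restrict_mem measurableSet_Ioi).mono fun y hy => hf y hy)).trans (le_of_eq ?_)
  rw [integral_const_mul, h]
  norm_num
  rw [Real.rpow_neg_one]; rfl

lemma norm_integral_le_add_of_norm_le_inv_sq {f : ℝ → ℂ} {K a : ℝ} (ha : 0 < a)
    (hfi : Integrable f) (hf : ∀ y, a < |y| → ‖f y‖ ≤ K * |y| ^ (-2 : ℝ)) :
    ‖∫ y, f y‖ ≤ ‖∫ y in (-a)..a, f y‖ + 2 * (K / a) := by
  have e1 := intervalIntegral.integral_Iic_add_Ioi (f := f) (b := a) hfi.integrableOn hfi.integrableOn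
  have e2 := intervalIntegral.integral_Iic_sub_Iic (f := f) (a := -a) (b := a)
    hfi.integrableOn hfi.integrableOn
  have b1 : ‖∫ y in Set.Ioi a, f y‖ ≤ K / a := norm_integral_Ioi_le_of_norm_le_inv_sq ha fun y hy => by
    have := hf y (by rwa [abs_of_pos (ha.trans hy)])
    rwa [abs_of_pos (ha.trans hy)] at this
  have b2 : ‖∫ y in Set.Iic (-a), f y‖ ≤ K / a := by
    have := integral_comp_neg_Iic (-a) (fun y => f (-y))
    simp only [neg_neg] at this
    rw [this]
    refine norm_integral_Ioi_le_of_norm_le_inv_sq ha fun y hy => ?_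
    have := hf (-y) (by rwa [abs_neg, abs_of_pos (ha.trans hy)])
    rwa [abs_neg, abs_of_pos (ha.trans hy)] at this
  have e3 : ∫ y, f y = (∫ y in (-a)..a, f y) + (∫ y in Set.Iic (-a), f y) + ∫ y in Set.Ioi a, f y := by
    rw [← e1, ← e2]; ring
  rw [e3]
  refine (norm_add₃_le).trans ?_
  linarith

lemma norm_shifted_le {s : ℂ} {z B r : ℝ} (hz : 0 < z) (hs : s ≠ 0) (hr : 0 < r)
    (hr' : r ≤ ‖s‖ * ‖s + 1‖) (hB : ‖((1 + s) - 1) / riemannZeta₁ (1 + s)‖ ≤ B) :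
    ‖(z : ℂ) ^ s / (riemannZeta₁ (1 + s) * (s + 1))‖ ≤ z ^ s.re * B / r := by
  have hns : 0 < ‖s‖ := norm_pos_iff.2 hs
  have hns1 : 0 < ‖s + 1‖ := by
    by_contra h
    have : ‖s + 1‖ = 0 := le_antisymm (not_lt.1 h) (norm_nonneg _)
    rw [this, mul_zero] at hr'
    linarith
  have hB0 : 0 ≤ B := (norm_nonneg _).trans hB
  rw [add_sub_cancel_left, norm_div] at hB
  have e : ‖(z : ℂ) ^ s / (riemannZeta₁ (1 + s) * (s + 1))‖ =
      z ^ s.re * (‖s‖ / ‖riemannZeta₁ (1 + s)‖) / (‖s‖ * ‖s + 1‖) := by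
    rw [norm_div, norm_mul, Complex.norm_cpow_eq_rpow_re_of_pos hz]
    by_cases h0 : ‖riemannZeta₁ (1 + s)‖ = 0
    · rw [h0]; simp
    · field_simp
  rw [e]
  have := Real.rpow_nonneg hz.le s.re
  gcongr

/-- Shifting the contour in Perron's formula to the left of the line `Re s = 0`. -/
theorem abs_sum_moebius_le_of_norm_div_le {σ η a B Z z : ℝ} (hσ : 0 < σ) (hσ1 : σ ≤ 1) (hη : 0 < η)
    (hη1 : η ≤ 1 / 2) (ha : 1 ≤ a) (hz : 1 ≤ z) (hZ : ‖riemannZeta (1 + σ : ℝ)‖ ≤ Z)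
    (hB : ∀ s : ℂ, |s.im| ≤ a → 1 - η ≤ s.re → s.re ≤ 2 →
      riemannZeta₁ s ≠ 0 ∧ ‖(s - 1) / riemannZeta₁ s‖ ≤ B) :
    |∑ n ∈ Icc 1 ⌊z⌋₊, (ArithmeticFunction.moebius n : ℝ) / n * (1 - n / z)| ≤
      2 * (Z * z ^ σ / a) + 4 * (z ^ σ * B / a ^ 2) + 4 * (a * (z ^ (-η) * B / η)) := by
  have hz0 : 0 < z := by linarith
  have ha0 : 0 < a := by linarith
  set f : ℂ → ℂ := fun s => (z : ℂ) ^ s / (riemannZeta₁ (1 + s) * (s + 1)) with hf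
  have hB0 : 0 ≤ B := (norm_nonneg _).trans (hB 1 (by simp; linarith) (by simp; linarith) (by simp)).2
  -- the integrand on the original line
  have hg : ∀ y : ℝ, (z : ℂ) ^ ((σ : ℂ) + y * Complex.I) *
        (riemannZeta (1 + ((σ : ℂ) + y * Complex.I)))⁻¹ *
        (1 / (((σ : ℂ) + y * Complex.I) * (σ + y * Complex.I + 1))) = f (σ + y * Complex.I) := by
    intro y
    have h1 : (1 + ((σ : ℂ) + y * Complex.I)) ≠ 1 := fun h => by
      have := congrArg Complex.re h
      simp at this; exact hσ.ne' this
    have h2 := vertical_ne_zero hσ y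
    have h3 := left_ne_zero_of_mul h2
    have h4 := right_ne_zero_of_mul h2
    simp only [hf]
    rw [← div_riemannZeta₁_eq_inv h1, add_sub_cancel_left]
    field_simp
  have hcont : Continuous fun y : ℝ => f (σ + y * Complex.I) := by
    simp only [hf]
    refine Continuous.div (Continuous.const_cpow (by fun_prop) (Or.inl (by exact_mod_cast hz0.ne')))
      ((differentiable_riemannZeta₁.continuous.comp (by fun_prop)).mul (by fun_prop)) fun y => ?_
    exact mul_ne_zero (riemannZeta₁_ne_zero_of_one_le_re (by simpa using hσ.le))
      (right_ne_zero_of_mul (vertical_ne_zero hσ y))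
  have hbound0 : ∀ y : ℝ, ‖f (σ + y * Complex.I)‖ ≤
      z ^ σ * Z * ‖1 / (((σ : ℂ) + y * Complex.I) * (σ + y * Complex.I + 1))‖ := by
    intro y
    rw [← hg, norm_mul, norm_mul, Complex.norm_cpow_eq_rpow_re_of_pos hz0]
    have h1 := norm_inv_riemannZeta_le (s := 1 + ((σ : ℂ) + y * Complex.I)) (by simpa using hσ)
    have e : (1 + ((σ : ℂ) + y * Complex.I)).re = 1 + σ := by simp
    have e' : ((σ : ℂ) + y * Complex.I).re = σ := by simp
    rw [e] at h1
    rw [e']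
    have := h1.trans hZ
    gcongr
  have hintegral : Integrable fun y : ℝ => f (σ + y * Complex.I) :=
    Integrable.mono' ((integrable_one_div_vertical hσ).norm.const_mul (z ^ σ * Z))
      hcont.aestronglyMeasurable (ae_of_all _ hbound0)
  have hre_le : ∀ x y : ℝ, |y| ≤ ‖(x : ℂ) + y * Complex.I‖ ∧ |y| ≤ ‖(x : ℂ) + y * Complex.I + 1‖ ∧
      |x| ≤ ‖(x : ℂ) + y * Complex.I‖ ∧ |x + 1| ≤ ‖(x : ℂ) + y * Complex.I + 1‖ := fun x y =>
    ⟨by simpa using Complex.abs_im_le_norm ((x : ℂ) + y * Complex.I),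
      by simpa using Complex.abs_im_le_norm ((x : ℂ) + y * Complex.I + 1),
      by simpa using Complex.abs_re_le_norm ((x : ℂ) + y * Complex.I),
      by simpa using Complex.abs_re_le_norm ((x : ℂ) + y * Complex.I + 1)⟩
  have htail := norm_integral_le_add_of_norm_le_inv_sq (K := z ^ σ * Z) ha0 hintegral (by
    intro y hy
    refine (hbound0 y).trans ?_
    have hZ0 : 0 ≤ Z := (norm_nonneg _).trans hZ
    refine mul_le_mul_of_nonneg_left ?_ (by positivity)
    have hy0 : 0 < |y| := ha0.trans hy
    rw [norm_div, norm_one, norm_mul, Real.rpow_neg hy0.le, one_div, show (2 : ℝ) = (2 : ℕ) by norm_num,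
      Real.rpow_natCast, sq]
    obtain ⟨h1, h2, -, -⟩ := hre_le σ y
    gcongr)
  have hrect := Complex.integral_boundary_rect_eq_zero_of_differentiableOn f
    (-η + (-a : ℝ) * Complex.I) (σ + a * Complex.I) (by
      intro s hs
      obtain ⟨hs1, hs2⟩ := hs
      simp at hs1 hs2
      rw [Set.uIcc_of_le (by linarith)] at hs1 hs2
      obtain ⟨h1, -⟩ := hB (1 + s) (by simpa using abs_le.2 hs2) (by simp; linarith [hs1.1])
        (by simp; linarith [hs1.2])
      refine DifferentiableAt.differentiableWithinAt ?_
      refine DifferentiableAt.div ?_ ?_ (mul_ne_zero h1 ?_)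
      · exact differentiableAt_id.const_cpow (Or.inl (by exact_mod_cast hz0.ne'))
      · exact (differentiable_riemannZeta₁.differentiableAt.comp s (by fun_prop)).mul (by fun_prop)
      · intro h
        have := congrArg Complex.re h
        simp at this
        linarith [hs1.1])
  simp only [Complex.add_re, Complex.neg_re, Complex.ofReal_re, Complex.mul_re, Complex.I_re,
    Complex.ofReal_im, Complex.I_im, Complex.add_im, Complex.neg_im, Complex.mul_im, mul_zero,
    mul_one, sub_zero, add_zero, zero_add, neg_zero] at hrect
  have hhor : ∀ b : ℝ, |b| = a →
      ‖∫ x in (-η)..σ, f (x + b * Complex.I)‖ ≤ 2 * (z ^ σ * B / a ^ 2) := by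
    intro b hb
    have hK : ∀ x ∈ Set.uIoc (-η) σ, ‖f (x + b * Complex.I)‖ ≤ z ^ σ * B / a ^ 2 := by
      intro x hx
      rw [Set.uIoc_of_le (by linarith)] at hx
      obtain ⟨h1, h2, -, -⟩ := hre_le x b
      rw [hb] at h1 h2
      have hne : (x : ℂ) + b * Complex.I ≠ 0 := norm_pos_iff.1 (ha0.trans_le h1)
      refine (norm_shifted_le hz0 hne (r := a ^ 2) (by positivity) (by nlinarith)
        (hB _ (by simp [hb]) (by simp; linarith [hx.1]) (by simp; linarith [hx.2])).2).trans ?_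
      have e : ((x : ℂ) + b * Complex.I).re = x := by simp
      rw [e]
      have := Real.rpow_le_rpow_of_exponent_le hz hx.2
      gcongr
    refine (intervalIntegral.norm_integral_le_of_norm_le_const hK).trans ?_
    rw [mul_comm]
    refine mul_le_mul_of_nonneg_right ?_ (by positivity)
    rw [abs_of_nonneg (by linarith)]; linarith
  have hver : ‖∫ y in (-a)..a, f ((-η : ℝ) + y * Complex.I)‖ ≤ 4 * (a * (z ^ (-η) * B / η)) := by
    have hK : ∀ y ∈ Set.uIoc (-a) a, ‖f ((-η : ℝ) + y * Complex.I)‖ ≤ z ^ (-η) * B / (η * (1 / 2)) := by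
      intro y hy
      rw [Set.uIoc_of_le (by linarith)] at hy
      obtain ⟨-, -, h1, h2⟩ := hre_le (-η) y
      rw [abs_neg, abs_of_pos hη] at h1
      rw [abs_of_nonneg (by linarith)] at h2
      have hne : ((-η : ℝ) : ℂ) + y * Complex.I ≠ 0 := norm_pos_iff.1 (hη.trans_le h1)
      refine (norm_shifted_le hz0 hne (r := η * (1 / 2)) (by positivity)
        (mul_le_mul h1 (by linarith) (by norm_num) (norm_nonneg _))
        (hB _ (by simpa using abs_le.2 ⟨hy.1.le, hy.2⟩) (by simp)
          (by simp; linarith)).2).trans (le_of_eq ?_)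
      congr 3
      simp
    refine (intervalIntegral.norm_integral_le_of_norm_le_const hK).trans (le_of_eq ?_)
    rw [abs_of_nonneg (by linarith)]
    field_simp
    ring
  have hmain : ‖∫ y in (-a)..a, f (σ + y * Complex.I)‖ ≤
      4 * (z ^ σ * B / a ^ 2) + 4 * (a * (z ^ (-η) * B / η)) := by
    have e : Complex.I • ∫ y in (-a)..a, f (σ + y * Complex.I) =
        (∫ x in (-η)..σ, f (x + a * Complex.I)) - (∫ x in (-η)..σ, f (x + (-a : ℝ) * Complex.I)) +
          Complex.I • ∫ y in (-a)..a, f ((-η : ℝ) + y * Complex.I) := by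
      linear_combination hrect
    have e2 : ‖∫ y in (-a)..a, f (σ + y * Complex.I)‖ =
        ‖Complex.I • ∫ y in (-a)..a, f (σ + y * Complex.I)‖ := by
      rw [norm_smul, Complex.norm_I, one_mul]
    rw [e2, e]
    refine (norm_add_le _ _).trans ?_
    have h1 := hhor a (abs_of_pos ha0)
    have h2 := hhor (-a) (by rw [abs_neg, abs_of_pos ha0])
    have h3 := norm_sub_le (∫ x in (-η)..σ, f (x + a * Complex.I))
      (∫ x in (-η)..σ, f (x + (-a : ℝ) * Complex.I))
    rw [norm_smul, Complex.norm_I, one_mul]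
    linarith
  have hP := sum_moebius_div_mul_eq_integral hσ hz0
  simp_rw [hg] at hP
  rw [← Real.norm_eq_abs, ← Complex.norm_real, hP, norm_mul]
  have hpi : ‖(1 : ℂ) / (2 * Real.pi)‖ ≤ 1 := by
    rw [norm_div, norm_one, norm_mul, Complex.norm_real, Complex.norm_ofNat,
      Real.norm_of_nonneg Real.pi_pos.le]
    rw [div_le_one (by positivity)]
    linarith [Real.pi_gt_three]
  refine (mul_le_of_le_one_left (norm_nonneg _) hpi).trans ?_
  rw [mul_comm Z]
  linarith

end Contour

section MoebiusSum

lemma eventually_curlyL_exponent {κ : ℝ} (hκ : 0 < κ) : ∀ᶠ L : ℝ in atTop,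
    1 ≤ Real.log L ∧ 1 ≤ L ^ ((3 : ℝ) / 5) / (Real.log L) ^ ((1 : ℝ) / 5) ∧
    Real.log L ≤ κ * (L ^ ((3 : ℝ) / 5) / (Real.log L) ^ ((1 : ℝ) / 5)) ∧
    1 ≤ κ * (L ^ ((3 : ℝ) / 5) / (Real.log L) ^ ((1 : ℝ) / 5)) := by
  have h1 := (isLittleO_log_rpow_atTop (r := 1 / 2) (by norm_num)).bound hκ
  have h2 := (isLittleO_log_rpow_atTop (r := 1 / 2) (by norm_num)).bound one_pos
  have h3 := Real.tendsto_log_atTop.eventually_ge_atTop 1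
  filter_upwards [h1, h2, h3, eventually_ge_atTop 1] with L h1 h2 h3 h4
  have hL : 0 < L := by linarith
  rw [Real.norm_of_nonneg (by linarith), Real.norm_of_nonneg (by positivity)] at h1 h2
  rw [one_mul] at h2
  have hg : L ^ (1 / 2 : ℝ) ≤ L ^ ((3 : ℝ) / 5) / (Real.log L) ^ ((1 : ℝ) / 5) := by
    rw [le_div_iff₀ (Real.rpow_pos_of_pos (by linarith) _)]
    calc L ^ (1 / 2 : ℝ) * Real.log L ^ ((1 : ℝ) / 5)
        ≤ L ^ (1 / 2 : ℝ) * (L ^ (1 / 2 : ℝ)) ^ ((1 : ℝ) / 5) := by gcongr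
      _ = L ^ ((3 : ℝ) / 5) := by
          rw [← Real.rpow_mul hL.le, ← Real.rpow_add hL]; norm_num
  have h5 : Real.log L ≤ κ * (L ^ ((3 : ℝ) / 5) / (Real.log L) ^ ((1 : ℝ) / 5)) :=
    h1.trans (mul_le_mul_of_nonneg_left hg hκ.le)
  exact ⟨h3, (Real.one_le_rpow h4 (by norm_num)).trans hg, h5, h3.trans h5⟩

lemma curlyL_exponent_le {L : ℝ} (hL : 1 ≤ Real.log L) (hL1 : 1 ≤ L) :
    L ^ ((3 : ℝ) / 5) / (Real.log L) ^ ((1 : ℝ) / 5) ≤ L := by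
  have h1 : 1 ≤ Real.log L ^ ((1 : ℝ) / 5) := Real.one_le_rpow hL (by norm_num)
  refine (div_le_self (by positivity) h1).trans ?_
  calc L ^ ((3 : ℝ) / 5) ≤ L ^ (1 : ℝ) := Real.rpow_le_rpow_of_exponent_le hL1 (by norm_num)
    _ = L := Real.rpow_one L

lemma curlyL_exponent_rpow {L : ℝ} (hL : 1 ≤ Real.log L) (hL1 : 1 ≤ L) :
    (L ^ ((3 : ℝ) / 5) / (Real.log L) ^ ((1 : ℝ) / 5)) ^ (2 / 3 : ℝ) * Real.log L ^ (1 / 3 : ℝ) =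
      L / (L ^ ((3 : ℝ) / 5) / (Real.log L) ^ ((1 : ℝ) / 5)) := by
  have h0 : 0 < L := by linarith
  have h1 : 0 < Real.log L := by linarith
  rw [Real.div_rpow (by positivity) (by positivity), ← Real.rpow_mul h0.le, ← Real.rpow_mul h1.le,
    div_mul_eq_mul_div, div_div_eq_mul_div, div_eq_div_iff (by positivity) (by positivity)]
  have e1 : L * Real.log L ^ ((1 : ℝ) / 5) * Real.log L ^ ((1 : ℝ) / 5 * (2 / 3)) =
      L * Real.log L ^ ((1 : ℝ) / 3) := by
    rw [mul_assoc, ← Real.rpow_add h1]; norm_num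
  have e2 : L ^ ((3 : ℝ) / 5 * (2 / 3)) * Real.log L ^ ((1 : ℝ) / 3) * L ^ ((3 : ℝ) / 5) =
      L * Real.log L ^ ((1 : ℝ) / 3) := by
    rw [mul_right_comm, ← Real.rpow_add h0]; norm_num
  rw [e1, e2]

set_option maxHeartbeats 1000000 in
theorem exists_abs_smooth_sum_moebius_le : ∃ c C X₀ : ℝ, 0 < c ∧ c ≤ 1 / 32 ∧ 0 < C ∧ 3 ≤ X₀ ∧
    ∀ X z : ℝ, X₀ ≤ X → X ^ (1 / 4 : ℝ) ≤ z → z ≤ 2 * X →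
      curlyL X ≤ X ∧ 1 ≤ curlyL X ∧
      |∑ n ∈ Icc 1 ⌊z⌋₊, (ArithmeticFunction.moebius n : ℝ) / n * (1 - n / z)| ≤
        C * curlyL X ^ (-c) := by
  obtain ⟨c₀, C₀, hc₀, hC₀, hζ⟩ := exists_norm_div_riemannZeta₁_le
  obtain ⟨C₁, hC₁, hZ⟩ := exists_norm_riemannZeta_real_le
  set c' : ℝ := min c₀ (1 / 2) with hc'
  have hc'0 : 0 < c' := lt_min hc₀ (by norm_num)
  have hc'1 : c' ≤ 1 / 2 := min_le_right _ _
  set κ : ℝ := c' / 16 with hκ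
  have hκ0 : 0 < κ := by positivity
  obtain ⟨X₀, hX₀⟩ := eventually_atTop.1
    (Real.tendsto_log_atTop.eventually (eventually_curlyL_exponent (κ := κ / 4) (by positivity)))
  refine ⟨κ / 2, 100 * C₁ + 200 * C₀ + 4 * C₀ / c', max X₀ 3, by positivity, by linarith, by positivity,
    le_max_right _ _, fun X z hX hz1 hz2 => ?_⟩
  obtain ⟨f1, f2, f3, f4⟩ := hX₀ X ((le_max_left _ _).trans hX)
  have hX3 : 3 ≤ X := (le_max_right _ _).trans hX
  set L := Real.log X with hL
  set g := L ^ ((3 : ℝ) / 5) / (Real.log L) ^ ((1 : ℝ) / 5) with hg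
  have hL1 : 1 ≤ L := by
    rw [hL, Real.le_log_iff_exp_le (by linarith)]
    linarith [Real.exp_one_lt_d9]
  have hgL : g ≤ L := curlyL_exponent_le f1 hL1
  have hcur : curlyL X = Real.exp g := rfl
  have hX0 : 0 < X := by linarith
  have hz : 1 ≤ z := (Real.one_le_rpow (by linarith) (by norm_num)).trans hz1
  have hz0 : 0 < z := by linarith
  refine ⟨?_, ?_, ?_⟩
  · rw [hcur]
    calc Real.exp g ≤ Real.exp L := Real.exp_le_exp.2 hgL
      _ = X := Real.exp_log hX0
  · rw [hcur]; exact Real.one_le_exp (by linarith)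
  set a := Real.exp (κ * g) with ha
  have hloga : Real.log a = κ * g := Real.log_exp _
  have ha16 : 16 ≤ a := by
    have h1 : (16 : ℝ) ≤ Real.exp 4 := by
      have := Real.exp_one_gt_d9
      calc (16 : ℝ) = 2 ^ 4 := by norm_num
        _ ≤ Real.exp 1 ^ 4 := by gcongr; linarith
        _ = Real.exp 4 := by rw [← Real.exp_nat_mul]; norm_num
    exact h1.trans (Real.exp_le_exp.2 (by linarith))
  have hκg : κ * g ≤ g := by
    have : κ ≤ 1 := by linarith
    nlinarith
  set η := c' * g / L with hη
  have hη0 : 0 < η := by positivity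
  have hη1 : η ≤ 1 / 2 := by
    rw [hη, div_le_iff₀ (by linarith)]
    nlinarith
  have hηle : η ≤ c₀ / (Real.log a ^ (2 / 3 : ℝ) * Real.log (Real.log a) ^ (1 / 3 : ℝ)) := by
    rw [hloga]
    have hκg1 : 1 ≤ κ * g := by linarith
    have h1 : 0 < Real.log (κ * g) := Real.log_pos (by linarith)
    have h2 : Real.log (κ * g) ≤ Real.log L := Real.log_le_log (by linarith) (by linarith)
    have h3 : (κ * g) ^ (2 / 3 : ℝ) * Real.log (κ * g) ^ (1 / 3 : ℝ) ≤ L / g := by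
      rw [hg, ← curlyL_exponent_rpow f1 hL1, ← hg]
      gcongr
    calc η = c' / (L / g) := by rw [hη]; field_simp
      _ ≤ c₀ / (L / g) := by gcongr; exact min_le_left _ _
      _ ≤ _ := by gcongr
  have hmain := abs_sum_moebius_le_of_norm_div_le (σ := 1 / L) (η := η) (a := a) (B := C₀ * Real.log a)
    (Z := C₁ * L) (z := z) (by positivity) (by rw [div_le_one (by linarith)]; exact hL1) hη0 hη1
    (by linarith) hz
    (by
      have := hZ (1 + 1 / L) (by linarith [show 0 < 1 / L by positivity])
        (by have : 1 / L ≤ 1 := by rw [div_le_one (by linarith)]; exact hL1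
            linarith)
      exact this.trans (le_of_eq (by rw [add_sub_cancel_left, div_div_eq_mul_div, div_one])))
    (fun s h1 h2 h3 => hζ a s ha16 h1 (by linarith) h3)
  refine hmain.trans ?_
  rw [hloga, hcur, ← Real.exp_mul]
  have hzσ : z ^ (1 / L) ≤ 8 := by
    have h1 : Real.log z ≤ 2 * L := by
      calc Real.log z ≤ Real.log (X ^ 2) := Real.log_le_log hz0 (by nlinarith)
        _ = 2 * L := by rw [Real.log_pow, ← hL]; norm_num
    calc z ^ (1 / L) = Real.exp (Real.log z * (1 / L)) := Real.rpow_def_of_pos hz0 _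
      _ ≤ Real.exp 2 := by
        refine Real.exp_le_exp.2 ?_
        rw [mul_one_div, div_le_iff₀ (by linarith)]; exact h1
      _ = Real.exp 1 ^ 2 := by rw [← Real.exp_nat_mul]; norm_num
      _ ≤ 2.72 ^ 2 := by gcongr; linarith [Real.exp_one_lt_d9]
      _ ≤ 8 := by norm_num
  have hzη : z ^ (-η) ≤ (a ^ 4)⁻¹ := by
    have h1 : L / 4 ≤ Real.log z := by
      calc L / 4 = Real.log (X ^ (1 / 4 : ℝ)) := by rw [Real.log_rpow hX0, ← hL]; ring
        _ ≤ _ := Real.log_le_log (by positivity) hz1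
    calc z ^ (-η) = Real.exp (Real.log z * (-η)) := Real.rpow_def_of_pos hz0 _
      _ ≤ Real.exp (-(4 * (κ * g))) := by
        refine Real.exp_le_exp.2 ?_
        have : 4 * (κ * g) = L / 4 * η := by rw [hη, hκ]; field_simp; norm_num
        rw [this]
        nlinarith
      _ = (a ^ 4)⁻¹ := by rw [Real.exp_neg, ha, ← Real.exp_nat_mul]; norm_num
  have hLa : L ^ 2 ≤ Real.exp (κ * g / 2) := by
    calc L ^ 2 = Real.exp (2 * Real.log L) := by
          rw [mul_comm, Real.exp_mul, Real.exp_log (by linarith)]; norm_num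
      _ ≤ _ := Real.exp_le_exp.2 (by linarith)
  set b := Real.exp (κ * g / 2) with hb
  have hab : a = b ^ 2 := by rw [ha, hb, ← Real.exp_nat_mul]; congr 1; push_cast; ring
  have hb' : Real.exp (g * -(κ / 2)) = b⁻¹ := by rw [hb, ← Real.exp_neg]; congr 1; ring
  have hb0 : 0 < b := Real.exp_pos _
  have hb1 : 1 ≤ b := Real.one_le_exp (by nlinarith)
  rw [hb']
  have hLb : L ≤ b := by nlinarith
  have t1 : C₁ * L * z ^ (1 / L) / a ≤ 8 * C₁ * b⁻¹ := by
    calc C₁ * L * z ^ (1 / L) / a ≤ C₁ * b * 8 / b ^ 2 := by rw [hab]; gcongr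
      _ = _ := by field_simp
  have t2 : z ^ (1 / L) * (C₀ * (κ * g)) / a ^ 2 ≤ 8 * C₀ * b⁻¹ := by
    calc z ^ (1 / L) * (C₀ * (κ * g)) / a ^ 2 ≤ 8 * (C₀ * b) / b ^ 2 := by
          have h1 : b ^ 2 ≤ a ^ 2 := by rw [hab]; nlinarith [one_le_pow₀ hb1 (n := 2)]
          gcongr
          linarith
      _ = _ := by field_simp
  have t3 : a * (z ^ (-η) * (C₀ * (κ * g)) / η) ≤ C₀ / c' * b⁻¹ := by
    have e : a * (z ^ (-η) * (C₀ * (κ * g)) / η) = C₀ / c' * (a * κ * L * z ^ (-η)) := by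
      rw [hη]; field_simp
    rw [e]
    refine mul_le_mul_of_nonneg_left ?_ (by positivity)
    calc a * κ * L * z ^ (-η) ≤ a * 1 * b * (a ^ 4)⁻¹ := by
          gcongr; linarith
      _ = b * (b ^ 6)⁻¹ := by rw [hab]; field_simp
      _ ≤ b⁻¹ := by
        rw [← div_eq_mul_inv, div_le_iff₀ (by positivity)]
        calc b ≤ b ^ 5 := le_self_pow₀ hb1 (by norm_num)
          _ = b⁻¹ * b ^ 6 := by field_simp
  have hbi : 0 < b⁻¹ := by positivity
  have e : (100 * C₁ + 200 * C₀ + 4 * C₀ / c') * b⁻¹ =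
      100 * (C₁ * b⁻¹) + 200 * (C₀ * b⁻¹) + 4 * (C₀ / c' * b⁻¹) := by ring
  rw [e]
  have p1 : 0 < C₁ * b⁻¹ := by positivity
  have p2 : 0 < C₀ * b⁻¹ := by positivity
  linarith

lemma abs_moebius_div_le (n : ℕ) : |(ArithmeticFunction.moebius n : ℝ) / n| ≤ 1 / n := by
  rw [abs_div, Nat.abs_cast]
  have : |(ArithmeticFunction.moebius n : ℝ)| ≤ 1 := by
    exact_mod_cast ArithmeticFunction.abs_moebius_le_one (n := n)
  gcongr

lemma abs_sum_moebius_div_le_of_smooth {z h E : ℝ} (hz : 1 ≤ z) (hh : 0 < h) (hhz : h ≤ z)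
    (h1 : |∑ n ∈ Icc 1 ⌊z⌋₊, (ArithmeticFunction.moebius n : ℝ) / n * (1 - n / z)| ≤ E)
    (h2 : |∑ n ∈ Icc 1 ⌊z + h⌋₊, (ArithmeticFunction.moebius n : ℝ) / n * (1 - n / (z + h))| ≤ E) :
    |∑ n ∈ Icc 1 ⌊z⌋₊, (ArithmeticFunction.moebius n : ℝ) / n| ≤ 3 * z * E / h + (h + 1) / z := by
  have hz0 : 0 < z := by linarith
  set w := z + h with hw
  have hw0 : 0 < w := by linarith
  set P := ∑ n ∈ Icc 1 ⌊z⌋₊, (ArithmeticFunction.moebius n : ℝ) / n * (1 - n / z) with hP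
  set Q := ∑ n ∈ Icc 1 ⌊w⌋₊, (ArithmeticFunction.moebius n : ℝ) / n * (1 - n / w) with hQ
  set S := ∑ n ∈ Icc 1 ⌊z⌋₊, (ArithmeticFunction.moebius n : ℝ) / n with hS
  have hle : ⌊z⌋₊ ≤ ⌊w⌋₊ := Nat.floor_mono (by linarith)
  set R := ∑ n ∈ Ioc ⌊z⌋₊ ⌊w⌋₊, (ArithmeticFunction.moebius n : ℝ) / n * (w - n) with hR
  have e1 : z * P = ∑ n ∈ Icc 1 ⌊z⌋₊, (ArithmeticFunction.moebius n : ℝ) / n * (z - n) := by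
    rw [hP, mul_sum]
    refine sum_congr rfl fun n _ => ?_
    have : z * (1 - n / z) = z - n := by field_simp
    rw [← this]; ring
  have e2 : w * Q = (∑ n ∈ Icc 1 ⌊z⌋₊, (ArithmeticFunction.moebius n : ℝ) / n * (w - n)) + R := by
    have hd : Icc 1 ⌊w⌋₊ = Icc 1 ⌊z⌋₊ ∪ Ioc ⌊z⌋₊ ⌊w⌋₊ := by
      ext n; simp only [mem_union, mem_Icc, mem_Ioc]; omega
    have hdis : Disjoint (Icc 1 ⌊z⌋₊) (Ioc ⌊z⌋₊ ⌊w⌋₊) := by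
      rw [disjoint_left]; intro n; simp only [mem_Icc, mem_Ioc]; omega
    rw [hQ, mul_sum, hR, ← sum_union hdis, ← hd]
    refine sum_congr rfl fun n _ => ?_
    have : w * (1 - n / w) = w - n := by field_simp
    rw [← this]; ring
  have e3 : h * S = w * Q - z * P - R := by
    rw [e1, e2, add_sub_right_comm, add_sub_cancel_right, ← sum_sub_distrib, hS, mul_sum]
    refine sum_congr rfl fun n _ => ?_
    rw [hw]; ring
  have hRb : |R| ≤ (h + 1) * (h / z) := by
    calc |R| ≤ ∑ n ∈ Ioc ⌊z⌋₊ ⌊w⌋₊, |(ArithmeticFunction.moebius n : ℝ) / n * (w - n)| :=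
          abs_sum_le_sum_abs _ _
      _ ≤ ∑ n ∈ Ioc ⌊z⌋₊ ⌊w⌋₊, h / z := by
          refine sum_le_sum fun n hn => ?_
          rw [mem_Ioc] at hn
          have h3 : z < n := (Nat.floor_lt hz0.le).1 hn.1
          have h4 : (n : ℝ) ≤ w := (Nat.le_floor_iff hw0.le).1 hn.2
          rw [abs_mul, abs_of_nonneg (sub_nonneg.2 h4)]
          calc |(ArithmeticFunction.moebius n : ℝ) / n| * (w - n) ≤ 1 / z * h := by
                refine mul_le_mul ((abs_moebius_div_le n).trans ?_) (by linarith) (by linarith)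
                  (by positivity)
                exact one_div_le_one_div_of_le hz0 h3.le
            _ = h / z := by ring
      _ = ((⌊w⌋₊ - ⌊z⌋₊ : ℕ) : ℝ) * (h / z) := by rw [sum_const, Nat.card_Ioc, nsmul_eq_mul]
      _ ≤ _ := by
          refine mul_le_mul_of_nonneg_right ?_ (by positivity)
          rw [Nat.cast_sub hle]
          linarith [Nat.floor_le hw0.le, Nat.lt_floor_add_one z]
  have e4 : h * |S| ≤ 3 * z * E + (h + 1) * (h / z) := by
    have : h * |S| = |h * S| := by rw [abs_mul, abs_of_pos hh]
    rw [this, e3]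
    have t1 := abs_sub (w * Q - z * P) R
    have t2 := abs_sub (w * Q) (z * P)
    rw [abs_mul, abs_mul, abs_of_pos hw0, abs_of_pos hz0] at t2
    have hE : 0 ≤ E := (abs_nonneg _).trans h1
    nlinarith
  calc |S| = h * |S| / h := by field_simp
    _ ≤ (3 * z * E + (h + 1) * (h / z)) / h := by gcongr
    _ = _ := by field_simp

lemma abs_sum_moebius_div_le_log (N : ℕ) :
    |∑ n ∈ Icc 1 N, (ArithmeticFunction.moebius n : ℝ) / n| ≤ 1 + Real.log N := by
  refine (abs_sum_le_sum_abs _ _).trans ((sum_le_sum fun n _ => abs_moebius_div_le n).trans ?_)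
  have := harmonic_le_one_add_log N
  rw [harmonic_eq_sum_Icc] at this
  push_cast at this
  simpa using this

theorem exists_abs_sum_moebius_div_le_of_large : ∃ c C X₀ : ℝ, 0 < c ∧ c ≤ 1 / 32 ∧ 0 < C ∧ 3 ≤ X₀ ∧
    ∀ X z : ℝ, X₀ ≤ X → X ^ (1 / 4 : ℝ) ≤ z → z ≤ X → curlyL X ≤ X ∧ 1 ≤ curlyL X ∧
      |∑ n ∈ Icc 1 ⌊z⌋₊, (ArithmeticFunction.moebius n : ℝ) / n| ≤ C * curlyL X ^ (-c) := by
  obtain ⟨c, C, X₀, hc, hc1, hC, hX₀, h⟩ := exists_abs_smooth_sum_moebius_le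
  refine ⟨c / 2, 3 * C + 2, X₀, by positivity, by linarith, by positivity, hX₀, fun X z hX h1 h2 => ?_⟩
  have hX3 : 3 ≤ X := hX₀.trans hX
  have hz : 1 ≤ z := (Real.one_le_rpow (by linarith) (by norm_num)).trans h1
  obtain ⟨l1, l2, b1⟩ := h X z hX h1 (by linarith)
  refine ⟨l1, l2, ?_⟩
  set e := curlyL X ^ (-(c / 2)) with he
  have hl0 : 0 < curlyL X := by linarith
  have he0 : 0 < e := Real.rpow_pos_of_pos hl0 _
  have he1 : e ≤ 1 := Real.rpow_le_one_of_one_le_of_nonpos l2 (by linarith)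
  have hee : curlyL X ^ (-c) = e * e := by
    rw [he, ← Real.rpow_add hl0]; congr 1; ring
  have hzh : z * e ≤ z := mul_le_of_le_one_right (by linarith) he1
  have hzh0 : 0 < z * e := mul_pos (by linarith) he0
  obtain ⟨-, -, b2⟩ := h X (z + z * e) hX (by linarith) (by linarith)
  refine (abs_sum_moebius_div_le_of_smooth hz hzh0 hzh b1 b2).trans ?_
  have hz0 : 0 < z := by linarith
  have hzi : 1 / z ≤ e := by
    rw [one_div, he, Real.rpow_neg hl0.le]
    refine inv_anti₀ (Real.rpow_pos_of_pos hl0 _) ?_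
    calc curlyL X ^ (c / 2) ≤ X ^ (c / 2) := Real.rpow_le_rpow hl0.le l1 (by linarith)
      _ ≤ X ^ (1 / 4 : ℝ) := Real.rpow_le_rpow_of_exponent_le (by linarith) (by linarith)
      _ ≤ z := h1
  have e1 : 3 * z * (C * curlyL X ^ (-c)) / (z * e) = 3 * C * e := by
    rw [hee]; field_simp
  have e2 : (z * e + 1) / z = e + 1 / z := by field_simp
  rw [e1, e2]
  linarith

/-- The Vinogradov–Korobov bound for `∑_{n ≤ j / e} μ(n) / n`, with a uniform dependence on `e`. -/
theorem exists_abs_sum_moebius_div_le : ∃ c C : ℝ, 0 < c ∧ 0 < C ∧ ∀ j e : ℕ, 1 ≤ j → 1 ≤ e →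
    |∑ n ∈ Icc 1 (j / e), (ArithmeticFunction.moebius n : ℝ) / n| ≤
      C * (e : ℝ) ^ (1 / 8 : ℝ) * curlyL (max 3 (2 * j)) ^ (-c) := by
  obtain ⟨c, C, X₀, hc, hc1, hC, hX₀, h⟩ := exists_abs_sum_moebius_div_le_of_large
  have hll3 : 0 < Real.log (Real.log 3) := by
    refine Real.log_pos ?_
    rw [Real.lt_log_iff_exp_lt (by norm_num)]
    linarith [Real.exp_one_lt_d9]
  set K := Real.exp ((Real.log X₀) ^ ((3 : ℝ) / 5) / (Real.log (Real.log 3)) ^ ((1 : ℝ) / 5)) with hK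
  have hKpos : 0 < K ^ c := Real.rpow_pos_of_pos (Real.exp_pos _) _
  refine ⟨c, C + X₀ * K ^ c + 100, hc, by positivity, fun j e hj he => ?_⟩
  have hj1 : (1 : ℝ) ≤ j := by exact_mod_cast hj
  have he1 : (1 : ℝ) ≤ e := by exact_mod_cast he
  have hepow : 1 ≤ (e : ℝ) ^ (1 / 8 : ℝ) := Real.one_le_rpow he1 (by norm_num)
  set X : ℝ := max 3 (2 * j) with hX
  have hX3 : 3 ≤ X := le_max_left _ _
  have hjX : (j : ℝ) ≤ X := le_trans (by linarith) (le_max_right _ _)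
  have hXj : X ≤ 3 * j := max_le (by linarith) (by linarith)
  have hlpos : 0 < curlyL X := Real.exp_pos _
  have hEpos : 0 < curlyL X ^ (-c) := Real.rpow_pos_of_pos hlpos _
  have hjediv : ((j / e : ℕ) : ℝ) ≤ (j : ℝ) / e := Nat.cast_div_le
  have hje : (j : ℝ) / e ≤ j := div_le_self (by linarith) he1
  have hgen : ∀ A, |∑ n ∈ Icc 1 (j / e), (ArithmeticFunction.moebius n : ℝ) / n| ≤
      A * (e : ℝ) ^ (1 / 8 : ℝ) * curlyL X ^ (-c) → A ≤ C + X₀ * K ^ c + 100 →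
      |∑ n ∈ Icc 1 (j / e), (ArithmeticFunction.moebius n : ℝ) / n| ≤
      (C + X₀ * K ^ c + 100) * (e : ℝ) ^ (1 / 8 : ℝ) * curlyL X ^ (-c) := by
    intro A h1 h2
    exact h1.trans (by gcongr)
  have hXK : 0 < X₀ * K ^ c := by positivity
  rcases lt_or_ge X X₀ with hsm | hlg
  · refine hgen (X₀ * K ^ c) ?_ (by linarith)
    have h1 : curlyL X ≤ K := by
      refine Real.exp_le_exp.2 ?_
      have h2 : Real.log 3 ≤ Real.log X := Real.log_le_log (by norm_num) hX3
      have h3 : Real.log X ≤ Real.log X₀ := Real.log_le_log (by linarith) hsm.le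
      have h4 : 0 < Real.log 3 := Real.log_pos (by norm_num)
      have h5 : Real.log (Real.log 3) ≤ Real.log (Real.log X) := Real.log_le_log h4 h2
      have h6 : 0 ≤ Real.log X := h4.le.trans h2
      have h7 : 0 ≤ Real.log X₀ := h6.trans h3
      gcongr
    have h2 : 1 ≤ K ^ c * curlyL X ^ (-c) := by
      rw [Real.rpow_neg hlpos.le, ← div_eq_mul_inv, one_le_div (Real.rpow_pos_of_pos hlpos _)]
      exact Real.rpow_le_rpow hlpos.le h1 hc.le
    have h3 : |∑ n ∈ Icc 1 (j / e), (ArithmeticFunction.moebius n : ℝ) / n| ≤ X₀ := by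
      calc |∑ n ∈ Icc 1 (j / e), (ArithmeticFunction.moebius n : ℝ) / n|
          ≤ ∑ n ∈ Icc 1 (j / e), |(ArithmeticFunction.moebius n : ℝ) / n| := abs_sum_le_sum_abs _ _
        _ ≤ ∑ n ∈ Icc 1 (j / e), (1 : ℝ) := by
            refine sum_le_sum fun n hn => (abs_moebius_div_le n).trans ?_
            have : (1 : ℝ) ≤ n := by exact_mod_cast (mem_Icc.1 hn).1
            exact (div_le_one (by linarith)).2 this
        _ = ((j / e : ℕ) : ℝ) := by simp
        _ ≤ X₀ := by linarith
    calc |∑ n ∈ Icc 1 (j / e), (ArithmeticFunction.moebius n : ℝ) / n| ≤ X₀ * 1 * 1 := by linarith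
      _ ≤ X₀ * (e : ℝ) ^ (1 / 8 : ℝ) * (K ^ c * curlyL X ^ (-c)) := by gcongr
      _ = _ := by ring
  have hX0 : 0 < X := by linarith
  rcases le_or_gt (X ^ (1 / 4 : ℝ)) ((j : ℝ) / e) with hbig | hbig
  · obtain ⟨-, -, h3⟩ := h X ((j : ℝ) / e) hlg hbig (by linarith)
    rw [Nat.floor_div_eq_div] at h3
    refine hgen C (h3.trans ?_) (by linarith)
    refine mul_le_mul_of_nonneg_right ?_ hEpos.le
    exact le_mul_of_one_le_right hC.le hepow
  · obtain ⟨l1, l2, -⟩ := h X X hlg (by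
      calc X ^ (1 / 4 : ℝ) ≤ X ^ (1 : ℝ) := Real.rpow_le_rpow_of_exponent_le (by linarith) (by norm_num)
        _ = X := Real.rpow_one X) le_rfl
    refine hgen 100 ?_ (by linarith)
    have hlog : 1 + Real.log (j / e : ℕ) ≤ 33 * X ^ (1 / 32 : ℝ) := by
      have h1 : Real.log (j / e : ℕ) ≤ Real.log X := by
        rcases Nat.eq_zero_or_pos (j / e) with h0 | h0
        · rw [h0]; simpa using Real.log_nonneg (by linarith)
        · exact Real.log_le_log (by exact_mod_cast h0) (by linarith)
      have h2 := Real.log_le_rpow_div hX0.le (ε := 1 / 32) (by norm_num)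
      have h3 : 1 ≤ X ^ (1 / 32 : ℝ) := Real.one_le_rpow (by linarith) (by norm_num)
      linarith
    have hee : X ^ (3 / 32 : ℝ) ≤ 3 * (e : ℝ) ^ (1 / 8 : ℝ) := by
      have h1 : X ^ (3 / 4 : ℝ) ≤ 3 * e := by
        rw [div_lt_iff₀ (by linarith)] at hbig
        have h2 : X = X ^ (1 / 4 : ℝ) * X ^ (3 / 4 : ℝ) := by
          rw [← Real.rpow_add hX0]; norm_num
        have h3 : 0 < X ^ (1 / 4 : ℝ) := by positivity
        nlinarith
      calc X ^ (3 / 32 : ℝ) = (X ^ (3 / 4 : ℝ)) ^ (1 / 8 : ℝ) := by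
            rw [← Real.rpow_mul hX0.le]; norm_num
        _ ≤ (3 * e) ^ (1 / 8 : ℝ) := by gcongr
        _ = 3 ^ (1 / 8 : ℝ) * (e : ℝ) ^ (1 / 8 : ℝ) := Real.mul_rpow (by norm_num) (by linarith)
        _ ≤ 3 * (e : ℝ) ^ (1 / 8 : ℝ) := by
            gcongr
            calc (3 : ℝ) ^ (1 / 8 : ℝ) ≤ 3 ^ (1 : ℝ) :=
                  Real.rpow_le_rpow_of_exponent_le (by norm_num) (by norm_num)
              _ = 3 := Real.rpow_one 3
    have hcur : X ^ (-(1 / 32) : ℝ) ≤ curlyL X ^ (-c) := by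
      calc X ^ (-(1 / 32) : ℝ) ≤ X ^ (-c) :=
            Real.rpow_le_rpow_of_exponent_le (by linarith) (by linarith)
        _ ≤ _ := Real.rpow_le_rpow_of_nonpos hlpos l1 (by linarith)
    refine (abs_sum_moebius_div_le_log _).trans (hlog.trans ?_)
    calc 33 * X ^ (1 / 32 : ℝ) ≤ 33 * X ^ (2 / 32 : ℝ) := by
          gcongr
          · linarith
          · norm_num
      _ = 33 * (X ^ (3 / 32 : ℝ) * X ^ (-(1 / 32) : ℝ)) := by rw [← Real.rpow_add hX0]; norm_num
      _ ≤ 33 * (3 * (e : ℝ) ^ (1 / 8 : ℝ) * curlyL X ^ (-c)) := by gcongr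
      _ ≤ 100 * (e : ℝ) ^ (1 / 8 : ℝ) * curlyL X ^ (-c) := by
          have : 0 < (e : ℝ) ^ (1 / 8 : ℝ) * curlyL X ^ (-c) := by positivity
          nlinarith

end MoebiusSum

section EulerBounds

lemma squarefree_prod_of_forall_prime {t : Finset ℕ} (ht : ∀ p ∈ t, p.Prime) :
    Squarefree (∏ p ∈ t, p) := by
  refine Finset.squarefree_prod_of_pairwise_isCoprime (fun p hp q hq hpq => ?_)
    fun p hp => (ht p hp).prime.squarefree
  simp only [Function.onFun, ← Nat.coprime_iff_isRelPrime]
  exact (Nat.coprime_primes (ht p hp) (ht q hq)).2 hpq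

lemma sum_squarefree_divisors_eq_sum_powerset {n : ℕ} (hn : n ≠ 0) (F : Finset ℕ → ℝ) :
    ∑ d ∈ n.divisors with Squarefree d, F d.primeFactors = ∑ t ∈ n.primeFactors.powerset, F t := by
  refine sum_nbij' (fun d => d.primeFactors) (fun t => ∏ p ∈ t, p) ?_ ?_ ?_ ?_ ?_
  · intro d hd
    rw [mem_filter, Nat.mem_divisors] at hd
    exact mem_powerset.2 (Nat.primeFactors_mono hd.1.1 hn)
  · intro t ht
    rw [mem_powerset] at ht
    have hp : ∀ p ∈ t, p.Prime := fun p hp => Nat.prime_of_mem_primeFactors (ht hp)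
    rw [mem_filter, Nat.mem_divisors]
    exact ⟨⟨(prod_dvd_prod_of_subset _ _ _ ht).trans (Nat.prod_primeFactors_dvd n), hn⟩,
      squarefree_prod_of_forall_prime hp⟩
  · intro d hd
    rw [mem_filter] at hd
    exact Nat.prod_primeFactors_of_squarefree hd.2
  · intro t ht
    rw [mem_powerset] at ht
    exact Nat.primeFactors_prod fun p hp => Nat.prime_of_mem_primeFactors (ht hp)
  · intro d _
    rfl

lemma sum_divisors_moebius_mul_prod_primeFactors {n : ℕ} (hn : n ≠ 0) (x : ℕ → ℝ) :
    ∑ d ∈ n.divisors, (ArithmeticFunction.moebius d : ℝ) * ∏ p ∈ d.primeFactors, x p =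
      ∏ p ∈ n.primeFactors, (1 - x p) := by
  have h1 : ∑ d ∈ n.divisors, (ArithmeticFunction.moebius d : ℝ) * ∏ p ∈ d.primeFactors, x p =
      ∑ d ∈ n.divisors with Squarefree d, ∏ p ∈ d.primeFactors, (-x p) := by
    rw [sum_filter]
    refine sum_congr rfl fun d _ => ?_
    split_ifs with h
    · rw [ArithmeticFunction.moebius_apply_of_squarefree h, prod_neg,
        (ArithmeticFunction.cardDistinctFactors_eq_cardFactors_iff_squarefree h.ne_zero).2 h |>.symm]
      push_cast
      rfl
    · rw [ArithmeticFunction.moebius_eq_zero_of_not_squarefree h]; simp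
  rw [h1, sum_squarefree_divisors_eq_sum_powerset hn (fun t => ∏ p ∈ t, (-x p)), ← prod_one_add]
  simp_rw [sub_eq_add_neg]

lemma prod_primeFactors_one_add_le_sum_divisors {n : ℕ} (hn : n ≠ 0) {x : ℕ → ℝ} (hx : ∀ p, 0 ≤ x p) :
    ∏ p ∈ n.primeFactors, (1 + x p) ≤ ∑ d ∈ n.divisors, ∏ p ∈ d.primeFactors, x p := by
  rw [prod_one_add, ← sum_squarefree_divisors_eq_sum_powerset hn (fun t => ∏ p ∈ t, x p)]
  exact sum_le_sum_of_subset_of_nonneg (filter_subset _ _) fun d _ _ => prod_nonneg fun p _ => hx p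

lemma tsum_prime_pow_le {b s : ℝ} (hb : 0 ≤ b) (hs : 1 / 4 ≤ s) {p : ℕ} (hp : p.Prime) :
    (Summable fun n : ℕ => (∏ _q ∈ (p ^ n).primeFactors, b) * ((p ^ n : ℕ) : ℝ) ^ (-s)) ∧
    ∑' n : ℕ, (∏ _q ∈ (p ^ n).primeFactors, b) * ((p ^ n : ℕ) : ℝ) ^ (-s) ≤
      1 + 7 * b * (p : ℝ) ^ (-s) := by
  have hp2 : (2 : ℝ) ≤ p := by exact_mod_cast hp.two_le
  set x : ℝ := (p : ℝ) ^ (-s) with hx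
  have hx0 : 0 < x := Real.rpow_pos_of_pos (by linarith) _
  have hx1 : x ≤ 6 / 7 := by
    calc x ≤ (2 : ℝ) ^ (-s) := Real.rpow_le_rpow_of_nonpos (by norm_num) hp2 (by linarith)
      _ ≤ (2 : ℝ) ^ (-(1 / 4) : ℝ) := Real.rpow_le_rpow_of_exponent_le (by norm_num) (by linarith)
      _ ≤ 6 / 7 := by
        have h4 : ((2 : ℝ) ^ (-(1 / 4) : ℝ)) ^ 4 = 1 / 2 := by
          rw [← Real.rpow_natCast ((2 : ℝ) ^ (-(1 / 4) : ℝ)) 4, ← Real.rpow_mul (by norm_num)]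
          norm_num
        refine le_of_pow_le_pow_left₀ (n := 4) (by norm_num) (by norm_num) ?_
        rw [h4]; norm_num
  have hterm : ∀ n : ℕ, (∏ q ∈ (p ^ (n + 1)).primeFactors, b) * ((p ^ (n + 1) : ℕ) : ℝ) ^ (-s) =
      b * x * x ^ n := by
    intro n
    rw [Nat.primeFactors_prime_pow n.succ_ne_zero hp, prod_singleton]
    push_cast
    rw [← Real.rpow_natCast (p : ℝ), ← Real.rpow_mul (by linarith), mul_comm ((n + 1 : ℕ) : ℝ),
      Real.rpow_mul (by linarith), Real.rpow_natCast, pow_succ]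
    ring
  have hgeo := summable_geometric_of_lt_one hx0.le (lt_of_le_of_lt hx1 (by norm_num))
  have hsum : Summable fun n : ℕ => (∏ _q ∈ (p ^ n).primeFactors, b) * ((p ^ n : ℕ) : ℝ) ^ (-s) := by
    rw [← summable_nat_add_iff 1]
    simp_rw [hterm]
    exact hgeo.mul_left _
  refine ⟨hsum, ?_⟩
  rw [hsum.tsum_eq_zero_add]
  simp_rw [hterm]
  rw [tsum_mul_left, tsum_geometric_of_lt_one hx0.le (lt_of_le_of_lt hx1 (by norm_num))]
  simp only [pow_zero, Nat.primeFactors_one, prod_empty, Nat.cast_one, Real.one_rpow, mul_one]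
  have h1 : (1 - x)⁻¹ ≤ 7 := by
    rw [inv_le_comm₀ (by linarith) (by norm_num)]; linarith
  have : b * x * (1 - x)⁻¹ ≤ b * x * 7 := by gcongr
  linarith

lemma sum_prod_primeFactors_mul_rpow_le {b : ℕ → ℝ} (hb : ∀ p, 0 ≤ b p) {s : ℝ} (hs : 1 / 4 ≤ s) (N : ℕ) :
    ∑ e ∈ Icc 1 N, (∏ p ∈ e.primeFactors, b p) * (e : ℝ) ^ (-s) ≤
      ∏ p ∈ (N + 1).primesBelow, (1 + 7 * b p * (p : ℝ) ^ (-s)) := by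
  set f : ℕ → ℝ := fun e => (∏ p ∈ e.primeFactors, b p) * (e : ℝ) ^ (-s) with hf
  have hf0 : ∀ e, 0 ≤ f e := fun e =>
    mul_nonneg (prod_nonneg fun p _ => hb p) (Real.rpow_nonneg (Nat.cast_nonneg _) _)
  have hpow : ∀ {p : ℕ}, p.Prime → ∀ n, f (p ^ n) =
      (∏ q ∈ (p ^ n).primeFactors, b p) * ((p ^ n : ℕ) : ℝ) ^ (-s) := by
    intro p hp n
    simp only [hf]
    congr 1
    refine prod_congr rfl fun q hq => ?_
    rw [(Nat.prime_dvd_prime_iff_eq (Nat.prime_of_mem_primeFactors hq) hp).1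
      ((Nat.prime_of_mem_primeFactors hq).dvd_of_dvd_pow (Nat.dvd_of_mem_primeFactors hq))]
  obtain ⟨h1, h2⟩ := EulerProduct.summable_and_hasSum_smoothNumbers_prod_primesBelow_tsum (f := f)
    (by simp [hf])
    (by
      intro m n hmn
      simp only [hf]
      rw [hmn.primeFactors_mul, prod_union hmn.disjoint_primeFactors, Nat.cast_mul,
        Real.mul_rpow (Nat.cast_nonneg _) (Nat.cast_nonneg _)]
      ring)
    (by
      intro p hp
      simp_rw [hpow hp]
      exact (tsum_prime_pow_le (hb p) hs hp).1.norm) (N + 1)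
  have h3 : ∑ e ∈ Icc 1 N, f e ≤ ∏ p ∈ (N + 1).primesBelow, ∑' n : ℕ, f (p ^ n) := by
    rw [← h2.tsum_eq]
    have hmem : ∀ e ∈ Icc 1 N, e ∈ (N + 1).smoothNumbers := fun e he => by
      rw [mem_Icc] at he
      exact Nat.mem_smoothNumbers_of_lt (by omega) (by omega)
    calc ∑ e ∈ Icc 1 N, f e = ∑ e ∈ (Icc 1 N).subtype (· ∈ (N + 1).smoothNumbers), f e := by
          rw [sum_subtype_of_mem f hmem]
      _ ≤ _ := h2.summable.sum_le_tsum _ fun e _ => hf0 e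
  refine h3.trans (prod_le_prod (fun p _ => tsum_nonneg fun n => hf0 _) fun p hp => ?_)
  have hp' := Nat.prime_of_mem_primesBelow hp
  simp_rw [hpow hp']
  exact (tsum_prime_pow_le (hb p) hs hp').2

lemma prod_one_add_rpow_le_exp {c s : ℝ} (hc : 0 ≤ c) (hs : 1 < s) (S : Finset ℕ) :
    ∏ p ∈ S, (1 + c * (p : ℝ) ^ (-s)) ≤ Real.exp (c * ∑' n : ℕ, (n : ℝ) ^ (-s)) := by
  have hsum := Real.summable_nat_rpow.2 (show -s < -1 by linarith)
  calc ∏ p ∈ S, (1 + c * (p : ℝ) ^ (-s)) ≤ ∏ p ∈ S, Real.exp (c * (p : ℝ) ^ (-s)) := by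
        refine prod_le_prod (fun p _ => by positivity) fun p _ => ?_
        rw [add_comm]; exact Real.add_one_le_exp _
    _ = Real.exp (c * ∑ p ∈ S, (p : ℝ) ^ (-s)) := by rw [← Real.exp_sum, mul_sum]
    _ ≤ _ := by
        refine Real.exp_le_exp.2 (mul_le_mul_of_nonneg_left ?_ hc)
        exact hsum.sum_le_tsum _ fun n _ => Real.rpow_nonneg (Nat.cast_nonneg _) _

lemma prod_le_prod_range_mul_prod {f g : ℕ → ℝ} {K : ℝ} (M : ℕ) (hK : 1 ≤ K) (hf : ∀ p, 0 ≤ f p)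
    (hg : ∀ p, 0 ≤ g p) (h1 : ∀ p, f p ≤ K * g p) (h2 : ∀ p, M ≤ p → f p ≤ g p) (S : Finset ℕ) :
    ∏ p ∈ S, f p ≤ K ^ M * ∏ p ∈ S, g p := by
  calc ∏ p ∈ S, f p ≤ ∏ p ∈ S, (if p < M then K else 1) * g p := by
        refine prod_le_prod (fun p _ => hf p) fun p _ => ?_
        split_ifs with h
        · exact h1 p
        · rw [one_mul]; exact h2 p (not_lt.1 h)
    _ = (∏ p ∈ S, if p < M then K else 1) * ∏ p ∈ S, g p := prod_mul_distrib
    _ ≤ _ := by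
        refine mul_le_mul_of_nonneg_right ?_ (prod_nonneg fun p _ => hg p)
        rw [prod_ite, prod_const_one, mul_one, prod_const]
        refine pow_le_pow_right₀ hK ?_
        calc _ ≤ #(range M) := card_le_card fun p hp => mem_range.2 (mem_filter.1 hp).2
          _ = M := card_range M

end EulerBounds

section MoebiusConvolution

lemma sum_moebius_mul_prod_primeFactors (α : ℕ → ℝ) (j : ℕ) :
    ∑ d ∈ Icc 1 j, (ArithmeticFunction.moebius d : ℝ) * ∏ p ∈ d.primeFactors, α p =
      ∑ e ∈ Icc 1 j, (∏ p ∈ e.primeFactors, (1 - p * α p)) / e *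
        ∑ n ∈ Icc 1 (j / e), (ArithmeticFunction.moebius n : ℝ) / n := by
  set H : ℕ → ℝ := fun e => ∏ p ∈ e.primeFactors, (1 - p * α p) with hH
  set f : ℕ → ℝ := fun d => (ArithmeticFunction.moebius d : ℝ) * ∏ p ∈ d.primeFactors, (p * α p)
    with hf
  have h1 := (ArithmeticFunction.sum_eq_iff_sum_mul_moebius_eq (f := f) (g := H)).1
    fun n hn => sum_divisors_moebius_mul_prod_primeFactors hn.ne' fun p => p * α p
  let F : ArithmeticFunction ℝ := ⟨fun n => H n / n, by simp⟩
  let G : ArithmeticFunction ℝ := ⟨fun n => (ArithmeticFunction.moebius n : ℝ) / n, by simp⟩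
  have hFG : ∀ d ∈ Ioc 0 j, (ArithmeticFunction.moebius d : ℝ) * ∏ p ∈ d.primeFactors, α p =
      (F * G) d := by
    intro d hd
    have hd0 : 0 < d := (mem_Ioc.1 hd).1
    have h2 : (F * G) d = f d / d := by
      rw [mul_comm, ArithmeticFunction.mul_apply, ← h1 d hd0, sum_div]
      refine sum_congr rfl fun x hx => ?_
      rw [Nat.mem_divisorsAntidiagonal] at hx
      change (ArithmeticFunction.moebius x.1 : ℝ) / x.1 * (H x.2 / x.2) = _
      rw [← hx.1, div_mul_div_comm, Nat.cast_mul]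
    rw [h2]
    by_cases hs : Squarefree d
    · have h3 : (∏ p ∈ d.primeFactors, (p : ℝ)) = d := by
        rw [← Nat.cast_prod, Nat.prod_primeFactors_of_squarefree hs]
      simp only [hf]
      rw [prod_mul_distrib, h3]
      field_simp
    · simp [hf, ArithmeticFunction.moebius_eq_zero_of_not_squarefree hs]
  have hI : ∀ N : ℕ, Icc 1 N = Ioc 0 N := fun N => by
    ext; simp [Nat.succ_le_iff]
  simp_rw [hI]
  rw [sum_congr rfl hFG, ArithmeticFunction.sum_Ioc_mul_eq_sum_sum]
  rfl

lemma abs_sum_moebius_mul_prod_primeFactors_le {c C : ℝ} (hC : 0 < C)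
    (h : ∀ j e : ℕ, 1 ≤ j → 1 ≤ e →
      |∑ n ∈ Icc 1 (j / e), (ArithmeticFunction.moebius n : ℝ) / n| ≤
        C * (e : ℝ) ^ (1 / 8 : ℝ) * curlyL (max 3 (2 * j)) ^ (-c))
    (α : ℕ → ℝ) {j : ℕ} (hj : 1 ≤ j) :
    |∑ d ∈ Icc 1 j, (ArithmeticFunction.moebius d : ℝ) * ∏ p ∈ d.primeFactors, α p| ≤
      C * curlyL (max 3 (2 * j)) ^ (-c) *
        ∏ p ∈ (j + 1).primesBelow, (1 + 7 * |1 - p * α p| * (p : ℝ) ^ (-(7 / 8) : ℝ)) := by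
  rw [sum_moebius_mul_prod_primeFactors]
  have hL : 0 ≤ curlyL (max 3 (2 * j)) ^ (-c) := Real.rpow_nonneg (Real.exp_pos _).le _
  calc _ ≤ ∑ e ∈ Icc 1 j, |(∏ p ∈ e.primeFactors, (1 - p * α p)) / e *
        ∑ n ∈ Icc 1 (j / e), (ArithmeticFunction.moebius n : ℝ) / n| := abs_sum_le_sum_abs _ _
    _ ≤ ∑ e ∈ Icc 1 j, C * curlyL (max 3 (2 * j)) ^ (-c) *
        ((∏ p ∈ e.primeFactors, |1 - p * α p|) * (e : ℝ) ^ (-(7 / 8) : ℝ)) := by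
        refine sum_le_sum fun e he => ?_
        have he1 : 1 ≤ e := (mem_Icc.1 he).1
        have he0 : (0 : ℝ) < e := by exact_mod_cast he1
        rw [abs_mul, abs_div, abs_prod, Nat.abs_cast]
        have h8 : (e : ℝ) ^ (-(7 / 8) : ℝ) = (e : ℝ) ^ (1 / 8 : ℝ) / e := by
          rw [← Real.rpow_sub_one he0.ne']; norm_num
        rw [h8]
        calc _ ≤ (∏ p ∈ e.primeFactors, |1 - p * α p|) / e *
              (C * (e : ℝ) ^ (1 / 8 : ℝ) * curlyL (max 3 (2 * j)) ^ (-c)) :=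
              mul_le_mul_of_nonneg_left (h j e hj he1)
                (div_nonneg (prod_nonneg fun _ _ => abs_nonneg _) he0.le)
          _ = _ := by ring
    _ = C * curlyL (max 3 (2 * j)) ^ (-c) *
        ∑ e ∈ Icc 1 j, (∏ p ∈ e.primeFactors, |1 - p * α p|) * (e : ℝ) ^ (-(7 / 8) : ℝ) := by
        rw [mul_sum]
    _ ≤ _ := mul_le_mul_of_nonneg_left
        (sum_prod_primeFactors_mul_rpow_le (fun _ => abs_nonneg _) (by norm_num) j)
        (mul_nonneg hC.le hL)

end MoebiusConvolution

section LocalFactors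

/-- The value at the prime `p` of the multiplicative weight attached to `δ` and `m`. -/
noncomputable def localWeight (m δ p : ℕ) : ℝ :=
  if p ∣ δ then 0 else if p ∣ m then 1 else 1 / ((p : ℝ) + 1)

lemma moebius_mul_div_psiM (m : ℕ) {d : ℕ} (hd : d ≠ 0) (δ : ℕ) :
    (ArithmeticFunction.moebius (d * δ) : ℝ) / (psiM m d : ℝ) =
      ArithmeticFunction.moebius δ *
        ((ArithmeticFunction.moebius d : ℝ) * ∏ p ∈ d.primeFactors, localWeight m δ p) := by
  by_cases h : Nat.Coprime d δ
  · have h1 : ∏ p ∈ d.primeFactors, localWeight m δ p = ((psiM m d : ℕ) : ℝ)⁻¹ := by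
      rw [psiM, Nat.cast_prod, ← prod_inv_distrib, prod_filter]
      refine prod_congr rfl fun p hp => ?_
      have hpd : ¬ p ∣ δ := fun hpδ =>
        (Nat.prime_of_mem_primeFactors hp).one_lt.ne'
          (Nat.eq_one_of_dvd_coprimes h (Nat.dvd_of_mem_primeFactors hp) hpδ)
      rw [localWeight, if_neg hpd]
      by_cases hm : p ∣ m
      · simp [hm]
      · simp [hm]
    rw [h1, ArithmeticFunction.isMultiplicative_moebius.map_mul_of_coprime h]
    push_cast
    ring
  · obtain ⟨p, hp, hpd, hpδ⟩ := Nat.Prime.not_coprime_iff_dvd.1 h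
    have h1 : ∏ p ∈ d.primeFactors, localWeight m δ p = 0 :=
      prod_eq_zero (Nat.mem_primeFactors.2 ⟨hp, hpd, hd⟩) (if_pos hpδ)
    have h2 : ¬ Squarefree (d * δ) := fun hs =>
      h (Nat.squarefree_mul_iff.1 hs).1
    rw [h1, ArithmeticFunction.moebius_eq_zero_of_not_squarefree h2]
    simp

lemma sq_sum_moebius_mul_div_psiM_le (m δ j : ℕ) :
    (∑ d ∈ Icc 1 j, (ArithmeticFunction.moebius (d * δ) : ℝ) / (psiM m d : ℝ)) ^ 2 ≤
      |∑ d ∈ Icc 1 j, (ArithmeticFunction.moebius d : ℝ) *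
        ∏ p ∈ d.primeFactors, localWeight m δ p| ^ 2 := by
  rw [sum_congr rfl fun d hd => moebius_mul_div_psiM m
    (Nat.one_le_iff_ne_zero.1 (mem_Icc.1 hd).1) δ, ← mul_sum, mul_pow, sq_abs]
  refine mul_le_of_le_one_left (sq_nonneg _) ?_
  rw [← sq_abs]
  refine pow_le_one₀ (abs_nonneg _) ?_
  exact_mod_cast ArithmeticFunction.abs_moebius_le_one (n := δ)

lemma prod_ite_dvd_le {f : ℕ → ℝ} (hf : ∀ p, 1 ≤ f p) {n : ℕ} (hn : n ≠ 0) (N : ℕ) :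
    ∏ p ∈ N.primesBelow, (if p ∣ n then f p else 1) ≤ ∏ p ∈ n.primeFactors, f p := by
  rw [← prod_filter]
  refine prod_le_prod_of_subset_of_one_le (fun p hp => ?_)
    (fun p _ => zero_le_one.trans (hf p)) fun p _ _ => hf p
  rw [mem_filter] at hp
  exact Nat.mem_primeFactors.2 ⟨Nat.prime_of_mem_primesBelow hp.1, hp.2, hn⟩

lemma one_add_localWeight_le (m δ : ℕ) {p : ℕ} (hp : p.Prime) :
    1 + 7 * |1 - p * localWeight m δ p| * (p : ℝ) ^ (-(7 / 8) : ℝ) ≤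
      (1 + 7 * (p : ℝ) ^ (-(15 / 8) : ℝ)) *
        ((if p ∣ δ then 1 + 7 * (p : ℝ) ^ (-(7 / 8) : ℝ) else 1) *
          (if p ∣ m then 1 + 7 * (p : ℝ) ^ (1 / 8 : ℝ) else 1)) := by
  have hp0 : (0 : ℝ) < p := by exact_mod_cast hp.pos
  have hp1 : (1 : ℝ) ≤ p := by exact_mod_cast hp.one_lt.le
  have hx : 0 < (p : ℝ) ^ (-(7 / 8) : ℝ) := Real.rpow_pos_of_pos hp0 _
  have hz : 0 < (p : ℝ) ^ (-(15 / 8) : ℝ) := Real.rpow_pos_of_pos hp0 _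
  have hw : 0 < (p : ℝ) ^ (1 / 8 : ℝ) := Real.rpow_pos_of_pos hp0 _
  have hzx : (p : ℝ) ^ (-(15 / 8) : ℝ) = (p : ℝ) ^ (-(7 / 8) : ℝ) / p := by
    rw [← Real.rpow_sub_one hp0.ne']; norm_num
  have hwx : (p : ℝ) ^ (1 / 8 : ℝ) = (p : ℝ) ^ (-(7 / 8) : ℝ) * p := by
    rw [← Real.rpow_add_one hp0.ne']; norm_num
  have key : ∀ t A B : ℝ, 0 ≤ A → 0 ≤ B → 0 ≤ t → (t ≤ A ∨ t ≤ B ∨ t ≤ (p : ℝ) ^ (-(15 / 8) : ℝ)) →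
      1 + 7 * t ≤ (1 + 7 * (p : ℝ) ^ (-(15 / 8) : ℝ)) * ((1 + 7 * A) * (1 + 7 * B)) := by
    intro t A B hA hB ht h
    have h1 : 0 ≤ A * B := mul_nonneg hA hB
    have h2 := mul_nonneg hz.le hA
    have h3 := mul_nonneg hz.le hB
    have h4 := mul_nonneg hz.le h1
    have e : (1 + 7 * (p : ℝ) ^ (-(15 / 8) : ℝ)) * ((1 + 7 * A) * (1 + 7 * B)) =
      1 + 7 * A + 7 * B + 7 * (p : ℝ) ^ (-(15 / 8) : ℝ) + 49 * (A * B) +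
        49 * ((p : ℝ) ^ (-(15 / 8) : ℝ) * A) + 49 * ((p : ℝ) ^ (-(15 / 8) : ℝ) * B) +
        343 * ((p : ℝ) ^ (-(15 / 8) : ℝ) * (A * B)) := by ring
    rw [e]
    rcases h with h | h | h <;> linarith
  have hite : ∀ (P : Prop) [Decidable P] (A : ℝ),
      (if P then 1 + 7 * A else 1) = 1 + 7 * (if P then A else 0) := by
    intro P _ A; split_ifs <;> simp
  rw [hite, hite, mul_assoc 7]
  refine key _ _ _ (by split_ifs <;> positivity) (by split_ifs <;> positivity) (by positivity) ?_
  by_cases h1 : p ∣ δ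
  · left; simp [localWeight, h1]
  · by_cases h2 : p ∣ m
    · right; left
      simp only [localWeight, h1, h2, if_true, if_false, mul_one]
      rw [hwx, mul_comm, abs_sub_comm, abs_of_nonneg (by linarith)]
      gcongr
      linarith
    · right; right
      simp only [localWeight, h1, h2, if_false]
      have : 1 - (p : ℝ) * (1 / ((p : ℝ) + 1)) = 1 / ((p : ℝ) + 1) := by field_simp; ring
      rw [this, hzx, abs_of_pos (by positivity), div_mul_eq_mul_div, one_mul]
      gcongr
      linarith

lemma prod_one_add_localWeight_le {m δ : ℕ} (hm : m ≠ 0) (hδ : δ ≠ 0) (N : ℕ) :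
    ∏ p ∈ N.primesBelow,
        (1 + 7 * |1 - p * localWeight m δ p| * (p : ℝ) ^ (-(7 / 8) : ℝ)) ≤
      Real.exp (7 * ∑' n : ℕ, (n : ℝ) ^ (-(15 / 8) : ℝ)) *
        ((∏ p ∈ δ.primeFactors, (1 + 7 * (p : ℝ) ^ (-(7 / 8) : ℝ))) *
          ∏ p ∈ m.primeFactors, (1 + 7 * (p : ℝ) ^ (1 / 8 : ℝ))) := by
  have hone : ∀ (s : ℝ) (p : ℕ), 1 ≤ 1 + 7 * (p : ℝ) ^ s := fun s p => by
    have := Real.rpow_nonneg (Nat.cast_nonneg (α := ℝ) p) s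
    linarith
  calc _ ≤ ∏ p ∈ N.primesBelow, ((1 + 7 * (p : ℝ) ^ (-(15 / 8) : ℝ)) *
        ((if p ∣ δ then 1 + 7 * (p : ℝ) ^ (-(7 / 8) : ℝ) else 1) *
          (if p ∣ m then 1 + 7 * (p : ℝ) ^ (1 / 8 : ℝ) else 1))) :=
        prod_le_prod (fun p _ => by positivity) fun p hp =>
          one_add_localWeight_le m δ (Nat.prime_of_mem_primesBelow hp)
    _ = (∏ p ∈ N.primesBelow, (1 + 7 * (p : ℝ) ^ (-(15 / 8) : ℝ))) *
        ((∏ p ∈ N.primesBelow, if p ∣ δ then 1 + 7 * (p : ℝ) ^ (-(7 / 8) : ℝ) else 1) *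
          ∏ p ∈ N.primesBelow, if p ∣ m then 1 + 7 * (p : ℝ) ^ (1 / 8 : ℝ) else 1) := by
        rw [prod_mul_distrib, prod_mul_distrib]
    _ ≤ _ := by
        have hnn : ∀ (s : ℝ) (n : ℕ), 0 ≤ ∏ p ∈ N.primesBelow,
            if p ∣ n then 1 + 7 * (p : ℝ) ^ s else 1 := fun s n => prod_nonneg fun p _ => by
          split_ifs
          · exact zero_le_one.trans (hone s p)
          · exact zero_le_one
        refine mul_le_mul (prod_one_add_rpow_le_exp (by norm_num) (by norm_num) _)
          (mul_le_mul (prod_ite_dvd_le (hone _) hδ N) (prod_ite_dvd_le (hone _) hm N) (hnn _ _)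
            (prod_nonneg fun p _ => zero_le_one.trans (hone _ p)))
          (mul_nonneg (hnn _ _) (hnn _ _)) (Real.exp_pos _).le

lemma exists_sq_prod_primeFactors_le_sqrt_psi : ∃ K > (0 : ℝ), ∀ m : ℕ,
    (∏ p ∈ m.primeFactors, (1 + 7 * (p : ℝ) ^ (1 / 8 : ℝ))) ^ 2 ≤ K * Real.sqrt (psi m) := by
  refine ⟨64 ^ (2 ^ 24), pow_pos (by norm_num) _, fun m => ?_⟩
  have hsq : Real.sqrt (psi m) = ∏ p ∈ m.primeFactors, Real.sqrt ((p : ℝ) + 1) := by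
    rw [psi, Nat.cast_prod, Real.sqrt_prod _ (fun p _ => Nat.cast_nonneg _)]
    push_cast
    rfl
  have h18 : ∀ p : ℕ, ((p : ℝ) ^ (1 / 8 : ℝ)) ^ 4 = Real.sqrt p := fun p => by
    rw [← Real.rpow_natCast ((p : ℝ) ^ (1 / 8 : ℝ)) 4, ← Real.rpow_mul (Nat.cast_nonneg _),
      Real.sqrt_eq_rpow]
    norm_num
  have hw : ∀ p : ℕ, 0 ≤ (p : ℝ) ^ (1 / 8 : ℝ) := fun p => Real.rpow_nonneg (Nat.cast_nonneg _) _
  have hs : ∀ p : ℕ, Real.sqrt p ≤ Real.sqrt ((p : ℝ) + 1) := fun p =>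
    Real.sqrt_le_sqrt (by linarith)
  rw [hsq, ← prod_pow]
  refine prod_le_prod_range_mul_prod (K := 64) (2 ^ 24)
    (f := fun p => (1 + 7 * (p : ℝ) ^ (1 / 8 : ℝ)) ^ 2) (g := fun p => Real.sqrt ((p : ℝ) + 1))
    (by norm_num) (fun p => sq_nonneg _) (fun p => Real.sqrt_nonneg _) ?_ ?_ _
  · intro p
    have h1 : 1 ≤ Real.sqrt ((p : ℝ) + 1) := by
      rw [Real.one_le_sqrt]
      have := Nat.cast_nonneg (α := ℝ) p
      linarith
    have h2 := (h18 p).trans_le (hs p)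
    set w := (p : ℝ) ^ (1 / 8 : ℝ)
    rcases le_total w 1 with h | h
    · nlinarith [hw p]
    · have h3 : w ^ 2 ≤ w ^ 4 := pow_le_pow_right₀ h (by norm_num)
      nlinarith [hw p]
  · intro p hp
    refine le_trans ?_ (hs p)
    rw [← h18 p]
    have h8 : (8 : ℝ) ≤ (p : ℝ) ^ (1 / 8 : ℝ) := by
      have : (8 : ℝ) = ((2 : ℝ) ^ (24 : ℕ)) ^ (1 / 8 : ℝ) := by
        rw [← Real.rpow_natCast (2 : ℝ) 24, ← Real.rpow_mul (by norm_num)]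
        norm_num
      have hp' : (2 : ℝ) ^ (24 : ℕ) ≤ p := by exact_mod_cast hp
      exact this.trans_le (Real.rpow_le_rpow (by positivity) hp' (by norm_num))
    set w := (p : ℝ) ^ (1 / 8 : ℝ)
    have h3 : 1 + 7 * w ≤ w ^ 2 := by nlinarith
    calc (1 + 7 * w) ^ 2 ≤ (w ^ 2) ^ 2 := by gcongr
      _ = w ^ 4 := by ring

end LocalFactors

section Average

lemma card_filter_dvd_Ioc_le {A B : ℕ} (hAB : A ≤ B) (d : ℕ) :
    (#{δ ∈ Ioc A B | d ∣ δ} : ℝ) ≤ ((B : ℝ) - A) / d + 1 := by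
  have h1 : #{δ ∈ Ioc 0 A | d ∣ δ} + #{δ ∈ Ioc A B | d ∣ δ} = #{δ ∈ Ioc 0 B | d ∣ δ} := by
    rw [← card_union_of_disjoint, ← filter_union, Ioc_union_Ioc_eq_Ioc (Nat.zero_le _) hAB]
    exact disjoint_filter_filter (Ioc_disjoint_Ioc_of_le le_rfl)
  rw [Nat.Ioc_filter_dvd_card_eq_div, Nat.Ioc_filter_dvd_card_eq_div] at h1
  have h2 : ((A / d : ℕ) : ℝ) + #{δ ∈ Ioc A B | d ∣ δ} = (B / d : ℕ) := by exact_mod_cast h1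
  have h3 : ((B / d : ℕ) : ℝ) ≤ B / d := Nat.cast_div_le
  have h4 : (A : ℝ) / d < (A / d : ℕ) + 1 := by
    rw [← Nat.floor_div_eq_div (K := ℝ)]
    exact Nat.lt_floor_add_one _
  rw [sub_div]
  linarith

lemma sum_sum_divisors_le {g : ℕ → ℝ} (hg : ∀ d, 0 ≤ g d) {A B : ℕ} (hAB : A ≤ B) :
    ∑ δ ∈ Ioc A B, ∑ d ∈ δ.divisors, g d ≤
      ∑ d ∈ Icc 1 B, g d * (((B : ℝ) - A) / d + 1) := by
  have h1 : ∀ δ ∈ Ioc A B, ∑ d ∈ δ.divisors, g d = ∑ d ∈ Icc 1 B, if d ∣ δ then g d else 0 := by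
    intro δ hδ
    rw [mem_Ioc] at hδ
    rw [← sum_filter]
    refine sum_congr ?_ fun _ _ => rfl
    ext d
    simp only [Nat.mem_divisors, mem_filter, mem_Icc]
    refine ⟨fun h => ⟨⟨Nat.pos_of_dvd_of_pos h.1 (by omega),
      (Nat.le_of_dvd (by omega) h.1).trans hδ.2⟩, h.1⟩, fun h => ⟨h.2, by omega⟩⟩
  rw [sum_congr rfl h1, sum_comm]
  refine sum_le_sum fun d _ => ?_
  rw [← sum_filter, sum_const, nsmul_eq_mul, mul_comm]
  exact mul_le_mul_of_nonneg_left (card_filter_dvd_Ioc_le hAB d) (hg d)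

lemma exists_sum_inv_mul_sq_prod_le : ∃ K > (0 : ℝ), ∀ y : ℝ, 3 ≤ y → ∀ j : ℕ, 1 ≤ j →
    (j : ℝ) ≤ y ^ (1 / 4 : ℝ) →
    ∑ δ ∈ Ioc ⌊y / ((j : ℝ) + 1)⌋₊ ⌊y / (j : ℝ)⌋₊,
      1 / (δ : ℝ) * (∏ p ∈ δ.primeFactors, (1 + 7 * (p : ℝ) ^ (-(7 / 8) : ℝ))) ^ 2 ≤ K / j := by
  set G := Real.exp (441 * ∑' n : ℕ, (n : ℝ) ^ (-(9 / 8) : ℝ)) with hG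
  have hG0 : 0 < G := Real.exp_pos _
  refine ⟨5 * G, by positivity, fun y hy j hj hjy => ?_⟩
  set A := ⌊y / ((j : ℝ) + 1)⌋₊ with hA
  set B := ⌊y / (j : ℝ)⌋₊ with hB
  have hj1 : (1 : ℝ) ≤ j := by exact_mod_cast hj
  have hAB : A ≤ B := Nat.floor_le_floor (by gcongr; linarith)
  set g : ℕ → ℝ := fun d => ∏ p ∈ d.primeFactors, (63 * (p : ℝ) ^ (-(7 / 8) : ℝ)) with hg
  have hg0 : ∀ d, 0 ≤ g d := fun d => prod_nonneg fun p _ => by positivity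
  have hR : ∀ δ : ℕ, δ ≠ 0 → (∏ p ∈ δ.primeFactors, (1 + 7 * (p : ℝ) ^ (-(7 / 8) : ℝ))) ^ 2 ≤
      ∑ d ∈ δ.divisors, g d := by
    intro δ hδ
    refine le_trans ?_ (prod_primeFactors_one_add_le_sum_divisors hδ fun p => by positivity)
    rw [← prod_pow]
    refine prod_le_prod (fun p _ => sq_nonneg _) fun p hp => ?_
    have hp1 : (1 : ℝ) ≤ p := by exact_mod_cast (Nat.prime_of_mem_primeFactors hp).one_lt.le
    have hx1 : (p : ℝ) ^ (-(7 / 8) : ℝ) ≤ 1 := Real.rpow_le_one_of_one_le_of_nonpos hp1 (by norm_num)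
    have hx0 : 0 ≤ (p : ℝ) ^ (-(7 / 8) : ℝ) := by positivity
    nlinarith
  have hsum : ∑ d ∈ Icc 1 B, g d * (d : ℝ) ^ (-(1 / 4) : ℝ) ≤ G := by
    refine (sum_prod_primeFactors_mul_rpow_le (fun p => by positivity) le_rfl B).trans ?_
    refine le_trans (le_of_eq (prod_congr rfl fun p hp => ?_))
      (prod_one_add_rpow_le_exp (c := 441) (s := 9 / 8) (by norm_num) (by norm_num) _)
    have hp0 : (0 : ℝ) < p := by exact_mod_cast (Nat.prime_of_mem_primesBelow hp).pos
    have : (p : ℝ) ^ (-(9 / 8) : ℝ) = (p : ℝ) ^ (-(7 / 8) : ℝ) * (p : ℝ) ^ (-(1 / 4) : ℝ) := by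
      rw [← Real.rpow_add hp0]; norm_num
    rw [this]
    ring
  set u := y ^ (1 / 4 : ℝ) with hu
  have hu4 : u ^ 4 = y := by
    rw [hu, ← Real.rpow_natCast (y ^ (1 / 4 : ℝ)) 4, ← Real.rpow_mul (by linarith)]
    norm_num
  have hu1 : 1 ≤ u := hj1.trans hjy
  have hy0 : 0 < y := by linarith
  have hBu : (B : ℝ) ^ (1 / 4 : ℝ) ≤ u := by
    refine Real.rpow_le_rpow (Nat.cast_nonneg _) ?_ (by norm_num)
    exact (Nat.floor_le (by positivity)).trans (div_le_self hy0.le hj1)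
  have hlen : (B : ℝ) - A ≤ y / (j * (j + 1)) + 1 := by
    have h1 : (B : ℝ) ≤ y / j := Nat.floor_le (by positivity)
    have h2 : y / ((j : ℝ) + 1) < A + 1 := Nat.lt_floor_add_one _
    have h3 : y / j - y / ((j : ℝ) + 1) = y / (j * (j + 1)) := by field_simp; ring
    linarith
  have hlen0 : 0 ≤ (B : ℝ) - A := sub_nonneg.2 (by exact_mod_cast hAB)
  have hT : ∑ d ∈ Icc 1 B, g d * (((B : ℝ) - A) / d + 1) ≤
      (y / (j * (j + 1)) + 1 + u) * G := by
    calc _ ≤ ∑ d ∈ Icc 1 B, (y / (j * (j + 1)) + 1 + u) * (g d * (d : ℝ) ^ (-(1 / 4) : ℝ)) := by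
          refine sum_le_sum fun d hd => ?_
          rw [mem_Icc] at hd
          have hd1 : (1 : ℝ) ≤ d := by exact_mod_cast hd.1
          have hd0 : (0 : ℝ) < d := by linarith
          have hdB : (d : ℝ) ≤ B := by exact_mod_cast hd.2
          have h1 : 1 / (d : ℝ) ≤ (d : ℝ) ^ (-(1 / 4) : ℝ) := by
            rw [one_div, ← Real.rpow_neg_one]
            exact Real.rpow_le_rpow_of_exponent_le hd1 (by norm_num)
          have h2 : 1 ≤ u * (d : ℝ) ^ (-(1 / 4) : ℝ) := by
            rw [Real.rpow_neg hd0.le, ← div_eq_mul_inv, one_le_div (by positivity)]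
            exact (Real.rpow_le_rpow hd0.le hdB (by norm_num)).trans hBu
          have h3 : ((B : ℝ) - A) / d + 1 ≤
              (y / (j * (j + 1)) + 1 + u) * (d : ℝ) ^ (-(1 / 4) : ℝ) := by
            rw [add_mul]
            refine add_le_add ?_ h2
            rw [div_eq_mul_one_div]
            exact mul_le_mul hlen h1 (by positivity) (hlen0.trans hlen)
          calc g d * (((B : ℝ) - A) / d + 1) ≤
              g d * ((y / (j * (j + 1)) + 1 + u) * (d : ℝ) ^ (-(1 / 4) : ℝ)) :=
              mul_le_mul_of_nonneg_left h3 (hg0 d)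
            _ = _ := by ring
      _ = (y / (j * (j + 1)) + 1 + u) * ∑ d ∈ Icc 1 B, g d * (d : ℝ) ^ (-(1 / 4) : ℝ) := by
          rw [mul_sum]
      _ ≤ _ := by gcongr
  have hfin : ((j : ℝ) + 1) / y * (y / (j * (j + 1)) + 1 + u) ≤ 5 / j := by
    have h1 : ((j : ℝ) + 1) / y * (y / (j * (j + 1))) = 1 / j := by field_simp
    have h2 : ((j : ℝ) + 1) / y * (1 + u) ≤ 4 / j := by
      rw [div_mul_eq_mul_div, div_le_div_iff₀ hy0 (by linarith), ← hu4]
      have h3 : ((j : ℝ) + 1) * (1 + u) ≤ (2 * u) * (2 * u) := by gcongr <;> linarith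
      have h4 : ((j : ℝ) + 1) * (1 + u) * j ≤ (2 * u) * (2 * u) * u := by gcongr
      have h5 : u ^ 3 ≤ u ^ 4 := pow_le_pow_right₀ hu1 (by norm_num)
      nlinarith
    calc _ = ((j : ℝ) + 1) / y * (y / (j * (j + 1))) + ((j : ℝ) + 1) / y * (1 + u) := by ring
      _ ≤ 1 / j + 4 / j := by rw [h1]; gcongr
      _ = 5 / j := by ring
  calc _ ≤ ∑ δ ∈ Ioc A B, ((j : ℝ) + 1) / y * ∑ d ∈ δ.divisors, g d := by
        refine sum_le_sum fun δ hδ => ?_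
        rw [mem_Ioc] at hδ
        have hδ0 : δ ≠ 0 := by omega
        have h1 : y / ((j : ℝ) + 1) < δ := (Nat.floor_lt (by positivity)).1 hδ.1
        refine mul_le_mul ?_ (hR δ hδ0) (sq_nonneg _) (by positivity)
        exact (one_div_le_one_div_of_le (by positivity) h1.le).trans_eq (one_div_div _ _)
    _ = ((j : ℝ) + 1) / y * ∑ δ ∈ Ioc A B, ∑ d ∈ δ.divisors, g d := by rw [mul_sum]
    _ ≤ ((j : ℝ) + 1) / y * ((y / (j * (j + 1)) + 1 + u) * G) := by
        gcongr
        exact (sum_sum_divisors_le hg0 hAB).trans hT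
    _ = ((j : ℝ) + 1) / y * (y / (j * (j + 1)) + 1 + u) * G := by ring
    _ ≤ 5 / j * G := by gcongr
    _ = 5 * G / j := by ring

lemma mul_moebius_sq_div_psi_sq_le (δ : ℕ) :
    (δ : ℝ) * (ArithmeticFunction.moebius δ : ℝ) ^ 2 / (psi δ : ℝ) ^ 2 ≤ 1 / δ := by
  by_cases h : Squarefree δ
  · have h0 : (0 : ℝ) < δ := by exact_mod_cast Nat.pos_of_ne_zero h.ne_zero
    have h1 : (δ : ℝ) ≤ psi δ := by
      rw [psi]
      conv_lhs => rw [← Nat.prod_primeFactors_of_squarefree h]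
      exact_mod_cast prod_le_prod' fun p _ => Nat.le_succ p
    have h2 : (ArithmeticFunction.moebius δ : ℝ) ^ 2 = 1 := by
      exact_mod_cast ArithmeticFunction.moebius_sq_eq_one_of_squarefree h
    rw [h2, mul_one, div_le_div_iff₀ (by nlinarith) h0]
    nlinarith
  · rw [ArithmeticFunction.moebius_eq_zero_of_not_squarefree h]
    simp

end Average

theorem stmt11 :
    ∃ c > (0 : ℝ), ∃ C > (0 : ℝ), ∀ m : ℕ, 1 ≤ m → ∀ y : ℝ, 3 ≤ y →
      ∀ j : ℕ, 1 ≤ j → (j : ℝ) ≤ y ^ ((1 : ℝ) / 4) →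
        |∑ δ ∈ (Finset.Ioc ⌊y / ((j : ℝ) + 1)⌋₊ ⌊y / (j : ℝ)⌋₊).filter
              (fun δ : ℕ => Nat.gcd δ m = 1),
            ((δ : ℝ) * (ArithmeticFunction.moebius δ : ℝ) ^ 2 / (psi δ : ℝ) ^ 2) *
              (∑ d ∈ Finset.Icc 1 j,
                (ArithmeticFunction.moebius (d * δ) : ℝ) / (psiM m d : ℝ)) ^ 2| ≤
          C * Real.sqrt (psi m) / ((j : ℝ) * (curlyL (max 3 (2 * (j : ℝ)))) ^ (2 * c)) := by
  obtain ⟨c, C, hc, hC, hmain⟩ := exists_abs_sum_moebius_div_le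
  obtain ⟨K, hK, hpsi⟩ := exists_sq_prod_primeFactors_le_sqrt_psi
  obtain ⟨K', hK', havg⟩ := exists_sum_inv_mul_sq_prod_le
  set E := Real.exp (7 * ∑' n : ℕ, (n : ℝ) ^ (-(15 / 8) : ℝ)) with hE
  have hE0 : 0 < E := Real.exp_pos _
  refine ⟨c, hc, C ^ 2 * E ^ 2 * K * K', by positivity, fun m hm y hy j hj hjy => ?_⟩
  set L := curlyL (max 3 (2 * (j : ℝ))) with hL
  have hL0 : 0 < L := Real.exp_pos _
  set P := ∏ p ∈ m.primeFactors, (1 + 7 * (p : ℝ) ^ (1 / 8 : ℝ)) with hP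
  have hinner : ∀ δ : ℕ, δ ≠ 0 → (∑ d ∈ Icc 1 j,
      (ArithmeticFunction.moebius (d * δ) : ℝ) / (psiM m d : ℝ)) ^ 2 ≤
      C ^ 2 * E ^ 2 * K * Real.sqrt (psi m) * (L ^ (2 * c))⁻¹ *
        (∏ p ∈ δ.primeFactors, (1 + 7 * (p : ℝ) ^ (-(7 / 8) : ℝ))) ^ 2 := by
    intro δ hδ
    set R := ∏ p ∈ δ.primeFactors, (1 + 7 * (p : ℝ) ^ (-(7 / 8) : ℝ)) with hR
    have hLc : 0 < L ^ (-c) := Real.rpow_pos_of_pos hL0 _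
    have hL2 : (L ^ (2 * c))⁻¹ = (L ^ (-c)) ^ 2 := by
      rw [← Real.rpow_neg hL0.le, ← Real.rpow_natCast (L ^ (-c)) 2, ← Real.rpow_mul hL0.le]
      congr 1
      push_cast
      ring
    have h1 := (abs_sum_moebius_mul_prod_primeFactors_le hC hmain (localWeight m δ) hj).trans
      (mul_le_mul_of_nonneg_left (prod_one_add_localWeight_le (by omega : m ≠ 0) hδ (j + 1))
        (mul_pos hC hLc).le)
    calc _ ≤ _ := sq_sum_moebius_mul_div_psiM_le m δ j
      _ ≤ (C * L ^ (-c) * (E * (R * P))) ^ 2 := by gcongr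
      _ = C ^ 2 * E ^ 2 * (L ^ (-c)) ^ 2 * R ^ 2 * P ^ 2 := by ring
      _ ≤ C ^ 2 * E ^ 2 * (L ^ (-c)) ^ 2 * R ^ 2 * (K * Real.sqrt (psi m)) := by
          gcongr
          exact hpsi m
      _ = _ := by rw [hL2]; ring
  rw [abs_of_nonneg (sum_nonneg fun δ _ => by positivity)]
  calc _ ≤ ∑ δ ∈ Ioc ⌊y / ((j : ℝ) + 1)⌋₊ ⌊y / (j : ℝ)⌋₊,
        ((δ : ℝ) * (ArithmeticFunction.moebius δ : ℝ) ^ 2 / (psi δ : ℝ) ^ 2) *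
          (∑ d ∈ Icc 1 j, (ArithmeticFunction.moebius (d * δ) : ℝ) / (psiM m d : ℝ)) ^ 2 :=
        sum_le_sum_of_subset_of_nonneg (filter_subset _ _) fun δ _ _ => by positivity
    _ ≤ ∑ δ ∈ Ioc ⌊y / ((j : ℝ) + 1)⌋₊ ⌊y / (j : ℝ)⌋₊,
        C ^ 2 * E ^ 2 * K * Real.sqrt (psi m) * (L ^ (2 * c))⁻¹ *
          (1 / (δ : ℝ) * (∏ p ∈ δ.primeFactors, (1 + 7 * (p : ℝ) ^ (-(7 / 8) : ℝ))) ^ 2) := by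
        refine sum_le_sum fun δ hδ => ?_
        have hδ0 : δ ≠ 0 := by rw [mem_Ioc] at hδ; omega
        refine (mul_le_mul (mul_moebius_sq_div_psi_sq_le δ) (hinner δ hδ0) (sq_nonneg _)
          (by positivity)).trans_eq ?_
        ring
    _ ≤ C ^ 2 * E ^ 2 * K * Real.sqrt (psi m) * (L ^ (2 * c))⁻¹ * (K' / j) := by
        rw [← mul_sum]
        exact mul_le_mul_of_nonneg_left (havg y hy j hj hjy) (by positivity)
    _ = _ := by field_simp
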